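/- Let (A, 𝔪, k) be a commutative Noetherian local ring, let M be a finitely generated A-module of finite complete intersection dimension, and let t be a natural number. If for every finitely generated A-module N of finite complete intersection dimension with cx N = t one has Ext^i_A(M,N) = 0 for all i ≫ 0, then cx M < t. In particular, M has finite projective dimension if and only if Ext^i_A(M,N) = 0 for every N of finite complete intersection dimension with cx N = 1 and all i ≫ 0. -/

import Mathlib

open CategoryTheory Opposite Filter IsLocalRing

universe u

namespace ComplexityTest

variable (A : Type u) [CommRing A] [IsLocalRing A]

structure MinFreeRes (M : Type u) [AddCommGroup M] [Module A M] : Type u where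
  b : ℕ → ℕ
  d : (n : ℕ) → ((Fin (b (n + 1)) → A) →ₗ[A] (Fin (b n) → A))
  aug : (Fin (b 0) → A) →ₗ[A] M
  aug_surjective : Function.Surjective aug
  exact_zero : Function.Exact (d 0) aug
  exact_succ : ∀ n, Function.Exact (d (n + 1)) (d n)
  minimal : ∀ n x i, d n x i ∈ maximalIdeal A

variable (M : Type u) [AddCommGroup M] [Module A M]

def HasComplexityLE (t : ℕ) : Prop :=
  ∃ (R : MinFreeRes A M) (a : ℝ), ∀ᶠ n : ℕ in atTop, (R.b n : ℝ) ≤ a * (n : ℝ) ^ ((t : ℤ) - 1)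

noncomputable def complexity : ℕ∞ :=
  sInf {c : ℕ∞ | ∃ t : ℕ, c = t ∧ HasComplexityLE A M t}

def HasProjDimLE (t : ℕ) : Prop :=
  ∃ R : MinFreeRes A M, ∀ i, t < i → R.b i = 0

noncomputable def projDim : ℕ∞ :=
  sInf {c : ℕ∞ | ∃ t : ℕ, c = t ∧ HasProjDimLE A M t}

def HasFiniteProjDim : Prop :=
  ∃ t : ℕ, HasProjDimLE A M t

def IsSyzygyOf (S : Type u) [AddCommGroup S] [Module A S] : ℕ → Prop
  | 0 => Nonempty (S ≃ₗ[A] M)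
  | 1 => ∃ R : MinFreeRes A M, Nonempty (S ≃ₗ[A] (LinearMap.ker R.aug))
  | (n + 2) => ∃ R : MinFreeRes A M, Nonempty (S ≃ₗ[A] (LinearMap.ker (R.d n)))

variable {A M} in
def IsSES {K S : Type u} [AddCommGroup K] [Module A K] [AddCommGroup S] [Module A S]
    (f : M →ₗ[A] K) (g : K →ₗ[A] S) : Prop :=
  Function.Injective f ∧ Function.Exact f g ∧ Function.Surjective g

noncomputable def extModule (n : ℕ) (N : Type u) [AddCommGroup N] [Module A N] :
    ModuleCat A :=
  ((_root_.Ext A (ModuleCat.{u} A) n).obj (op (ModuleCat.of A M))).obj (ModuleCat.of A N)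

def extVanish (n : ℕ) (N : Type u) [AddCommGroup N] [Module A N] : Prop :=
  Subsingleton (extModule A M n N)

/-- The `n`-th Tor module `Tor^A_n(M, N)`. -/
noncomputable def torModule (n : ℕ) (N : Type u) [AddCommGroup N] [Module A N] :
    ModuleCat A :=
  ((Tor (ModuleCat.{u} A) n).obj (ModuleCat.of A M)).obj (ModuleCat.of A N)

/-- The vanishing `Tor^A_n(M, N) = 0`. -/
def torVanish (n : ℕ) (N : Type u) [AddCommGroup N] [Module A N] : Prop :=
  Subsingleton (torModule A M n N)

noncomputable def depth : ℕ∞ :=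
  sInf {c : ℕ∞ | ∃ i : ℕ, c = i ∧ ¬ extVanish A (ResidueField A) i M}

variable {A}

/-- The category of modules of *free reducible complexity* over the local ring `A`.
It is defined inductively: every finitely generated module of finite projective
dimension has free reducible complexity, and a finitely generated module `M` of finite
positive complexity has free reducible complexity provided there is a short exact
sequence `0 → M → K → Ω^n_A(M) → 0` (necessarily induced by a cohomology element
`η ∈ Ext^{n+1}_A(M,M)`) where `K` is a finitely generated module of free reducible
complexity with `cx K = cx M - 1`. -/
inductive HasFreeRedCxCat : ModuleCat.{u} A → Prop
  | of_finite_projDim (M : ModuleCat.{u} A) (hfg : Module.Finite A M)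
      (h : HasFiniteProjDim A M) : HasFreeRedCxCat M
  | step (M K S : ModuleCat.{u} A) (n : ℕ)
      (hfg : Module.Finite A M) (hKfg : Module.Finite A K)
      (hpos : 0 < complexity A M) (hfin : complexity A M ≠ ⊤)
      (hsyz : IsSyzygyOf A M S n)
      (f : M →ₗ[A] K) (g : K →ₗ[A] S) (hses : IsSES f g)
      (hcx : complexity A K = complexity A M - 1)
      (hK : HasFreeRedCxCat K) : HasFreeRedCxCat M

/-- The category of modules of *reducible complexity* over the local ring `A`: as for
free reducible complexity, but where in addition the reductions are required to
preserve depth. -/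
inductive HasRedCxCat : ModuleCat.{u} A → Prop
  | of_finite_projDim (M : ModuleCat.{u} A) (hfg : Module.Finite A M)
      (h : HasFiniteProjDim A M) : HasRedCxCat M
  | step (M K S : ModuleCat.{u} A) (n : ℕ)
      (hfg : Module.Finite A M) (hKfg : Module.Finite A K)
      (hpos : 0 < complexity A M) (hfin : complexity A M ≠ ⊤)
      (hsyz : IsSyzygyOf A M S n)
      (f : M →ₗ[A] K) (g : K →ₗ[A] S) (hses : IsSES f g)
      (hcx : complexity A K = complexity A M - 1)
      (hdepth : depth A K = depth A M)
      (hK : HasRedCxCat K) : HasRedCxCat M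

variable (A)

/-- `M` has free reducible complexity. -/
def HasFreeRedCx (M : Type u) [AddCommGroup M] [Module A M] : Prop :=
  HasFreeRedCxCat (ModuleCat.of A M)

/-- `M` has reducible complexity. -/
def HasRedCx (M : Type u) [AddCommGroup M] [Module A M] : Prop :=
  HasRedCxCat (ModuleCat.of A M)

/-- A Noetherian local ring is Gorenstein if it has finite injective dimension over
itself; by Bass' characterization, this is equivalent to the vanishing of
`Ext^i_A(k, A)` for all sufficiently large `i`. -/
def IsGorenstein : Prop :=
  ∃ n : ℕ, ∀ i : ℕ, n < i → extVanish A (ResidueField A) i A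

end ComplexityTest

open ComplexityTest

namespace ComplexityTest

/-- A quasi-deformation of the local ring `A`: a diagram `A → R ↞ Q` of local
homomorphisms, where `A → R` is faithfully flat and `Q ↠ R` is surjective with kernel
generated by a regular sequence. -/
structure QuasiDeformation (A : Type u) [CommRing A] [IsLocalRing A] where
  /-- the middle ring of the quasi-deformation -/
  R : Type u
  /-- the deformation -/
  Q : Type u
  [commRingR : CommRing R]
  [commRingQ : CommRing Q]
  [isLocalRingR : IsLocalRing R]
  [isLocalRingQ : IsLocalRing Q]
  [algebraAR : Algebra A R]
  isLocalHom_to_R : IsLocalHom (algebraMap A R)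
  faithfullyFlat : Module.FaithfullyFlat A R
  /-- the surjection `Q ↠ R` -/
  g : Q →+* R
  g_surjective : Function.Surjective g
  isLocalHom_g : IsLocalHom g
  /-- a regular sequence of `Q` generating the kernel of `Q ↠ R` -/
  rs : List Q
  rs_regular : RingTheory.Sequence.IsRegular Q rs
  ker_g : RingHom.ker g = Ideal.span {x | x ∈ rs}

attribute [instance] QuasiDeformation.commRingR QuasiDeformation.commRingQ
  QuasiDeformation.isLocalRingR QuasiDeformation.isLocalRingQ QuasiDeformation.algebraAR

variable (A : Type u) [CommRing A] [IsLocalRing A]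

/-- The module `M` has finite complete intersection dimension: there is a
quasi-deformation `A → R ↞ Q` such that `R ⊗_A M` has finite projective dimension
over `Q`. -/
def HasFiniteCIDim (M : Type u) [AddCommGroup M] [Module A M] : Prop :=
  ∃ qd : QuasiDeformation A,
    letI : Module qd.Q (TensorProduct A qd.R M) := Module.compHom _ qd.g
    HasFiniteProjDim qd.Q (TensorProduct A qd.R M)

end ComplexityTest

section Part1
open CategoryTheory Opposite Filter IsLocalRing ComplexityTest
namespace CX

section basic
variable {B : Type*} [CommRing B] {J J' J'' : Type*}

/-- basis vector -/
noncomputable abbrev e (B : Type*) [CommRing B] {J : Type*} (j : J) : J →₀ B := Finsupp.single j 1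

noncomputable def mkOp {N : Type*} [AddCommGroup N] [Module B N] (f : J → N) : (J →₀ B) →ₗ[B] N :=
  Finsupp.linearCombination B f

@[simp] theorem mkOp_e {N : Type*} [AddCommGroup N] [Module B N] (f : J → N) (j : J) :
    mkOp (B := B) f (e B j) = f j := by simp [mkOp, e]

theorem op_ext {N : Type*} [AddCommGroup N] [Module B N] {φ ψ : (J →₀ B) →ₗ[B] N}
    (h : ∀ j, φ (e B j) = ψ (e B j)) : φ = ψ := by
  apply Finsupp.lhom_ext'
  intro j
  ext
  simpa using h j

def Hg (B : Type*) [CommRing B] (deg : J → ℕ) (n : ℕ) : Submodule B (J →₀ B) where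
  carrier := {v | ∀ l, v l ≠ 0 → deg l = n}
  zero_mem' := by simp
  add_mem' := by
    intro a b ha hb l hl
    by_contra h
    have h1 : a l = 0 := by by_contra h'; exact h (ha l h')
    have h2 : b l = 0 := by by_contra h'; exact h (hb l h')
    simp [h1, h2] at hl
  smul_mem' := by
    intro c a ha l hl
    apply ha l
    intro h
    simp [h] at hl

theorem mem_Hg {deg : J → ℕ} {n : ℕ} {v : J →₀ B} : v ∈ Hg B deg n ↔ ∀ l, v l ≠ 0 → deg l = n :=
  Iff.rfl

theorem e_mem_Hg {deg : J → ℕ} {n : ℕ} {j : J} (h : deg j = n) : e B j ∈ Hg B deg n := by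
  intro l hl
  classical
  have : j = l := by
    by_contra h'
    simp [e, h'] at hl
  rw [← this, h]

theorem sum_e (v : J →₀ B) : v = v.sum (fun l a => a • e B l) := by
  simp [e]

theorem Hg_induct {deg : J → ℕ} {n : ℕ} {P : Submodule B (J →₀ B)}
    (h : ∀ j, deg j = n → e B j ∈ P) {v : J →₀ B} (hv : v ∈ Hg B deg n) : v ∈ P := by
  rw [sum_e v]
  refine Submodule.sum_mem _ fun l hl => P.smul_mem _ (h l (hv l ?_))
  simpa using hl

theorem Hg_eq {N : Type*} [AddCommGroup N] [Module B N] {deg : J → ℕ} {n : ℕ}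
    {φ ψ : (J →₀ B) →ₗ[B] N} (h : ∀ j, deg j = n → φ (e B j) = ψ (e B j))
    {v : J →₀ B} (hv : v ∈ Hg B deg n) : φ v = ψ v := by
  have := Hg_induct (P := LinearMap.eqLocus φ ψ) (fun j hj => h j hj) hv
  exact this

theorem Hg_map {N : Type*} [AddCommGroup N] [Module B N] {deg : J → ℕ} {n : ℕ}
    {φ : (J →₀ B) →ₗ[B] N} {P : Submodule B N} (h : ∀ j, deg j = n → φ (e B j) ∈ P)
    {v : J →₀ B} (hv : v ∈ Hg B deg n) : φ v ∈ P :=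
  Hg_induct (P := P.comap φ) (fun j hj => h j hj) hv

def IsDeg (deg : J → ℕ) (deg' : J' → ℕ) (p q : ℕ) (φ : (J →₀ B) →ₗ[B] (J' →₀ B)) : Prop :=
  ∀ j l, φ (e B j) l ≠ 0 → deg' l + q = deg j + p

variable {deg : J → ℕ} {deg' : J' → ℕ} {deg'' : J'' → ℕ} {p q p' q' : ℕ}

theorem IsDeg.mem {φ : (J →₀ B) →ₗ[B] (J' →₀ B)} (h : IsDeg deg deg' p q φ) {n m : ℕ}
    (hm : m + q = n + p) {v : J →₀ B} (hv : v ∈ Hg B deg n) : φ v ∈ Hg B deg' m := by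
  refine Hg_map (fun j hj => ?_) hv
  intro l hl
  have := h j l hl
  omega

theorem IsDeg.eq_zero {φ : (J →₀ B) →ₗ[B] (J' →₀ B)} (h : IsDeg deg deg' p q φ) {n : ℕ}
    (hm : n + p < q) {v : J →₀ B} (hv : v ∈ Hg B deg n) : φ v = 0 := by
  have := Hg_eq (φ := φ) (ψ := 0) (fun j hj => ?_) hv
  · simpa using this
  · ext l
    by_contra h'
    have := h j l (by simpa using h')
    omega

theorem IsDeg.e_mem {φ : (J →₀ B) →ₗ[B] (J' →₀ B)} (h : IsDeg deg deg' p q φ) {m : ℕ} {j : J}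
    (hm : m + q = deg j + p) : φ (e B j) ∈ Hg B deg' m :=
  h.mem hm (e_mem_Hg rfl)

theorem IsDeg.e_zero {φ : (J →₀ B) →ₗ[B] (J' →₀ B)} (h : IsDeg deg deg' p q φ) {j : J}
    (hm : deg j + p < q) : φ (e B j) = 0 :=
  h.eq_zero hm (e_mem_Hg rfl)

theorem isDeg_of_mem {φ : (J →₀ B) →ₗ[B] (J' →₀ B)}
    (h : ∀ j m, m + q = deg j + p → φ (e B j) ∈ Hg B deg' m)
    (h0 : ∀ j, deg j + p < q → φ (e B j) = 0) : IsDeg deg deg' p q φ := by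
  intro j l hl
  by_cases hq : deg j + p < q
  · rw [h0 j hq] at hl; simp at hl
  · have := h j (deg j + p - q) (by omega) l hl
    omega

theorem IsDeg.comp {φ : (J →₀ B) →ₗ[B] (J' →₀ B)} {ψ : (J' →₀ B) →ₗ[B] (J'' →₀ B)}
    (hψ : IsDeg deg' deg'' p' q' ψ) (h : IsDeg deg deg' p q φ)  :
    IsDeg deg deg'' (p + p') (q + q') (ψ ∘ₗ φ) := by
  intro j l hl
  by_contra hcon
  apply hl
  rw [LinearMap.comp_apply, sum_e (φ (e B j)), Finsupp.sum, map_sum, Finsupp.finsetSum_apply]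
  refine Finset.sum_eq_zero fun i hi => ?_
  rw [map_smul, Finsupp.smul_apply]
  by_cases h' : ψ (e B i) l = 0
  · rw [h', smul_zero]
  · have h1 := hψ i l h'
    have h2 := h j i (by simpa using hi)
    omega

theorem IsDeg.cast {φ : (J →₀ B) →ₗ[B] (J' →₀ B)} (h : IsDeg deg deg' p q φ)
    (hpq : p + q' = p' + q) : IsDeg deg deg' p' q' φ := by
  intro j l hl
  have := h j l hl
  omega

theorem IsDeg.add {φ ψ : (J →₀ B) →ₗ[B] (J' →₀ B)} (h : IsDeg deg deg' p q φ)
    (h' : IsDeg deg deg' p q ψ) : IsDeg deg deg' p q (φ + ψ) := by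
  intro j l hl
  by_cases h1 : φ (e B j) l = 0
  · by_cases h2 : ψ (e B j) l = 0
    · simp [h1, h2] at hl
    · exact h' j l h2
  · exact h j l h1

theorem IsDeg.smul {φ : (J →₀ B) →ₗ[B] (J' →₀ B)} (h : IsDeg deg deg' p q φ) (c : B) :
    IsDeg deg deg' p q (c • φ) := by
  intro j l hl
  apply h j l
  intro h1
  simp [h1] at hl

theorem IsDeg.neg {φ : (J →₀ B) →ₗ[B] (J' →₀ B)} (h : IsDeg deg deg' p q φ) :
    IsDeg deg deg' p q (-φ) := by
  intro j l hl
  apply h j l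
  intro h1
  simp [h1] at hl

theorem IsDeg.sub {φ ψ : (J →₀ B) →ₗ[B] (J' →₀ B)} (h : IsDeg deg deg' p q φ)
    (h' : IsDeg deg deg' p q ψ) : IsDeg deg deg' p q (φ - ψ) := by
  have h2 : φ - ψ = φ + -ψ := sub_eq_add_neg φ ψ
  rw [h2]; exact h.add h'.neg

theorem IsDeg.zero : IsDeg deg deg' p q (0 : (J →₀ B) →ₗ[B] (J' →₀ B)) := by
  intro j l hl; simp at hl

theorem IsDeg.id : IsDeg deg deg 0 0 (LinearMap.id : (J →₀ B) →ₗ[B] (J →₀ B)) := by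
  intro j l hl
  have := e_mem_Hg (B := B) (deg := deg) (j := j) rfl l hl
  omega

theorem IsDeg.sum {ι : Type*} {s : Finset ι} {φ : ι → (J →₀ B) →ₗ[B] (J' →₀ B)}
    (h : ∀ i ∈ s, IsDeg deg deg' p q (φ i)) : IsDeg deg deg' p q (∑ i ∈ s, φ i) := by
  classical
  induction s using Finset.induction_on with
  | empty => simpa using IsDeg.zero
  | insert a s ha ih =>
    rw [Finset.sum_insert ha]
    exact (h a (by simp)).add (ih fun i hi => h i (by simp [hi]))

/-- projection on degree n -/
noncomputable def pr (B : Type*) [CommRing B] (deg : J → ℕ) (n : ℕ) : (J →₀ B) →ₗ[B] (J →₀ B) :=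
  open Classical in mkOp fun j => if deg j = n then e B j else 0

theorem pr_e {n : ℕ} {j : J} : pr B deg n (e B j) = open Classical in if deg j = n then e B j else 0 := by
  simp [pr]

theorem pr_mem (n : ℕ) (v : J →₀ B) : pr B deg n v ∈ Hg B deg n := by
  rw [sum_e v, Finsupp.sum, map_sum]
  refine Submodule.sum_mem _ fun l hl => ?_
  rw [map_smul]
  refine Submodule.smul_mem _ _ ?_
  rw [pr_e]
  split_ifs with h
  · exact e_mem_Hg h
  · simp

theorem pr_of_mem {n : ℕ} {v : J →₀ B} (h : v ∈ Hg B deg n) : pr B deg n v = v := by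
  refine Hg_eq (φ := pr B deg n) (ψ := LinearMap.id) (fun j hj => ?_) h
  rw [pr_e]; simp [hj]

theorem pr_of_mem_ne {n m : ℕ} (hnm : m ≠ n) {v : J →₀ B} (h : v ∈ Hg B deg m) :
    pr B deg n v = 0 := by
  refine Hg_eq (φ := pr B deg n) (ψ := 0) (fun j hj => ?_) h
  rw [pr_e]; simp [hj, hnm]

theorem IsDeg.pr_comm {φ : (J →₀ B) →ₗ[B] (J' →₀ B)} (h : IsDeg deg deg' p q φ) {n m : ℕ}
    (hm : m + q = n + p) (v : J →₀ B) : φ (pr B deg n v) = pr B deg' m (φ v) := by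
  suffices φ ∘ₗ pr B deg n = pr B deg' m ∘ₗ φ from LinearMap.congr_fun this v
  apply op_ext
  intro j
  simp only [LinearMap.comp_apply, pr_e]
  split_ifs with hj
  · rw [pr_of_mem (h.e_mem (by omega))]
  · by_cases hq : deg j + p < q
    · rw [h.e_zero hq]; simp
    · rw [pr_of_mem_ne (m := deg j + p - q) (by omega) (h.e_mem (by omega))]
      simp

theorem pr_apply (n : ℕ) (v : J →₀ B) (l : J) :
    pr B deg n v l = open Classical in if deg l = n then v l else 0 := by
  classical
  induction v using Finsupp.induction_linear with
  | zero => simp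
  | add f g hf hg => simp only [map_add, Finsupp.add_apply, hf, hg]; split_ifs <;> simp
  | single j a =>
    have : Finsupp.single j a = a • e B j := by simp [e]
    rw [this, map_smul, pr_e]
    by_cases hjl : j = l
    · subst hjl
      split_ifs <;> simp
    · split_ifs <;> simp [e, hjl]

/-- Acyclic in positive degrees -/
def Acy (deg : J → ℕ) (d : (J →₀ B) →ₗ[B] (J →₀ B)) : Prop :=
  ∀ n, ∀ v ∈ Hg B deg (n + 1), d v = 0 → ∃ w ∈ Hg B deg (n + 2), d w = v

theorem LL {d : (J →₀ B) →ₗ[B] (J →₀ B)} {d' : (J' →₀ B) →ₗ[B] (J' →₀ B)}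
    (hd : IsDeg deg deg 0 1 d) (hd' : IsDeg deg' deg' 0 1 d') (hdd : d ∘ₗ d = 0)
    (hac : Acy deg' d') (q : ℕ) (φ0 : (J →₀ B) →ₗ[B] (J' →₀ B))
    (h0 : ∀ j, deg j = q → φ0 (e B j) ∈ Hg B deg' 0)
    (h1 : ∀ j, deg j = q + 1 → ∃ w ∈ Hg B deg' 1, d' w = φ0 (d (e B j))) :
    ∃ φ : (J →₀ B) →ₗ[B] (J' →₀ B), IsDeg deg deg' 0 q φ ∧
      (∀ j, deg j = q → φ (e B j) = φ0 (e B j)) ∧ d' ∘ₗ φ = φ ∘ₗ d := by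
  classical
  let Good : ℕ → ((J →₀ B) →ₗ[B] (J' →₀ B)) → Prop := fun n φ =>
    (∀ j, deg j = q + n → φ (e B j) ∈ Hg B deg' n) ∧
    (∀ j, deg j = q + n + 1 → ∃ w ∈ Hg B deg' (n + 1), d' w = φ (d (e B j)))
  have step : ∀ n φ, Good n φ → ∃ φ', Good (n + 1) φ' ∧
      ∀ j, deg j = q + n + 1 → d' (φ' (e B j)) = φ (d (e B j)) := by
    intro n φ hφ
    choose! w hw hw' using hφ.2
    have key : ∀ j, deg j = q + n + 1 → d' (mkOp w (e B j)) = φ (d (e B j)) := by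
      intro j hj
      rw [mkOp_e]; exact hw' j hj
    refine ⟨mkOp w, ⟨?_, ?_⟩, key⟩
    · intro j hj
      rw [mkOp_e]
      exact hw j hj
    · intro j hj
      refine hac n _ (Hg_map (n := q + n + 1) (fun j hj => ?_) (hd.e_mem (by omega))) ?_
      · rw [mkOp_e]; exact hw j hj
      · have : d' (mkOp w (d (e B j))) = φ (d (d (e B j))) :=
          Hg_eq (φ := d' ∘ₗ mkOp w) (ψ := φ ∘ₗ d) key
            (hd.e_mem (m := q + n + 1) (by omega))
        rw [this, ← LinearMap.comp_apply d d, hdd]; simp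
  choose! nx hnx hnx' using step
  let Φ : ℕ → ((J →₀ B) →ₗ[B] (J' →₀ B)) := fun n => Nat.rec φ0 nx n
  have hG : ∀ n, Good n (Φ n) := by
    intro n
    induction n with
    | zero => exact ⟨h0, h1⟩
    | succ n ih => exact hnx n _ ih
  have hN : ∀ n j, deg j = q + n + 1 → d' (Φ (n + 1) (e B j)) = Φ n (d (e B j)) :=
    fun n => hnx' n _ (hG n)
  let φ : (J →₀ B) →ₗ[B] (J' →₀ B) := mkOp fun j => if q ≤ deg j then Φ (deg j - q) (e B j) else 0
  have hφ : ∀ n j, deg j = q + n → φ (e B j) = Φ n (e B j) := by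
    intro n j hj
    simp only [φ, mkOp_e]
    rw [if_pos (by omega)]
    congr 2
    omega
  have hφ0 : ∀ j, deg j < q → φ (e B j) = 0 := by
    intro j hj
    simp only [φ, mkOp_e]
    rw [if_neg (by omega)]
  have hφd : IsDeg deg deg' 0 q φ := by
    refine isDeg_of_mem ?_ (fun j hj => hφ0 j hj)
    intro j m hm
    rw [hφ m j (by omega)]
    exact (hG m).1 j (by omega)
  refine ⟨φ, hφd, fun j hj => hφ 0 j hj, op_ext fun j => ?_⟩
  simp only [LinearMap.comp_apply]
  rcases lt_trichotomy (deg j) q with h | h | h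
  · rw [hφ0 j h, map_zero]
    rcases Nat.eq_zero_or_pos (deg j) with h' | h'
    · rw [hd.e_zero (by omega), map_zero]
    · rw [hφd.eq_zero (n := deg j - 1) (by omega) (hd.e_mem (by omega))]
  · rw [hφ 0 j h, show Φ 0 = φ0 from rfl, hd'.eq_zero (n := 0) (by omega) (h0 j h)]
    rcases Nat.eq_zero_or_pos (deg j) with h' | h'
    · rw [hd.e_zero (by omega), map_zero]
    · rw [hφd.eq_zero (n := deg j - 1) (by omega) (hd.e_mem (by omega))]
  · obtain ⟨n, hn⟩ := Nat.exists_eq_add_of_lt h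
    rw [hφ (n + 1) j (by omega), hN n j hn]
    exact (Hg_eq (n := q + n) (fun i hi => hφ n i hi) (hd.e_mem (by omega))).symm

theorem HL {d : (J →₀ B) →ₗ[B] (J →₀ B)} {d' : (J' →₀ B) →ₗ[B] (J' →₀ B)}
    (hd : IsDeg deg deg 0 1 d) (hdd : d ∘ₗ d = 0)
    (hac : Acy deg' d') (q : ℕ) (ψ : (J →₀ B) →ₗ[B] (J' →₀ B)) (hψ : IsDeg deg deg' 0 q ψ)
    (hψd : d' ∘ₗ ψ = ψ ∘ₗ d) (s0 : (J →₀ B) →ₗ[B] (J' →₀ B))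
    (h0 : ∀ j, deg j + 1 = q → s0 (e B j) ∈ Hg B deg' 0)
    (h1 : ∀ j, deg j = q → ∃ w ∈ Hg B deg' 1, d' w = ψ (e B j) - s0 (d (e B j))) :
    ∃ s : (J →₀ B) →ₗ[B] (J' →₀ B), IsDeg deg deg' 1 q s ∧ (∀ j, deg j + 1 = q → s (e B j) = s0 (e B j)) ∧
      (∀ j, q ≤ deg j → ψ (e B j) = d' (s (e B j)) + s (d (e B j))) := by
  classical
  let Good : ℕ → ((J →₀ B) →ₗ[B] (J' →₀ B)) → Prop := fun n φ =>
    (∀ j, deg j + 1 = q + n → φ (e B j) ∈ Hg B deg' n) ∧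
    (∀ j, deg j = q + n → ∃ w ∈ Hg B deg' (n + 1), d' w = ψ (e B j) - φ (d (e B j)))
  have step : ∀ n φ, Good n φ → ∃ φ', Good (n + 1) φ' ∧
      ∀ j, deg j = q + n → d' (φ' (e B j)) = ψ (e B j) - φ (d (e B j)) := by
    intro n φ hφ
    choose! w hw hw' using hφ.2
    have key : ∀ j, deg j = q + n → d' (mkOp w (e B j)) = ψ (e B j) - φ (d (e B j)) := by
      intro j hj
      rw [mkOp_e]; exact hw' j hj
    refine ⟨mkOp w, ⟨?_, ?_⟩, key⟩
    · intro j hj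
      rw [mkOp_e]
      exact hw j (by omega)
    · intro j hj
      refine hac n _ (Submodule.sub_mem _ (hψ.e_mem (by omega))
        (Hg_map (n := q + n) (fun j hj => ?_) (hd.e_mem (by omega)))) ?_
      · rw [mkOp_e]; exact hw j hj
      · have : d' (mkOp w (d (e B j))) = ψ (d (e B j)) - φ (d (d (e B j))) :=
          Hg_eq (φ := d' ∘ₗ mkOp w) (ψ := ψ - φ ∘ₗ d) key
            (hd.e_mem (m := q + n) (by omega))
        rw [map_sub, this, ← LinearMap.comp_apply d d, hdd, ← LinearMap.comp_apply d', hψd]; simp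
  choose! nx hnx hnx' using step
  let Φ : ℕ → ((J →₀ B) →ₗ[B] (J' →₀ B)) := fun n => Nat.rec s0 nx n
  have hG : ∀ n, Good n (Φ n) := by
    intro n
    induction n with
    | zero => exact ⟨h0, h1⟩
    | succ n ih => exact hnx n _ ih
  have hN : ∀ n j, deg j = q + n → d' (Φ (n + 1) (e B j)) = ψ (e B j) - Φ n (d (e B j)) :=
    fun n => hnx' n _ (hG n)
  let φ : (J →₀ B) →ₗ[B] (J' →₀ B) :=
    mkOp fun j => if q ≤ deg j + 1 then Φ (deg j + 1 - q) (e B j) else 0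
  have hφ : ∀ n j, deg j + 1 = q + n → φ (e B j) = Φ n (e B j) := by
    intro n j hj
    simp only [φ, mkOp_e]
    rw [if_pos (by omega)]
    congr 2
    omega
  have hφ0 : ∀ j, deg j + 1 < q → φ (e B j) = 0 := by
    intro j hj
    simp only [φ, mkOp_e]
    rw [if_neg (by omega)]
  have hφd : IsDeg deg deg' 1 q φ := by
    refine isDeg_of_mem ?_ (fun j hj => hφ0 j hj)
    intro j m hm
    rw [hφ m j (by omega)]
    exact (hG m).1 j (by omega)
  refine ⟨φ, hφd, fun j hj => hφ 0 j hj, fun j hj => ?_⟩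
  obtain ⟨n, hn⟩ := Nat.exists_eq_add_of_le hj
  rw [hφ (n + 1) j (by omega), hN n j hn]
  have : φ (d (e B j)) = Φ n (d (e B j)) := by
    rcases Nat.eq_zero_or_pos (deg j) with h' | h'
    · rw [hd.e_zero (by omega), map_zero, map_zero]
    · exact (Hg_eq (n := deg j - 1) (fun i hi => hφ n i (by omega)) (hd.e_mem (by omega)))
  rw [this]; abel

end basic
end CX
end Part1

section Part2
open CategoryTheory Opposite Filter IsLocalRing ComplexityTest
namespace CX

section bc
variable {A B C : Type*} [CommRing A] [CommRing B] [CommRing C] {J J' J'' : Type*}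

/-- coefficientwise base change of vectors -/
noncomputable def mr (f : A →+* B) : (J →₀ A) →+ (J →₀ B) := Finsupp.mapRange.addMonoidHom f.toAddMonoidHom

@[simp] theorem mr_apply (f : A →+* B) (v : J →₀ A) (j : J) : mr f v j = f (v j) := by
  simp [mr]

@[simp] theorem mr_smul (f : A →+* B) (c : A) (v : J →₀ A) : mr f (c • v) = f c • mr f v := by
  ext j; simp

@[simp] theorem mr_e (f : A →+* B) (j : J) : mr f (e A j) = e B j := by
  classical
  ext l
  by_cases h : j = l <;> simp [e, h]

theorem mr_mem {deg : J → ℕ} {n : ℕ} (f : A →+* B) {v : J →₀ A} (h : v ∈ Hg A deg n) :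
    mr f v ∈ Hg B deg n := by
  intro l hl
  apply h l
  intro h'
  simp [h'] at hl

noncomputable def bc (f : A →+* B) (φ : (J →₀ A) →ₗ[A] (J' →₀ A)) : (J →₀ B) →ₗ[B] (J' →₀ B) :=
  mkOp fun j => mr f (φ (e A j))

@[simp] theorem bc_e (f : A →+* B) (φ : (J →₀ A) →ₗ[A] (J' →₀ A)) (j : J) :
    bc f φ (e B j) = mr f (φ (e A j)) := by simp [bc]

theorem bc_mr (f : A →+* B) (φ : (J →₀ A) →ₗ[A] (J' →₀ A)) (v : J →₀ A) :
    bc f φ (mr f v) = mr f (φ v) := by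
  rw [sum_e v, Finsupp.sum]
  simp only [map_sum, mr_smul, map_smul, mr_e, bc_e]

theorem bc_comp (f : A →+* B) (φ : (J →₀ A) →ₗ[A] (J' →₀ A)) (ψ : (J' →₀ A) →ₗ[A] (J'' →₀ A)) :
    bc f (ψ ∘ₗ φ) = bc f ψ ∘ₗ bc f φ := by
  apply op_ext; intro j
  rw [LinearMap.comp_apply, bc_e, bc_e, bc_mr]; rfl

theorem bc_add (f : A →+* B) (φ ψ : (J →₀ A) →ₗ[A] (J' →₀ A)) :
    bc f (φ + ψ) = bc f φ + bc f ψ := by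
  apply op_ext; intro j
  simp

theorem bc_neg (f : A →+* B) (φ : (J →₀ A) →ₗ[A] (J' →₀ A)) :
    bc f (-φ) = -bc f φ := by
  apply op_ext; intro j
  simp

theorem bc_sub (f : A →+* B) (φ ψ : (J →₀ A) →ₗ[A] (J' →₀ A)) :
    bc f (φ - ψ) = bc f φ - bc f ψ := by
  apply op_ext; intro j
  simp

theorem bc_smul (f : A →+* B) (c : A) (φ : (J →₀ A) →ₗ[A] (J' →₀ A)) :
    bc f (c • φ) = f c • bc f φ := by
  apply op_ext; intro j
  simp

theorem bc_zero (f : A →+* B) : bc f (0 : (J →₀ A) →ₗ[A] (J' →₀ A)) = 0 := by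
  apply op_ext; intro j
  simp

theorem bc_id (f : A →+* B) : bc f (LinearMap.id : (J →₀ A) →ₗ[A] (J →₀ A)) = LinearMap.id := by
  apply op_ext; intro j
  simp

theorem bc_sum (f : A →+* B) {ι : Type*} (s : Finset ι) (φ : ι → (J →₀ A) →ₗ[A] (J' →₀ A)) :
    bc f (∑ i ∈ s, φ i) = ∑ i ∈ s, bc f (φ i) := by
  apply op_ext; intro j
  simp

theorem bc_bc (f : A →+* B) (g : B →+* C) (φ : (J →₀ A) →ₗ[A] (J' →₀ A)) :
    bc g (bc f φ) = bc (g.comp f) φ := by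
  apply op_ext; intro j
  ext l
  simp

theorem bc_isDeg {deg : J → ℕ} {deg' : J' → ℕ} {p q : ℕ} (f : A →+* B) {φ : (J →₀ A) →ₗ[A] (J' →₀ A)}
    (h : IsDeg deg deg' p q φ) : IsDeg deg deg' p q (bc f φ) := by
  intro j l hl
  apply h j l
  intro h'
  simp [h'] at hl

theorem bc_lift (f : A →+* B) (hf : Function.Surjective f) (φ : (J →₀ B) →ₗ[B] (J' →₀ B)) :
    ∃ ψ : (J →₀ A) →ₗ[A] (J' →₀ A), bc f ψ = φ ∧
      ∀ (deg : J → ℕ) (deg' : J' → ℕ) p q, IsDeg deg deg' p q φ → IsDeg deg deg' p q ψ := by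
  classical
  let g : B → A := fun b => if b = 0 then 0 else Function.surjInv hf b
  have hg0 : g 0 = 0 := by simp [g]
  have hg : ∀ b, f (g b) = b := by
    intro b
    by_cases h : b = 0
    · simp [g, h]
    · simp only [g, h, if_false]; exact Function.surjInv_eq hf b
  refine ⟨mkOp fun j => Finsupp.mapRange g hg0 (φ (e B j)), ?_, ?_⟩
  · apply op_ext; intro j
    ext l
    simp [hg]
  · intro deg deg' p q h j l hl
    apply h j l
    intro h'
    simp [h', hg0] at hl

end bc

section res
variable {B : Type*} [CommRing B] {J J' J'' : Type*}

/-- cochains in degree n -/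
def Ch (B : Type*) [CommRing B] (deg : J → ℕ) (N : Type*) [AddCommGroup N] [Module B N] (n : ℕ) :
    Submodule B ((J →₀ B) →ₗ[B] N) where
  carrier := {u | ∀ j, deg j ≠ n → u (e B j) = 0}
  zero_mem' := by simp
  add_mem' := by
    intro a b ha hb j hj
    rw [LinearMap.add_apply, ha j hj, hb j hj, add_zero]
  smul_mem' := by
    intro c a ha j hj
    rw [LinearMap.smul_apply, ha j hj, smul_zero]

theorem mem_Ch {deg : J → ℕ} {N : Type*} [AddCommGroup N] [Module B N] {n : ℕ}
    {u : (J →₀ B) →ₗ[B] N} : u ∈ Ch B deg N n ↔ ∀ j, deg j ≠ n → u (e B j) = 0 := Iff.rfl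

theorem Ch_eq {deg : J → ℕ} {N : Type*} [AddCommGroup N] [Module B N] {n : ℕ}
    {u u' : (J →₀ B) →ₗ[B] N} (h : u ∈ Ch B deg N n) (h' : u' ∈ Ch B deg N n)
    (hh : ∀ j, deg j = n → u (e B j) = u' (e B j)) : u = u' := by
  apply op_ext; intro j
  by_cases hj : deg j = n
  · exact hh j hj
  · rw [h j hj, h' j hj]

theorem IsDeg.ch {deg : J → ℕ} {deg' : J' → ℕ} {p q : ℕ} {φ : (J →₀ B) →ₗ[B] (J' →₀ B)}
    (h : IsDeg deg deg' p q φ) {N : Type*} [AddCommGroup N] [Module B N] {n m : ℕ}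
    (hm : m + q = n + p) {u : (J' →₀ B) →ₗ[B] N} (hu : u ∈ Ch B deg' N m) :
    u ∘ₗ φ ∈ Ch B deg N n := by
  intro j hj
  rw [LinearMap.comp_apply, sum_e (φ (e B j)), Finsupp.sum, map_sum]
  refine Finset.sum_eq_zero fun i hi => ?_
  rw [map_smul, hu i, smul_zero]
  have := h j i (by simpa using hi)
  omega

theorem IsDeg.ch_zero {deg : J → ℕ} {deg' : J' → ℕ} {p q : ℕ} {φ : (J →₀ B) →ₗ[B] (J' →₀ B)}
    (h : IsDeg deg deg' p q φ) {N : Type*} [AddCommGroup N] [Module B N] {m : ℕ}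
    (hm : m + q < p) {u : (J' →₀ B) →ₗ[B] N} (hu : u ∈ Ch B deg' N m) :
    u ∘ₗ φ = 0 := by
  apply op_ext; intro j
  rw [LinearMap.comp_apply, sum_e (φ (e B j)), Finsupp.sum, map_sum]
  refine Finset.sum_eq_zero fun i hi => ?_
  rw [map_smul, hu i, smul_zero]
  have := h j i (by simpa using hi)
  omega

theorem Ch_pr {deg : J → ℕ} {N : Type*} [AddCommGroup N] [Module B N] (n : ℕ)
    (u : (J →₀ B) →ₗ[B] N) : u ∘ₗ pr B deg n ∈ Ch B deg N n := by
  intro j hj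
  rw [LinearMap.comp_apply, pr_e, if_neg hj, map_zero]

theorem Ch_pr_eq {deg : J → ℕ} {N : Type*} [AddCommGroup N] [Module B N] {n : ℕ}
    {u : (J →₀ B) →ₗ[B] N} (hu : u ∈ Ch B deg N n) : u ∘ₗ pr B deg n = u := by
  refine Ch_eq (Ch_pr n u) hu fun j hj => ?_
  rw [LinearMap.comp_apply, pr_e, if_pos hj]

theorem Ch_pr_ne {deg : J → ℕ} {N : Type*} [AddCommGroup N] [Module B N] {n m : ℕ} (hnm : m ≠ n)
    {u : (J →₀ B) →ₗ[B] N} (hu : u ∈ Ch B deg N n) : u ∘ₗ pr B deg m = 0 := by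
  apply op_ext; intro j
  rw [LinearMap.comp_apply, pr_e]
  split_ifs with h
  · rw [hu j (by omega)]; rfl
  · simp

structure IsRes {X : Type*} [AddCommGroup X] [Module B X] (deg : J → ℕ)
    (d : (J →₀ B) →ₗ[B] (J →₀ B)) (aug : (J →₀ B) →ₗ[B] X) : Prop where
  fin : ∀ n, {j | deg j = n}.Finite
  hd : IsDeg deg deg 0 1 d
  haug : aug ∈ Ch B deg X 0
  dd : d ∘ₗ d = 0
  augd : aug ∘ₗ d = 0
  surj : Function.Surjective aug
  exact : ∀ a, d a = 0 → aug a = 0 → ∃ b, d b = a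

variable {X Y : Type*} [AddCommGroup X] [Module B X] [AddCommGroup Y] [Module B Y]
  {deg : J → ℕ} {deg' : J' → ℕ} {d : (J →₀ B) →ₗ[B] (J →₀ B)} {d' : (J' →₀ B) →ₗ[B] (J' →₀ B)}
  {aug : (J →₀ B) →ₗ[B] X} {aug' : (J' →₀ B) →ₗ[B] Y}

theorem Ch_apply_zero {N : Type*} [AddCommGroup N] [Module B N] {n m : ℕ} (hnm : m ≠ n)
    {u : (J →₀ B) →ₗ[B] N} (hu : u ∈ Ch B deg N n) {v : J →₀ B} (hv : v ∈ Hg B deg m) : u v = 0 := by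
  have := Hg_eq (φ := u) (ψ := 0) (fun j hj => by rw [hu j (by omega)]; rfl) hv
  simpa using this

theorem IsRes.exactHg (h : IsRes deg d aug) (n : ℕ) {v : J →₀ B} (hv : v ∈ Hg B deg n)
    (h1 : d v = 0) (h2 : aug v = 0) : ∃ w ∈ Hg B deg (n + 1), d w = v := by
  obtain ⟨b, hb⟩ := h.exact v h1 h2
  refine ⟨pr B deg (n + 1) b, pr_mem _ _, ?_⟩
  rw [h.hd.pr_comm (m := n) (by omega), hb, pr_of_mem hv]

theorem IsRes.acy (h : IsRes deg d aug) : Acy deg d := by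
  intro n v hv hdv
  exact h.exactHg (n + 1) hv hdv (Ch_apply_zero (by omega) h.haug hv)

theorem IsRes.exact0 (h : IsRes deg d aug) {v : J →₀ B} (hv : v ∈ Hg B deg 0)
    (h2 : aug v = 0) : ∃ w ∈ Hg B deg 1, d w = v :=
  h.exactHg 0 hv (h.hd.eq_zero (by omega) hv) h2

theorem IsRes.surj0 (h : IsRes deg d aug) (x : X) : ∃ v ∈ Hg B deg 0, aug v = x := by
  obtain ⟨b, hb⟩ := h.surj x
  refine ⟨pr B deg 0 b, pr_mem _ _, ?_⟩
  rw [← hb, ← LinearMap.comp_apply, Ch_pr_eq h.haug]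

theorem IsRes.lift (h : IsRes deg d aug) (h' : IsRes deg' d' aug') (f : X →ₗ[B] Y) :
    ∃ φ : (J →₀ B) →ₗ[B] (J' →₀ B), IsDeg deg deg' 0 0 φ ∧ d' ∘ₗ φ = φ ∘ₗ d ∧
      aug' ∘ₗ φ = f ∘ₗ aug := by
  choose w hw hw' using fun j => h'.surj0 (f (aug (e B j)))
  have hc : aug' ∘ₗ mkOp w = f ∘ₗ aug := by
    apply op_ext; intro j
    rw [LinearMap.comp_apply, mkOp_e, hw']; rfl
  obtain ⟨φ, h1, h2, h3⟩ := LL h.hd h'.hd h.dd h'.acy 0 (mkOp w)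
    (fun j hj => by rw [mkOp_e]; exact hw j) (fun j hj => by
      apply h'.exact0
      · exact Hg_map (n := 0) (fun i _ => by rw [mkOp_e]; exact hw i) (h.hd.e_mem (by omega))
      · rw [← LinearMap.comp_apply, hc, LinearMap.comp_apply, ← LinearMap.comp_apply aug, h.augd]
        simp)
  refine ⟨φ, h1, h3, ?_⟩
  rw [← hc]
  refine Ch_eq (deg := deg) (n := 0) (h1.ch (by omega) h'.haug) ?_ ?_
  · rw [hc]; intro j hj
    rw [LinearMap.comp_apply, h.haug j hj, map_zero]
  · intro j hj
    rw [LinearMap.comp_apply, h2 j hj]; rfl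

theorem IsRes.homotopy (h : IsRes deg d aug) (h' : IsRes deg' d' aug')
    (ψ : (J →₀ B) →ₗ[B] (J' →₀ B)) (hψ : IsDeg deg deg' 0 0 ψ)
    (hψd : d' ∘ₗ ψ = ψ ∘ₗ d) (ha : aug' ∘ₗ ψ = 0) :
    ∃ s : (J →₀ B) →ₗ[B] (J' →₀ B), IsDeg deg deg' 1 0 s ∧ ψ = d' ∘ₗ s + s ∘ₗ d := by
  obtain ⟨s, h1, h2, h3⟩ := HL h.hd h.dd h'.acy 0 ψ hψ hψd 0 (fun j _ => by simp)
    (fun j hj => by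
      apply h'.exact0
      · simpa using hψ.e_mem (j := j) (by omega)
      · have := LinearMap.congr_fun ha (e B j)
        simpa using this)
  exact ⟨s, h1, op_ext fun j => h3 j (by omega)⟩

end res

section tot
open ComplexityTest
variable {B : Type u} [CommRing B] [IsLocalRing B] {X : Type u} [AddCommGroup X] [Module B X]
  (F : MinFreeRes B X)

abbrev TJ : Type := Σ n, Fin (F.b n)
def tdeg : TJ F → ℕ := fun j => j.1
noncomputable def temb (n : ℕ) : (Fin (F.b n) → B) →ₗ[B] (TJ F →₀ B) :=
  ∑ i, (LinearMap.toSpanSingleton B (TJ F →₀ B) (e B ⟨n, i⟩)) ∘ₗ LinearMap.proj i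
noncomputable def tres (n : ℕ) : (TJ F →₀ B) →ₗ[B] (Fin (F.b n) → B) :=
  LinearMap.pi fun i => Finsupp.lapply ⟨n, i⟩

theorem temb_apply (n : ℕ) (v : Fin (F.b n) → B) : temb F n v = ∑ i, v i • e B (⟨n, i⟩ : TJ F) := by
  simp [temb]

theorem tres_apply (n : ℕ) (v : TJ F →₀ B) (i) : tres F n v i = v ⟨n, i⟩ := rfl

theorem tres_temb (n : ℕ) (v : Fin (F.b n) → B) : tres F n (temb F n v) = v := by
  classical
  funext i
  rw [tres_apply, temb_apply, Finsupp.finsetSum_apply]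
  rw [Finset.sum_eq_single i]
  · simp [e]
  · intro j _ hj
    simp [e, hj]
  · simp

theorem tres_temb_ne {n m : ℕ} (h : n ≠ m) (v : Fin (F.b n) → B) : tres F m (temb F n v) = 0 := by
  classical
  funext i
  rw [tres_apply, temb_apply, Finsupp.finsetSum_apply]
  refine Finset.sum_eq_zero fun j _ => ?_
  have : ¬ ((⟨n, j⟩ : TJ F) = ⟨m, i⟩) := fun h' => h (congrArg Sigma.fst h')
  simp [e, this]

theorem temb_mem (n : ℕ) (v : Fin (F.b n) → B) : temb F n v ∈ Hg B (tdeg F) n := by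
  rw [temb_apply]
  exact Submodule.sum_mem _ fun i _ => Submodule.smul_mem _ _ (e_mem_Hg rfl)

theorem temb_single (n : ℕ) (i) : temb F n (Pi.single i 1) = e B (⟨n, i⟩ : TJ F) := by
  classical
  rw [temb_apply, Finset.sum_eq_single i]
  · simp
  · intro j _ hj; simp [hj]
  · simp

noncomputable def td : (TJ F →₀ B) →ₗ[B] (TJ F →₀ B) := mkOp fun j =>
  match j with
  | ⟨0, _⟩ => 0
  | ⟨n + 1, i⟩ => temb F n (F.d n (Pi.single i 1))

noncomputable def taug : (TJ F →₀ B) →ₗ[B] X := F.aug ∘ₗ tres F 0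

theorem td_zero (v) : td F (temb F 0 v) = 0 := by
  rw [temb_apply, map_sum]
  refine Finset.sum_eq_zero fun i _ => ?_
  rw [map_smul, td, mkOp_e, smul_zero]

theorem td_succ (n : ℕ) (v) : td F (temb F (n + 1) v) = temb F n (F.d n v) := by
  suffices h : td F ∘ₗ temb F (n + 1) = temb F n ∘ₗ F.d n from LinearMap.congr_fun h v
  apply LinearMap.pi_ext'
  intro i
  ext1
  simp only [LinearMap.comp_apply, LinearMap.single_apply]
  rw [temb_single]
  simp [td]

theorem tres_td (n : ℕ) (v) : tres F n (td F v) = F.d n (tres F (n + 1) v) := by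
  suffices h : tres F n ∘ₗ td F = F.d n ∘ₗ tres F (n + 1) from LinearMap.congr_fun h v
  apply op_ext
  rintro ⟨m, i⟩
  simp only [LinearMap.comp_apply]
  rw [← temb_single]
  rcases m with _ | m
  · rw [td_zero, tres_temb_ne F (by omega), map_zero, map_zero]
  · rw [td_succ]
    by_cases h : m = n
    · subst h
      rw [tres_temb, tres_temb]
    · rw [tres_temb_ne F h, tres_temb_ne F (by omega), map_zero]

theorem t_ext {v w : TJ F →₀ B} (h : ∀ n, tres F n v = tres F n w) : v = w := by
  ext ⟨n, i⟩
  exact congrFun (h n) i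

theorem td_isDeg : IsDeg (tdeg F) (tdeg F) 0 1 (td F) := by
  rintro ⟨n, i⟩ l hl
  rcases n with _ | n
  · simp [td] at hl
  · rw [← temb_single, td_succ] at hl
    have := temb_mem F n _ l hl
    simp only [tdeg] at this ⊢
    omega

theorem t_isRes : IsRes (tdeg F) (td F) (taug F) where
  fin n := by
    have : {j | tdeg F j = n} = Set.range (fun i : Fin (F.b n) => (⟨n, i⟩ : TJ F)) := by
      ext ⟨m, i⟩
      simp only [tdeg, Set.mem_ofPred_eq, Set.mem_range]
      constructor
      · rintro rfl; exact ⟨i, rfl⟩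
      · rintro ⟨i', h⟩; exact (congrArg Sigma.fst h).symm
    rw [this]
    exact Set.finite_range _
  hd := td_isDeg F
  haug := by
    rintro ⟨n, i⟩ h
    rw [taug, LinearMap.comp_apply, ← temb_single, tres_temb_ne F (n := n) h, map_zero]
  dd := by
    apply LinearMap.ext; intro v
    apply t_ext; intro n
    rw [LinearMap.comp_apply, tres_td, tres_td, LinearMap.zero_apply, map_zero]
    exact (F.exact_succ n).apply_apply_eq_zero _
  augd := by
    apply LinearMap.ext; intro v
    rw [LinearMap.comp_apply, taug, LinearMap.comp_apply, tres_td, LinearMap.zero_apply]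
    exact F.exact_zero.apply_apply_eq_zero _
  surj := by
    intro x
    obtain ⟨v, hv⟩ := F.aug_surjective x
    exact ⟨temb F 0 v, by rw [taug, LinearMap.comp_apply, tres_temb, hv]⟩
  exact := by
    intro a ha ha'
    have : ∀ n, ∃ w, F.d n w = tres F n a := by
      intro n
      rcases n with _ | n
      · exact (F.exact_zero _).1 ha'
      · refine (F.exact_succ n _).1 ?_
        rw [← tres_td, ha, map_zero]
    choose w hw using this
    classical
    refine ⟨∑ n ∈ a.support.image Sigma.fst, temb F (n + 1) (w n), t_ext F fun m => ?_⟩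
    rw [map_sum, map_sum]
    simp only [td_succ, hw]
    by_cases hm : m ∈ a.support.image Sigma.fst
    · rw [Finset.sum_eq_single m]
      · rw [tres_temb]
      · intro b _ hb; rw [tres_temb_ne F hb]
      · intro h; exact absurd hm h
    · rw [Finset.sum_eq_zero]
      · funext i
        symm
        by_contra h
        apply hm
        rw [Finset.mem_image]
        exact ⟨⟨m, i⟩, by rw [Finsupp.mem_support_iff]; exact h, rfl⟩
      · intro b hb
        rw [tres_temb_ne F]
        rintro rfl; exact hm hb

theorem td_minimal (j l) : td F (e B j) l ∈ maximalIdeal B := by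
  rcases j with ⟨n, i⟩
  rcases n with _ | n
  · simp [td]
  · rw [← temb_single, td_succ]
    rcases l with ⟨m, i'⟩
    rw [← tres_apply]
    by_cases h : n = m
    · subst h
      rw [tres_temb]
      exact F.minimal _ _ _
    · rw [tres_temb_ne F h]; simp

theorem t_card (n : ℕ) : {j | tdeg F j = n}.ncard = F.b n := by
  have : {j | tdeg F j = n} = Set.range (fun i : Fin (F.b n) => (⟨n, i⟩ : TJ F)) := by
    ext ⟨m, i⟩
    simp only [tdeg, Set.mem_ofPred_eq, Set.mem_range]
    constructor
    · rintro rfl; exact ⟨i, rfl⟩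
    · rintro ⟨i', h⟩; exact (congrArg Sigma.fst h).symm
  rw [this, ← Set.image_univ, Set.ncard_image_of_injective _ (by
    intro a b h; simpa using h), Set.ncard_univ]
  simp

end tot
end CX
end Part2

section Part3
open CategoryTheory Opposite Filter IsLocalRing ComplexityTest
namespace CX

section FLs
variable {S V : Type*} [CommRing S] [AddCommGroup V] [Module S V] [IsNoetherian S V]

theorem ker_pow_stab (x : S) : ∃ a, 1 ≤ a ∧ ∀ n (w : V), x ^ n • w = 0 → x ^ a • w = 0 := by
  let K : ℕ →o Submodule S V := ⟨fun n => LinearMap.ker (LinearMap.lsmul S V (x ^ n)), by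
    intro n m hnm w hw
    simp only [LinearMap.mem_ker, LinearMap.lsmul_apply] at hw ⊢
    obtain ⟨c, rfl⟩ := Nat.exists_eq_add_of_le hnm
    rw [pow_add, mul_comm, mul_smul, hw, smul_zero]⟩
  obtain ⟨a, ha⟩ := monotone_stabilizes_iff_noetherian.2 ‹_› K
  refine ⟨a + 1, by omega, fun n w hw => ?_⟩
  have h1 : w ∈ K (n + a) := K.monotone (show n ≤ n + a by omega) (LinearMap.mem_ker.2 hw)
  rw [← ha (n + a) (by omega)] at h1
  have : w ∈ K (a + 1) := K.monotone (show a ≤ a + 1 by omega) h1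
  exact LinearMap.mem_ker.1 this

theorem FL (O : ℕ → S → Prop) (hmul : ∀ p q x y, O p x → O q y → O (p + q) (x * y))
    (hadd : ∀ p x y, O p x → O p y → O p (x + y)) (h0 : O 1 0) (T : ℕ → S) (r : ℕ)
    (hT : ∀ j < r, O 1 (T j)) :
    ∃ q f, 1 ≤ q ∧ O q f ∧ ∀ w : V, f • w = 0 → ∃ N, ∀ j < r, T j ^ N • w = 0 := by
  have hpow : ∀ p x m, O p x → 1 ≤ m → O (m * p) (x ^ m) := by
    intro p x m hx hm
    induction m, hm using Nat.le_induction with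
    | base => simpa using hx
    | succ m hm ih =>
      rw [pow_succ, Nat.add_mul, one_mul]
      exact hmul _ _ _ _ ih hx
  induction r with
  | zero => exact ⟨1, 0, le_rfl, h0, fun w _ => ⟨0, fun j hj => absurd hj (by omega)⟩⟩
  | succ r ih =>
    obtain ⟨q, u0, hq, hu0, hu⟩ := ih (fun j hj => hT j (by omega))
    obtain ⟨a, ha1, ha⟩ := ker_pow_stab (V := V) (T r)
    obtain ⟨b, hb1, hb⟩ := ker_pow_stab (V := V) u0
    -- equal degrees
    set u := u0 ^ (a * b) with hudef
    set v := T r ^ (a * b * q) with hvdef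
    set D := a * b * q with hD
    have hab : 1 ≤ a * b := Nat.mul_pos ha1 hb1
    have hD1 : 1 ≤ D := Nat.mul_pos hab hq
    have hOu : O D u := hpow _ _ _ hu0 hab
    have hOv : O D v := by simpa using hpow _ _ (a * b * q) (hT r (by omega)) hD1
    have hv : ∀ n (w : V), v ^ n • w = 0 → v • w = 0 := by
      intro n w hw
      rw [hvdef, ← pow_mul] at hw
      have h1 := ha _ _ hw
      have : a * b * q = a * (b * q - 1) + a := by
        have : 1 ≤ b * q := Nat.mul_pos hb1 hq
        rw [← Nat.mul_succ, mul_assoc]; congr 1; omega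
      rw [hvdef, hD, this, pow_add, mul_smul, h1, smul_zero]
    let p : ℕ → S := fun m => Nat.rec v (fun m pm => pm * (u ^ (2 ^ m) + pm)) m
    have hp0 : p 0 = v := rfl
    have hps : ∀ m, p (m + 1) = p m * (u ^ (2 ^ m) + p m) := fun m => rfl
    have hOp : ∀ m, O (2 ^ m * D) (p m) := by
      intro m
      induction m with
      | zero => simpa [hp0] using hOv
      | succ m ih =>
        rw [hps, pow_succ, mul_two, Nat.add_mul]
        exact hmul _ _ _ _ ih (hadd _ _ _ (hpow _ _ _ hOu Nat.one_le_two_pow) ih)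
    have hpv : ∀ m, ∃ y, p m = v ^ (2 ^ m) + u * y := by
      intro m
      induction m with
      | zero => exact ⟨0, by simp [hp0]⟩
      | succ m ih =>
        obtain ⟨y, hy⟩ := ih
        obtain ⟨c, hc⟩ : ∃ c, 2 ^ m = c + 1 := ⟨2 ^ m - 1, by have := Nat.one_le_two_pow (n := m); omega⟩
        refine ⟨y * (u ^ (2 ^ m) + p m) + v ^ (2 ^ m) * (u ^ c + y), ?_⟩
        have h2 : (2:ℕ) ^ (m + 1) = 2 ^ m + 2 ^ m := by rw [pow_succ]; omega
        rw [hps, h2, pow_add]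
        have : u ^ (2 ^ m) = u * u ^ c := by rw [hc, pow_succ, mul_comm]
        nth_rw 1 [hy]
        linear_combination (v ^ 2 ^ m) * hy + v ^ 2 ^ m * this
    let K : ℕ →o Submodule S V := ⟨fun m => LinearMap.ker (LinearMap.lsmul S V (v * p m)),
      monotone_nat_of_le_succ (by
        intro m w hw
        simp only [LinearMap.mem_ker, LinearMap.lsmul_apply] at hw ⊢
        rw [hps, ← mul_assoc, mul_comm, mul_smul, hw, smul_zero])⟩
    obtain ⟨m, hm⟩ := monotone_stabilizes_iff_noetherian.2 ‹_› K
    refine ⟨2 ^ m * D, u ^ (2 ^ m) + p m, Nat.mul_pos (by positivity) hD1,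
      hadd _ _ _ (hpow _ _ _ hOu Nat.one_le_two_pow) (hOp m), fun w hw => ?_⟩
    have h1 : (v * p m) • w = 0 := by
      have : w ∈ K (m + 1) := by
        simp only [K, OrderHom.coe_mk, LinearMap.mem_ker, LinearMap.lsmul_apply]
        rw [hps, ← mul_assoc, mul_smul, hw, smul_zero]
      rw [← hm (m + 1) (by omega)] at this
      exact LinearMap.mem_ker.1 this
    have h2 : v • u ^ (2 ^ m) • w = 0 := by
      have : v • (u ^ (2 ^ m) + p m) • w = 0 := by rw [hw, smul_zero]
      rw [add_smul, smul_add, ← mul_smul v (p m), h1, add_zero] at this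
      exact this
    obtain ⟨y, hy⟩ := hpv m
    have h3 : v • w = 0 := by
      have hpn : ∀ n, ∃ z, p m ^ n = (v ^ (2 ^ m)) ^ n + u * z := by
        intro n
        induction n with
        | zero => exact ⟨0, by simp⟩
        | succ n ih =>
          obtain ⟨z, hz⟩ := ih
          exact ⟨z * p m + (v ^ 2 ^ m) ^ n * y, by
            rw [pow_succ, pow_succ, hz]; linear_combination (v ^ 2 ^ m) ^ n * hy⟩
      -- v ^ (1 + 2^m) w = - v u y w ; iterate
      have key : ∀ n, ∃ z, v • (v ^ (2 ^ m)) ^ n • w = (z * u ^ n * v) • w := by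
        intro n
        induction n with
        | zero => exact ⟨1, by simp⟩
        | succ n ih =>
          obtain ⟨z, hz⟩ := ih
          refine ⟨-(z * y), ?_⟩
          have e1 : v • (v ^ (2 ^ m)) ^ (n + 1) • w = v ^ (2 ^ m) • (v • (v ^ (2 ^ m)) ^ n • w) := by
            simp only [← mul_smul]; congr 1; ring
          rw [e1, hz]
          have e2 : v ^ (2 ^ m) = p m - u * y := by rw [hy]; ring
          rw [e2, ← mul_smul]
          have e3 : (p m - u * y) * (z * u ^ n * v) =
            (z * u ^ n) * (v * p m) + (-(z * y) * u ^ (n + 1) * v) := by ring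
          rw [e3, add_smul, mul_smul (z * u ^ n), h1, smul_zero, zero_add]
      obtain ⟨z, hz⟩ := key (2 ^ m)
      have : (z * u ^ 2 ^ m * v) • w = 0 := by
        rw [mul_assoc, mul_smul, mul_comm, mul_smul, h2, smul_zero]
      rw [this] at hz
      refine hv (1 + 2 ^ m * 2 ^ m) w ?_
      rw [← mul_smul] at hz
      convert hz using 2
      ring
    have h4 : p m • w = 0 := by
      rw [mul_comm, mul_smul] at h1
      have : ∀ n, ∃ z, p n = z * v := by
        intro n
        induction n with
        | zero => exact ⟨1, by simp [hp0]⟩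
        | succ n ih =>
          obtain ⟨z, hz⟩ := ih
          exact ⟨z * (u ^ (2 ^ n) + p n), by rw [hps]; nth_rw 1 [hz]; ring⟩
      obtain ⟨z, hz⟩ := this m
      rw [hz, mul_smul, h3, smul_zero]
    have h5 : u ^ (2 ^ m) • w = 0 := by
      rw [add_smul, h4, add_zero] at hw; exact hw
    have h6 : ∀ n (w : V), u0 ^ n • w = 0 → ∃ N, ∀ j < r, T j ^ N • w = 0 := by
      intro n
      induction n with
      | zero => intro w hw; exact ⟨0, fun j hj => by simpa using hw⟩
      | succ n ih =>
        intro w hw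
        obtain ⟨N, hN⟩ := hu (u0 ^ n • w) (by rw [← mul_smul, ← pow_succ']; exact hw)
        have : ∀ N' ≥ N, ∀ j < r, u0 ^ n • (T j ^ N' • w) = 0 := by
          intro N' hN' j hj
          obtain ⟨c, rfl⟩ := Nat.exists_eq_add_of_le hN'
          rw [smul_comm, pow_add, mul_comm, mul_smul, hN j hj, smul_zero]
        have h7 : ∀ j < r, ∃ M, T j ^ M • w = 0 := by
          intro j hj
          obtain ⟨N2, h8⟩ := ih _ (this N le_rfl j hj)
          exact ⟨N2 + N, by rw [pow_add, mul_smul]; exact h8 j hj⟩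
        choose! M hM using h7
        refine ⟨∑ j ∈ Finset.range r, M j, fun j hj => ?_⟩
        have : M j ≤ ∑ j ∈ Finset.range r, M j :=
          Finset.single_le_sum (f := M) (fun _ _ => Nat.zero_le _) (by simpa using hj)
        obtain ⟨c, hc⟩ := Nat.exists_eq_add_of_le this
        rw [hc, pow_add, mul_comm, mul_smul, hM j hj, smul_zero]
    obtain ⟨N, hN⟩ := h6 _ w (by rw [hudef, ← pow_mul] at h5; exact h5)
    refine ⟨N + D, fun j hj => ?_⟩
    rcases Nat.lt_succ_iff_lt_or_eq.1 hj with h | rfl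
    · rw [pow_add, mul_comm, mul_smul, hN j h, smul_zero]
    · rw [pow_add, mul_smul, ← hvdef, h3, smul_zero]

end FLs
end CX
end Part3

section Part4
open CategoryTheory Opposite Filter IsLocalRing ComplexityTest
namespace CX

section graded
variable {k : Type*} [Field k]

/-- action of a polynomial ring through commuting operators -/
theorem exists_polyAct {V : Type*} [AddCommGroup V] [Module k V] {r : ℕ}
    (τ : Fin r → Module.End k V) (hc : ∀ i j, τ i * τ j = τ j * τ i) :
    ∃ ρ : MvPolynomial (Fin r) k →ₐ[k] Module.End k V, ∀ i, ρ (MvPolynomial.X i) = τ i := by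
  have hcomm : ∀ a ∈ Set.range τ, ∀ b ∈ Set.range τ, a * b = b * a := by
    rintro _ ⟨i, rfl⟩ _ ⟨j, rfl⟩; exact hc i j
  letI : CommRing (Algebra.adjoin k (Set.range τ)) := Algebra.adjoinCommRingOfComm k hcomm
  let x : Fin r → Algebra.adjoin k (Set.range τ) := fun i => ⟨τ i, Algebra.subset_adjoin ⟨i, rfl⟩⟩
  refine ⟨(Algebra.adjoin k (Set.range τ)).val.comp (MvPolynomial.aeval x), fun i => ?_⟩
  simp [x]

variable {E : ℕ → Type*} [∀ n, AddCommGroup (E n)] [∀ n, Module k (E n)]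

open DirectSum in
noncomputable def tauOp (t : ∀ n, E n →ₗ[k] E (n + 2)) : Module.End k (⨁ n, E n) :=
  DirectSum.toModule k ℕ _ fun n => DirectSum.lof k ℕ E (n + 2) ∘ₗ t n

theorem tauOp_lof (t : ∀ n, E n →ₗ[k] E (n + 2)) (n : ℕ) (x : E n) :
    tauOp t (DirectSum.lof k ℕ E n x) = DirectSum.lof k ℕ E (n + 2) (t n x) := by
  simp [tauOp]

theorem tauOp_apply (t : ∀ n, E n →ₗ[k] E (n + 2)) (v : DirectSum ℕ E) (n : ℕ) :
    tauOp t v (n + 2) = t n (v n) := by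
  suffices h : DirectSum.component k ℕ E (n + 2) ∘ₗ tauOp t = t n ∘ₗ DirectSum.component k ℕ E n from
    LinearMap.congr_fun h v
  apply DirectSum.linearMap_ext
  intro m
  ext x
  simp only [LinearMap.comp_apply, tauOp_lof]
  by_cases h : m = n
  · subst h
    rw [DirectSum.component.lof_self, DirectSum.component.lof_self]
  · rw [DirectSum.component.of, DirectSum.component.of, dif_neg (by omega), dif_neg h, map_zero]

theorem tauOp_apply_lt (t : ∀ n, E n →ₗ[k] E (n + 2)) (v : DirectSum ℕ E) (n : ℕ) (hn : n < 2) :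
    tauOp t v n = 0 := by
  suffices h : DirectSum.component k ℕ E n ∘ₗ tauOp t = 0 from
    LinearMap.congr_fun h v
  apply DirectSum.linearMap_ext
  intro m
  ext x
  simp only [LinearMap.comp_apply, tauOp_lof]
  rw [DirectSum.component.of, dif_neg (by omega)]; simp

/-- commuting -/
def Comm {r : ℕ} (t : Fin r → ∀ n, E n →ₗ[k] E (n + 2)) : Prop :=
  ∀ i j n x, t i (n + 2) (t j n x) = t j (n + 2) (t i n x)

def FGr {r : ℕ} (t : Fin r → ∀ n, E n →ₗ[k] E (n + 2)) (D : ∀ n, Submodule k (E n)) : Prop :=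
  ∃ N, ∀ n ≥ N, ∀ x ∈ D (n + 2), ∃ y : Fin r → E n, (∀ i, y i ∈ D n) ∧ x = ∑ i, t i n (y i)

theorem tau_comm {r : ℕ} {t : Fin r → ∀ n, E n →ₗ[k] E (n + 2)} (hc : Comm t) (i j : Fin r) :
    tauOp (t i) * tauOp (t j) = tauOp (t j) * tauOp (t i) := by
  apply DirectSum.linearMap_ext
  intro m
  ext1 x
  simp only [LinearMap.comp_apply, Module.End.mul_apply, tauOp_lof, hc i j]

theorem graded_noeth [∀ n, Module.Finite k (E n)] {r : ℕ} {t : Fin r → ∀ n, E n →ₗ[k] E (n + 2)}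
    (hfg : FGr t (fun _ => ⊤))
    (ρ : MvPolynomial (Fin r) k →ₐ[k] Module.End k (DirectSum ℕ E))
    (hρ : ∀ i, ρ (MvPolynomial.X i) = tauOp (t i)) :
    letI : Module (MvPolynomial (Fin r) k) (DirectSum ℕ E) := Module.compHom _ ρ.toRingHom
    IsNoetherian (MvPolynomial (Fin r) k) (DirectSum ℕ E) := by
  letI : Module (MvPolynomial (Fin r) k) (DirectSum ℕ E) := Module.compHom _ ρ.toRingHom
  have hsm : ∀ (s : MvPolynomial (Fin r) k) (v : DirectSum ℕ E), s • v = ρ s v := fun s v => rfl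
  obtain ⟨N, hN⟩ := hfg
  choose G hG using fun n => (Module.Finite.fg_top (R := k) (M := E n))
  classical
  let gs : Set (DirectSum ℕ E) := ⋃ n ∈ Set.Iio (N + 2), (DirectSum.lof k ℕ E n) '' (G n : Set (E n))
  have hgs : gs.Finite := Set.Finite.biUnion (Set.finite_Iio _) fun n _ => (G n).finite_toSet.image _
  have hk : ∀ (W : Submodule (MvPolynomial (Fin r) k) (DirectSum ℕ E)) (c : k) (v), v ∈ W → c • v ∈ W := by
    intro W c v hv
    have : c • v = (MvPolynomial.C c : MvPolynomial (Fin r) k) • v := by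
      rw [hsm, ← MvPolynomial.algebraMap_eq, AlgHom.commutes]; rfl
    rw [this]; exact W.smul_mem _ hv
  have hspan : ∀ n (x : E n), DirectSum.lof k ℕ E n x ∈ Submodule.span (MvPolynomial (Fin r) k) gs := by
    intro n
    induction n using Nat.strong_induction_on with
    | _ n ih =>
      intro x
      by_cases hn : n < N + 2
      · have hx : x ∈ Submodule.span k (G n : Set (E n)) := by rw [hG n]; trivial
        induction hx using Submodule.span_induction with
        | mem y hy =>
          apply Submodule.subset_span
          exact Set.mem_biUnion (show n ∈ Set.Iio (N + 2) from hn) ⟨y, hy, rfl⟩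
        | zero => simp
        | add a b _ _ ha hb => rw [map_add]; exact Submodule.add_mem _ ha hb
        | smul c a _ ha => rw [map_smul]; exact hk _ _ _ ha
      · obtain ⟨m, rfl⟩ : ∃ m, n = m + 2 := ⟨n - 2, by omega⟩
        obtain ⟨y, -, rfl⟩ := hN m (by omega) x trivial
        rw [map_sum]
        refine Submodule.sum_mem _ fun i _ => ?_
        rw [← tauOp_lof, ← hρ, ← hsm]
        exact Submodule.smul_mem _ _ (ih m (by omega) _)
  have : Module.Finite (MvPolynomial (Fin r) k) (DirectSum ℕ E) := by
    refine ⟨⟨hgs.toFinset, ?_⟩⟩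
    rw [Set.Finite.coe_toFinset, eq_top_iff]
    rintro v -
    induction v using DirectSum.induction_on with
    | zero => simp
    | of n x => exact hspan n x
    | add a b ha hb => exact Submodule.add_mem _ ha hb
  exact inferInstance

theorem GH [∀ n, Module.Finite k (E n)] {r : ℕ} {t : Fin r → ∀ n, E n →ₗ[k] E (n + 2)}
    (hc : Comm t) (hfg : FGr t (fun _ => ⊤)) (D : ∀ n, Submodule k (E n))
    (hD : ∀ i n, ∀ x ∈ D n, t i n x ∈ D (n + 2)) : FGr t D := by
  obtain ⟨ρ, hρ⟩ := exists_polyAct (fun i => tauOp (t i)) (tau_comm hc)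
  letI : Module (MvPolynomial (Fin r) k) (DirectSum ℕ E) := Module.compHom _ ρ.toRingHom
  have hnoeth : IsNoetherian (MvPolynomial (Fin r) k) (DirectSum ℕ E) := graded_noeth hfg ρ hρ
  have hsm : ∀ (s : MvPolynomial (Fin r) k) (v : DirectSum ℕ E), s • v = ρ s v := fun s v => rfl
  have closed : ∀ W : Submodule k (DirectSum ℕ E), (∀ i, ∀ v ∈ W, tauOp (t i) v ∈ W) →
      ∀ (s : MvPolynomial (Fin r) k), ∀ v ∈ W, s • v ∈ W := by
    intro W hW s
    induction s using MvPolynomial.induction_on with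
    | C a =>
      intro v hv
      rw [hsm, ← MvPolynomial.algebraMap_eq, AlgHom.commutes]
      exact W.smul_mem a hv
    | add p q hp hq => intro v hv; rw [add_smul]; exact W.add_mem (hp v hv) (hq v hv)
    | mul_X p i hp =>
      intro v hv
      rw [mul_smul]
      apply hp
      rw [hsm, hρ]
      exact hW i v hv
  let Dk : Submodule k (DirectSum ℕ E) :=
    { carrier := {v | ∀ n, v n ∈ D n}
      zero_mem' := fun n => by simp
      add_mem' := fun {a b} ha hb n => by rw [DirectSum.add_apply]; exact (D n).add_mem (ha n) (hb n)
      smul_mem' := fun c a ha n => by rw [DirectSum.smul_apply]; exact (D n).smul_mem c (ha n) }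
  have hDk : ∀ i, ∀ v ∈ Dk, tauOp (t i) v ∈ Dk := by
    intro i v hv n
    by_cases hn : n < 2
    · rw [tauOp_apply_lt _ _ _ hn]; exact (D n).zero_mem
    · obtain ⟨m, rfl⟩ : ∃ m, n = m + 2 := ⟨n - 2, by omega⟩
      rw [tauOp_apply]; exact hD i m _ (hv m)
  let DS : Submodule (MvPolynomial (Fin r) k) (DirectSum ℕ E) :=
    { carrier := Dk
      zero_mem' := Dk.zero_mem
      add_mem' := fun ha hb => Dk.add_mem ha hb
      smul_mem' := fun c v hv => closed Dk hDk c v hv }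
  obtain ⟨s, hs⟩ := hnoeth.noetherian DS
  classical
  let N := (s.sup fun g => (DFinsupp.support g).sup id) + 1
  have hgN : ∀ g ∈ s, ∀ n ≥ N, g n = 0 := by
    intro g hg n hn
    by_contra h
    have h1 : n ≤ (DFinsupp.support g).sup id := Finset.le_sup (f := id) (by simpa using h)
    have h2 : (DFinsupp.support g).sup id ≤ s.sup fun g => (DFinsupp.support g).sup id :=
      Finset.le_sup (f := fun g : DirectSum ℕ E => (DFinsupp.support g).sup id) hg
    omega
  let D' : ∀ n, Submodule k (E (n + 2)) := fun n =>
    (Submodule.pi Set.univ (fun _ : Fin r => D n)).map (∑ i, t i n ∘ₗ LinearMap.proj i)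
  let Dk' : Submodule k (DirectSum ℕ E) :=
    { carrier := {v | v ∈ Dk ∧ ∀ n ≥ N, v (n + 2) ∈ D' n}
      zero_mem' := ⟨Dk.zero_mem, fun n _ => by simp⟩
      add_mem' := fun {a b} ha hb => ⟨Dk.add_mem ha.1 hb.1, fun n hn => by
        rw [DirectSum.add_apply]; exact (D' n).add_mem (ha.2 n hn) (hb.2 n hn)⟩
      smul_mem' := fun c a ha => ⟨Dk.smul_mem c ha.1, fun n hn => by
        rw [DirectSum.smul_apply]; exact (D' n).smul_mem c (ha.2 n hn)⟩ }
  have hDk' : ∀ i, ∀ v ∈ Dk', tauOp (t i) v ∈ Dk' := by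
    intro i v hv
    refine ⟨hDk i v hv.1, fun n hn => ?_⟩
    rw [tauOp_apply]
    refine ⟨Pi.single i (v n), ?_, ?_⟩
    · intro j _
      by_cases h : j = i
      · subst h; simpa using hv.1 n
      · simp [h]
    · simp only [LinearMap.sum_apply, LinearMap.comp_apply, LinearMap.proj_apply]
      rw [Finset.sum_eq_single i]
      · simp
      · intro j _ hj; simp [hj]
      · simp
  let DS' : Submodule (MvPolynomial (Fin r) k) (DirectSum ℕ E) :=
    { carrier := Dk'
      zero_mem' := Dk'.zero_mem
      add_mem' := fun ha hb => Dk'.add_mem ha hb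
      smul_mem' := fun c v hv => closed Dk' hDk' c v hv }
  have hle : DS ≤ DS' := by
    rw [← hs, Submodule.span_le]
    intro g hg
    have hgD : g ∈ DS := by rw [← hs]; exact Submodule.subset_span hg
    refine ⟨hgD, fun n hn => ?_⟩
    rw [hgN g hg (n + 2) (by omega)]; exact (D' n).zero_mem
  refine ⟨N, fun n hn x hx => ?_⟩
  have hxD : DirectSum.lof k ℕ E (n + 2) x ∈ DS := by
    intro m
    by_cases h : n + 2 = m
    · subst h
      rw [DirectSum.lof_eq_of, DirectSum.of_eq_same]; exact hx
    · rw [DirectSum.lof_eq_of, DirectSum.of_eq_of_ne _ _ _ (Ne.symm h)]; exact (D m).zero_mem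
  have h2 := (hle hxD).2 n hn
  rw [DirectSum.lof_eq_of, DirectSum.of_eq_same] at h2
  obtain ⟨y, hy, hy'⟩ := h2
  refine ⟨y, fun i => hy i trivial, ?_⟩
  rw [← hy']; simp

def Delta (h : ℕ → ℤ) : ℕ → ℤ := fun n => h (n + 2) - h n

theorem Delta_iter_sub (r : ℕ) (f g : ℕ → ℤ) : Delta^[r] (f - g) = Delta^[r] f - Delta^[r] g := by
  induction r generalizing f g with
  | zero => rfl
  | succ r ih =>
    rw [Function.iterate_succ_apply, Function.iterate_succ_apply, Function.iterate_succ_apply, ← ih]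
    congr 1
    funext n
    simp only [Delta, Pi.sub_apply]; ring

end graded

theorem delta_lemma {k : Type*} [Field k] (r : ℕ) : ∀ (E : ℕ → Type v) [∀ n, AddCommGroup (E n)] [∀ n, Module k (E n)]
    [∀ n, Module.Finite k (E n)] (t : Fin r → ∀ n, E n →ₗ[k] E (n + 2)) (_ : Comm t)
    (_ : FGr t (fun _ => ⊤)),
    ∃ N, ∀ n ≥ N, Delta^[r] (fun n => (Module.finrank k (E n) : ℤ)) n = 0 := by
  induction r with
  | zero =>
    intro E _ _ _ t hc ⟨N, hN⟩
    refine ⟨N + 2, fun n hn => ?_⟩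
    obtain ⟨m, rfl⟩ : ∃ m, n = m + 2 := ⟨n - 2, by omega⟩
    have : Subsingleton (E (m + 2)) := by
      refine ⟨fun x y => ?_⟩
      obtain ⟨_, _, hx⟩ := hN m (by omega) x trivial
      obtain ⟨_, _, hy⟩ := hN m (by omega) y trivial
      simp at hx hy
      rw [hx, hy]
    simp [Module.finrank_zero_of_subsingleton]
  | succ r ih =>
    intro E _ _ _ t hc hfg
    have hK := GH hc hfg (fun n => LinearMap.ker (t (Fin.last r) n)) (by
      intro i n x hx
      rw [LinearMap.mem_ker] at hx ⊢
      rw [hc, hx, map_zero])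
    let K : ℕ → Type _ := fun n => LinearMap.ker (t (Fin.last r) n)
    let C : ℕ → Type _ := fun n => E (n + 2) ⧸ LinearMap.range (t (Fin.last r) n)
    let tK : Fin r → ∀ n, K n →ₗ[k] K (n + 2) := fun i n => (t i.castSucc n).restrict (by
      intro x hx
      rw [LinearMap.mem_ker] at hx ⊢
      rw [hc, hx, map_zero])
    let tC : Fin r → ∀ n, C n →ₗ[k] C (n + 2) := fun i n =>
      Submodule.mapQ _ _ (t i.castSucc (n + 2)) (by
        rintro _ ⟨x, rfl⟩
        exact ⟨t i.castSucc n x, hc _ _ _ _⟩)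
    obtain ⟨N1, h1⟩ := ih K tK (by
      intro i j n x
      apply Subtype.ext
      exact hc _ _ _ _) (by
      obtain ⟨N, hN⟩ := hK
      refine ⟨N, fun n hn x _ => ?_⟩
      obtain ⟨y, hy, hxy⟩ := hN n hn x.1 x.2
      refine ⟨fun i => ⟨y i.castSucc, hy _⟩, fun _ => trivial, Subtype.ext ?_⟩
      rw [hxy, Fin.sum_univ_castSucc, LinearMap.mem_ker.1 (hy (Fin.last r)), add_zero]
      rw [AddSubmonoidClass.coe_finsetSum]
      rfl)
    obtain ⟨N2, h2⟩ := ih C tC (by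
      intro i j n x
      obtain ⟨x, rfl⟩ := Submodule.Quotient.mk_surjective _ x
      change Submodule.Quotient.mk (t i.castSucc (n + 2 + 2) (t j.castSucc (n + 2) x)) =
        Submodule.Quotient.mk (t j.castSucc (n + 2 + 2) (t i.castSucc (n + 2) x))
      rw [hc]) (by
      obtain ⟨N, hN⟩ := hfg
      refine ⟨N, fun n hn x _ => ?_⟩
      obtain ⟨x, rfl⟩ := Submodule.Quotient.mk_surjective _ x
      obtain ⟨y, -, hxy⟩ := hN (n + 2) (by omega) x trivial
      refine ⟨fun i => Submodule.Quotient.mk (y i.castSucc), fun _ => trivial, ?_⟩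
      rw [hxy, Fin.sum_univ_castSucc, ← Submodule.mkQ_apply, map_add, map_sum]
      have : (LinearMap.range (t (Fin.last r) (n + 2))).mkQ (t (Fin.last r) (n + 2) (y (Fin.last r))) = 0 := by
        rw [Submodule.mkQ_apply, Submodule.Quotient.mk_eq_zero]; exact ⟨_, rfl⟩
      rw [this, add_zero]; rfl)
    refine ⟨N1 + N2, fun n hn => ?_⟩
    rw [Function.iterate_succ_apply]
    have : Delta (fun n => (Module.finrank k (E n) : ℤ)) =
      (fun n => (Module.finrank k (C n) : ℤ)) - (fun n => (Module.finrank k (K n) : ℤ)) := by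
      funext n
      simp only [Delta, Pi.sub_apply]
      have e1 := LinearMap.finrank_range_add_finrank_ker (t (Fin.last r) n)
      have e2 := Submodule.finrank_quotient_add_finrank (LinearMap.range (t (Fin.last r) n))
      simp only [K, C]
      omega
    rw [this, Delta_iter_sub, Pi.sub_apply, h1 n (by omega), h2 n (by omega), sub_zero]

section graded2
variable {k : Type*} [Field k] {E : ℕ → Type*} [∀ n, AddCommGroup (E n)] [∀ n, Module k (E n)]

theorem exists_filter_regular [∀ n, Module.Finite k (E n)] {r : ℕ} {t : Fin r → ∀ n, E n →ₗ[k] E (n + 2)}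
    (hc : Comm t) (hfg : FGr t (fun _ => ⊤))
    (O : ℕ → Module.End k (DirectSum ℕ E) → Prop)
    (hmul : ∀ p q x y, O p x → O q y → O (p + q) (x * y))
    (hadd : ∀ p x y, O p x → O p y → O p (x + y)) (h0 : O 1 0)
    (hT : ∀ j, O 1 (tauOp (t j))) :
    ∃ q f, 1 ≤ q ∧ O q f ∧ ∃ N, ∀ n ≥ N, ∀ x : E n, f (DirectSum.lof k ℕ E n x) = 0 → x = 0 := by
  obtain ⟨ρ, hρ⟩ := exists_polyAct (fun i => tauOp (t i)) (tau_comm hc)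
  letI : Module (MvPolynomial (Fin r) k) (DirectSum ℕ E) := Module.compHom _ ρ.toRingHom
  have hnoeth : IsNoetherian (MvPolynomial (Fin r) k) (DirectSum ℕ E) := graded_noeth hfg ρ hρ
  have hsm : ∀ (s : MvPolynomial (Fin r) k) (v : DirectSum ℕ E), s • v = ρ s v := fun s v => rfl
  let T : ℕ → MvPolynomial (Fin r) k := fun j => if h : j < r then MvPolynomial.X ⟨j, h⟩ else 0
  have hTj : ∀ j : Fin r, T j = MvPolynomial.X j := fun j => by simp [T]
  obtain ⟨q, f, hq, hf, hfN⟩ := FL (V := DirectSum ℕ E) (fun p s => O p (ρ s))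
    (by intro p q x y hx hy; rw [map_mul]; exact hmul _ _ _ _ hx hy)
    (by intro p x y hx hy; rw [map_add]; exact hadd _ _ _ hx hy)
    (by rw [map_zero]; exact h0) T r (by
      intro j hj
      have := hTj ⟨j, hj⟩
      simp only at this
      rw [this, hρ]; exact hT _)
  refine ⟨q, ρ f, hq, hf, ?_⟩
  let Γ : Submodule (MvPolynomial (Fin r) k) (DirectSum ℕ E) :=
    { carrier := {v | ∃ N, ∀ j < r, T j ^ N • v = 0}
      zero_mem' := ⟨0, fun j _ => smul_zero _⟩
      add_mem' := by
        rintro a b ⟨N, hN⟩ ⟨M, hM⟩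
        refine ⟨N + M, fun j hj => ?_⟩
        rw [smul_add, pow_add, mul_smul, mul_smul, hM j hj, smul_zero, add_zero, smul_comm, hN j hj, smul_zero]
      smul_mem' := by
        rintro c a ⟨N, hN⟩
        exact ⟨N, fun j hj => by rw [smul_comm, hN j hj, smul_zero]⟩ }
  let I : Ideal (MvPolynomial (Fin r) k) := Ideal.span (Set.range (MvPolynomial.X (R := k)))
  have hI : I ≤ (Module.annihilator (MvPolynomial (Fin r) k) Γ).radical := by
    rw [Ideal.span_le]
    rintro _ ⟨j, rfl⟩
    obtain ⟨a, -, ha⟩ := ker_pow_stab (V := DirectSum ℕ E) (MvPolynomial.X (R := k) j)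
    refine ⟨a, ?_⟩
    rw [Module.mem_annihilator]
    rintro ⟨v, N, hN⟩
    apply Subtype.ext
    refine ha N v ?_
    have := hN j j.2
    rwa [hTj j] at this
  obtain ⟨m, hm⟩ := Ideal.exists_pow_le_of_le_radical_of_fg hI (IsNoetherian.noetherian I)
  let D : ∀ n, Submodule k (E n) := fun n =>
    { carrier := {x | DirectSum.lof k ℕ E n x ∈ Γ}
      zero_mem' := by
        change DirectSum.lof k ℕ E n 0 ∈ Γ
        rw [map_zero]; exact Γ.zero_mem
      add_mem' := by
        intro a b ha hb
        change DirectSum.lof k ℕ E n (a + b) ∈ Γ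
        rw [map_add]; exact Γ.add_mem ha hb
      smul_mem' := by
        intro c a ha
        change DirectSum.lof k ℕ E n (c • a) ∈ Γ
        rw [map_smul]
        have : c • DirectSum.lof k ℕ E n a = (MvPolynomial.C c : MvPolynomial (Fin r) k) • DirectSum.lof k ℕ E n a := by
          rw [hsm, ← MvPolynomial.algebraMap_eq, AlgHom.commutes]; rfl
        rw [this]; exact Γ.smul_mem _ ha }
  obtain ⟨N, hN⟩ := GH hc hfg D (by
    intro i n x hx
    change DirectSum.lof k ℕ E (n + 2) (t i n x) ∈ Γ
    rw [← tauOp_lof, ← hρ, ← hsm]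
    exact Γ.smul_mem _ hx)
  have key : ∀ m n, N ≤ n → ∀ x ∈ D (n + 2 * m), DirectSum.lof k ℕ E _ x ∈ I ^ m • Γ := by
    intro m
    induction m with
    | zero =>
      intro n hn x hx
      rw [pow_zero, Ideal.one_eq_top, Submodule.top_smul]; exact hx
    | succ m ih =>
      intro n hn x hx
      obtain ⟨y, hy, rfl⟩ := hN (n + 2 * m) (by omega) x hx
      rw [map_sum]
      refine Submodule.sum_mem _ fun i _ => ?_
      have h1 : DirectSum.lof k ℕ E (n + 2 * m + 2) (t i (n + 2 * m) (y i)) ∈ I ^ (m + 1) • Γ := by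
        rw [← tauOp_lof, ← hρ, ← hsm, pow_succ', Submodule.mul_smul]
        exact Submodule.smul_mem_smul (Ideal.subset_span ⟨i, rfl⟩) (ih n hn _ (hy i))
      exact h1
  refine ⟨N + 2 * m, fun n hn x hx => ?_⟩
  obtain ⟨n', hn'⟩ : ∃ n', n = n' + 2 * m := ⟨n - 2 * m, by omega⟩
  subst hn'
  have hxD : x ∈ D (n' + 2 * m) := hfN _ hx
  have h3 := key m n' (by omega) x hxD
  have h4 : I ^ m • Γ = ⊥ := by
    rw [eq_bot_iff, Submodule.smul_le]
    intro s hs v hv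
    have h5 := Module.mem_annihilator.1 (hm hs) ⟨v, hv⟩
    exact congrArg Subtype.val h5
  rw [h4, Submodule.mem_bot] at h3
  have := congrArg (fun v : DirectSum ℕ E => v (n' + 2 * m)) h3
  simpa [DirectSum.lof_eq_of] using this

end graded2
end CX
end Part4

section Part5
open CategoryTheory Opposite Filter IsLocalRing ComplexityTest
namespace CX

section blocks
variable {B : Type*} [CommRing B] {J J' K K' L L' : Type*}

noncomputable def il (B : Type*) [CommRing B] (J J' : Type*) : (J →₀ B) →ₗ[B] (J ⊕ J' →₀ B) :=
  mkOp fun j => e B (Sum.inl j)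
noncomputable def ir (B : Type*) [CommRing B] (J J' : Type*) : (J' →₀ B) →ₗ[B] (J ⊕ J' →₀ B) :=
  mkOp fun j => e B (Sum.inr j)
noncomputable def pl (B : Type*) [CommRing B] (J J' : Type*) : (J ⊕ J' →₀ B) →ₗ[B] (J →₀ B) :=
  mkOp (Sum.elim (fun j => e B j) (fun _ => 0))
noncomputable def pR (B : Type*) [CommRing B] (J J' : Type*) : (J ⊕ J' →₀ B) →ₗ[B] (J' →₀ B) :=
  mkOp (Sum.elim (fun _ => 0) (fun j => e B j))

@[simp] theorem il_e (j : J) : il B J J' (e B j) = e B (Sum.inl j) := mkOp_e _ _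
@[simp] theorem ir_e (j : J') : ir B J J' (e B j) = e B (Sum.inr j) := mkOp_e _ _
@[simp] theorem pl_e_inl (j : J) : pl B J J' (e B (Sum.inl j)) = e B j := mkOp_e _ _
@[simp] theorem pl_e_inr (j : J') : pl B J J' (e B (Sum.inr j)) = 0 := mkOp_e _ _
@[simp] theorem pR_e_inl (j : J) : pR B J J' (e B (Sum.inl j)) = 0 := mkOp_e _ _
@[simp] theorem pR_e_inr (j : J') : pR B J J' (e B (Sum.inr j)) = e B j := mkOp_e _ _

@[simp] theorem pl_il (v) : pl B J J' (il B J J' v) = v := by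
  suffices h : pl B J J' ∘ₗ il B J J' = LinearMap.id from LinearMap.congr_fun h v
  apply op_ext; intro j; simp
@[simp] theorem pR_ir (v) : pR B J J' (ir B J J' v) = v := by
  suffices h : pR B J J' ∘ₗ ir B J J' = LinearMap.id from LinearMap.congr_fun h v
  apply op_ext; intro j; simp
@[simp] theorem pl_ir (v) : pl B J J' (ir B J J' v) = 0 := by
  suffices h : pl B J J' ∘ₗ ir B J J' = 0 from LinearMap.congr_fun h v
  apply op_ext; intro j; simp
@[simp] theorem pR_il (v) : pR B J J' (il B J J' v) = 0 := by
  suffices h : pR B J J' ∘ₗ il B J J' = 0 from LinearMap.congr_fun h v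
  apply op_ext; intro j; simp
theorem ilpl_add (v) : il B J J' (pl B J J' v) + ir B J J' (pR B J J' v) = v := by
  suffices h : il B J J' ∘ₗ pl B J J' + ir B J J' ∘ₗ pR B J J' = LinearMap.id from LinearMap.congr_fun h v
  apply op_ext; rintro (j | j) <;> simp
theorem blk_ext {v w : J ⊕ J' →₀ B} (h1 : pl B J J' v = pl B J J' w) (h2 : pR B J J' v = pR B J J' w) :
    v = w := by
  rw [← ilpl_add v, ← ilpl_add w, h1, h2]

theorem pl_apply (v : J ⊕ J' →₀ B) (j : J) : pl B J J' v j = v (Sum.inl j) := by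
  classical
  suffices h : Finsupp.lapply j ∘ₗ pl B J J' = Finsupp.lapply (Sum.inl j) from LinearMap.congr_fun h v
  apply op_ext; rintro (i | i)
  · by_cases h : i = j <;> simp [h]
  · simp
theorem pR_apply (v : J ⊕ J' →₀ B) (j : J') : pR B J J' v j = v (Sum.inr j) := by
  classical
  suffices h : Finsupp.lapply j ∘ₗ pR B J J' = Finsupp.lapply (Sum.inr j) from LinearMap.congr_fun h v
  apply op_ext; rintro (i | i)
  · simp
  · by_cases h : i = j <;> simp [h]

noncomputable def blk (a : (J →₀ B) →ₗ[B] (K →₀ B)) (b : (J' →₀ B) →ₗ[B] (K →₀ B))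
    (c : (J →₀ B) →ₗ[B] (K' →₀ B)) (d : (J' →₀ B) →ₗ[B] (K' →₀ B)) :
    (J ⊕ J' →₀ B) →ₗ[B] (K ⊕ K' →₀ B) :=
  il B K K' ∘ₗ (a ∘ₗ pl B J J' + b ∘ₗ pR B J J') + ir B K K' ∘ₗ (c ∘ₗ pl B J J' + d ∘ₗ pR B J J')

variable (a : (J →₀ B) →ₗ[B] (K →₀ B)) (b : (J' →₀ B) →ₗ[B] (K →₀ B))
    (c : (J →₀ B) →ₗ[B] (K' →₀ B)) (d : (J' →₀ B) →ₗ[B] (K' →₀ B))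

@[simp] theorem pl_blk (v) : pl B K K' (blk a b c d v) = a (pl B J J' v) + b (pR B J J' v) := by
  simp [blk]
@[simp] theorem pR_blk (v) : pR B K K' (blk a b c d v) = c (pl B J J' v) + d (pR B J J' v) := by
  simp [blk]
theorem blk_inl (j : J) : blk a b c d (e B (Sum.inl j)) = il B K K' (a (e B j)) + ir B K K' (c (e B j)) := by
  simp [blk]
theorem blk_inr (j : J') : blk a b c d (e B (Sum.inr j)) = il B K K' (b (e B j)) + ir B K K' (d (e B j)) := by
  simp [blk]

theorem isDeg_blk {da : J → ℕ} {da' : J' → ℕ} {dk : K → ℕ} {dk' : K' → ℕ} {p q : ℕ}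
    (ha : IsDeg da dk p q a) (hb : IsDeg da' dk p q b) (hc : IsDeg da dk' p q c) (hd : IsDeg da' dk' p q d) :
    IsDeg (Sum.elim da da') (Sum.elim dk dk') p q (blk a b c d) := by
  rintro (j | j) (l | l) hl
  · rw [← pl_apply, pl_blk] at hl
    exact ha j l (by simpa using hl)
  · rw [← pR_apply, pR_blk] at hl
    exact hc j l (by simpa using hl)
  · rw [← pl_apply, pl_blk] at hl
    exact hb j l (by simpa using hl)
  · rw [← pR_apply, pR_blk] at hl
    exact hd j l (by simpa using hl)

theorem bc_blk {C : Type*} [CommRing C] (f : B →+* C) :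
    bc f (blk a b c d) = blk (bc f a) (bc f b) (bc f c) (bc f d) := by
  apply op_ext
  rintro (j | j)
  · ext (l | l)
    · rw [bc_e, mr_apply, ← pl_apply, ← pl_apply, pl_blk, pl_blk]; simp
    · rw [bc_e, mr_apply, ← pR_apply, ← pR_apply, pR_blk, pR_blk]; simp
  · ext (l | l)
    · rw [bc_e, mr_apply, ← pl_apply, ← pl_apply, pl_blk, pl_blk]; simp
    · rw [bc_e, mr_apply, ← pR_apply, ← pR_apply, pR_blk, pR_blk]; simp

end blocks

section VIs
variable {Q : Type*} [CommRing Q] {J J' : Type*} (x : ℕ → Q)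

/-- the ideal generated by x_0, ..., x_{i-1} -/
def II (i : ℕ) : Ideal Q where
  carrier := {a | ∃ y : ℕ → Q, a = ∑ m ∈ Finset.range i, x m * y m}
  zero_mem' := ⟨0, by simp⟩
  add_mem' := by
    rintro _ _ ⟨y, rfl⟩ ⟨z, rfl⟩
    exact ⟨y + z, by simp [mul_add, Finset.sum_add_distrib]⟩
  smul_mem' := by
    rintro c _ ⟨y, rfl⟩
    exact ⟨fun m => c * y m, by simp only [smul_eq_mul, Finset.mul_sum]; congr 1; funext m; ring⟩

def VI (J : Type*) (i : ℕ) : Submodule Q (J →₀ Q) where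
  carrier := {v | ∀ l, v l ∈ II x i}
  zero_mem' := fun l => by simp
  add_mem' := fun ha hb l => (II x i).add_mem (ha l) (hb l)
  smul_mem' := fun c v hv l => (II x i).mul_mem_left c (hv l)

variable {x}

theorem mem_II_of_lt {i m : ℕ} (h : m < i) (a : Q) : x m * a ∈ II x i := by
  refine ⟨Pi.single m a, ?_⟩
  rw [Finset.sum_eq_single m]
  · simp
  · intro b _ hb; simp [hb]
  · simp; omega

theorem smul_mem_VI {i m : ℕ} (h : m < i) (v : J →₀ Q) : x m • v ∈ VI x J i :=
  fun l => mem_II_of_lt h (v l)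

theorem II_mono {i i' : ℕ} (h : i ≤ i') : II x i ≤ II x i' := by
  rintro _ ⟨y, rfl⟩
  exact Ideal.sum_mem _ fun m hm => mem_II_of_lt (by simp at hm; omega) _

theorem VI_mono {i i' : ℕ} (h : i ≤ i') {v : J →₀ Q} (hv : v ∈ VI x J i) : v ∈ VI x J i' :=
  fun l => II_mono h (hv l)

theorem sum_mem_VI {i : ℕ} (y : ℕ → J →₀ Q) : ∑ m ∈ Finset.range i, x m • y m ∈ VI x J i :=
  Submodule.sum_mem _ fun m hm => smul_mem_VI (by simpa using hm) _

theorem VI_exists {i : ℕ} {v : J →₀ Q} (hv : v ∈ VI x J i) :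
    ∃ y : ℕ → J →₀ Q, v = ∑ m ∈ Finset.range i, x m • y m ∧ ∀ m l, v l = 0 → y m l = 0 := by
  classical
  choose c hc using hv
  refine ⟨fun m => Finsupp.onFinset v.support (fun l => if v l = 0 then 0 else c l m) (by
    intro l hl
    simp at hl ⊢
    exact hl.1), ?_, ?_⟩
  · ext l
    rw [Finsupp.finsetSum_apply]
    simp only [Finsupp.smul_apply, Finsupp.onFinset_apply, smul_eq_mul]
    by_cases h : v l = 0
    · simp [h]
    · simp only [h, if_false]; exact hc l
  · intro m l hl
    simp [hl]

theorem OI_exists {i : ℕ} {φ : (J →₀ Q) →ₗ[Q] (J' →₀ Q)} (hφ : ∀ j, φ (e Q j) ∈ VI x J' i) :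
    ∃ h : ℕ → ((J →₀ Q) →ₗ[Q] (J' →₀ Q)), φ = ∑ m ∈ Finset.range i, x m • h m ∧
      ∀ (deg : J → ℕ) (deg' : J' → ℕ) p q, IsDeg deg deg' p q φ → ∀ m, IsDeg deg deg' p q (h m) := by
  choose y hy hy' using fun j => VI_exists (hφ j)
  refine ⟨fun m => mkOp fun j => y j m, op_ext fun j => ?_, ?_⟩
  · rw [hy j]; simp
  · intro deg deg' p q h m j l hl
    apply h j l
    intro h'
    apply hl
    rw [mkOp_e]
    exact hy' j m l h'

theorem VI_map {i : ℕ} (φ : (J →₀ Q) →ₗ[Q] (J' →₀ Q)) {v : J →₀ Q} (hv : v ∈ VI x J i) :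
    φ v ∈ VI x J' i := by
  obtain ⟨y, rfl, -⟩ := VI_exists hv
  rw [map_sum]
  simp only [map_smul]
  exact sum_mem_VI _

theorem VI_op {i : ℕ} {φ : (J →₀ Q) →ₗ[Q] (J' →₀ Q)} (hφ : ∀ j, φ (e Q j) ∈ VI x J' i) (v) :
    φ v ∈ VI x J' i := by
  rw [sum_e v, Finsupp.sum, map_sum]
  refine Submodule.sum_mem _ fun l _ => ?_
  rw [map_smul]; exact Submodule.smul_mem _ _ (hφ l)

/-- regularity of the sequence x_0, ..., x_{c-1} -/
def Reg (x : ℕ → Q) (c : ℕ) : Prop := ∀ i < c, ∀ a, x i * a ∈ II x i → a ∈ II x i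

theorem Reg.vec {c : ℕ} (hx : Reg x c) {i : ℕ} (hi : i < c) {v : J →₀ Q} (hv : x i • v ∈ VI x J i) :
    v ∈ VI x J i := fun l => hx i hi _ (hv l)

theorem Reg.kos_last {c : ℕ} (hx : Reg x c) {i : ℕ} (hi : i < c) {y : ℕ → J →₀ Q}
    (h : ∑ m ∈ Finset.range (i + 1), x m • y m = 0) : y i ∈ VI x J i := by
  apply hx.vec hi
  rw [Finset.sum_range_succ] at h
  rw [← neg_eq_of_add_eq_zero_right h]
  exact Submodule.neg_mem _ (sum_mem_VI _)

theorem Reg.kos {c : ℕ} (hx : Reg x c) {i : ℕ} (hi : i ≤ c) {y : ℕ → J →₀ Q}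
    (h : ∑ m ∈ Finset.range i, x m • y m = 0) : ∀ m < i, y m ∈ VI x J i := by
  induction i generalizing y with
  | zero => intro m hm; omega
  | succ i ih =>
    have h1 := hx.kos_last (by omega) h
    obtain ⟨z, hz, -⟩ := VI_exists h1
    have h2 : ∑ m ∈ Finset.range i, x m • (y m + x i • z m) = 0 := by
      rw [Finset.sum_range_succ, hz, Finset.smul_sum, ← Finset.sum_add_distrib] at h
      rw [← h]
      refine Finset.sum_congr rfl fun m _ => ?_
      rw [smul_add, smul_comm (x m)]
    intro m hm
    rcases Nat.lt_succ_iff_lt_or_eq.1 hm with h' | rfl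
    · have h3 := ih (by omega) h2 m h'
      have h4 : y m = (y m + x i • z m) - x i • z m := by abel
      rw [h4]
      exact Submodule.sub_mem _ (VI_mono (by omega) h3) (smul_mem_VI (by omega) _)
    · exact VI_mono (by omega) h1

theorem nat_lemma {c : ℕ} (hx : Reg x c) {i : ℕ} (hi : i ≤ c) {d : (J →₀ Q) →ₗ[Q] (J →₀ Q)}
    {t : ℕ → ((J →₀ Q) →ₗ[Q] (J →₀ Q))} (hdd : d ∘ₗ d = ∑ m ∈ Finset.range i, x m • t m)
    (W : (J →₀ Q) →ₗ[Q] (J →₀ Q)) (h : ℕ → ((J →₀ Q) →ₗ[Q] (J →₀ Q)))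
    (hW : d ∘ₗ W - W ∘ₗ d = ∑ m ∈ Finset.range i, x m • h m) (m : ℕ) (hm : m < i) (v : J →₀ Q) :
    t m (W v) - W (t m v) - (h m (d v) + d (h m v)) ∈ VI x J i := by
  refine hx.kos hi (y := fun m => t m (W v) - W (t m v) - (h m (d v) + d (h m v))) ?_ m hm
  have e1 : ∀ v, d (d v) = ∑ m ∈ Finset.range i, x m • t m v := fun v => by
    have := LinearMap.congr_fun hdd v
    simpa using this
  have e2 : ∀ v, d (W v) = W (d v) + ∑ m ∈ Finset.range i, x m • h m v := fun v => by
    have := LinearMap.congr_fun hW v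
    simp only [LinearMap.sub_apply, LinearMap.comp_apply, LinearMap.sum_apply, LinearMap.smul_apply] at this
    rw [← this]; abel
  have e3 : d (d (W v)) = W (d (d v)) + ∑ m ∈ Finset.range i, x m • h m (d v) +
      ∑ m ∈ Finset.range i, x m • d (h m v) := by
    rw [e2, map_add, e2, map_sum]; simp only [map_smul]
  rw [e1, e1, map_sum] at e3
  simp only [map_smul] at e3
  simp only [smul_sub, smul_add, Finset.sum_sub_distrib, Finset.sum_add_distrib]
  rw [e3]; abel

theorem bc_VI {k : Type*} [CommRing k] (ε : Q →+* k) {i : ℕ} (hε : ∀ m < i, ε (x m) = 0)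
    {φ : (J →₀ Q) →ₗ[Q] (J' →₀ Q)} (hφ : ∀ j, φ (e Q j) ∈ VI x J' i) : bc ε φ = 0 := by
  apply op_ext; intro j
  ext l
  obtain ⟨y, hy⟩ := hφ j l
  rw [bc_e, mr_apply, hy, map_sum]
  simp only [LinearMap.zero_apply, Finsupp.coe_zero, Pi.zero_apply]
  refine Finset.sum_eq_zero fun m hm => ?_
  rw [map_mul, hε m (by simpa using hm), zero_mul]

end VIs
end CX
end Part5

section Part6
open CategoryTheory Opposite Filter IsLocalRing ComplexityTest
namespace CX

section findim
variable {k : Type*} [Field k] {J : Type*} {deg : J → ℕ}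

theorem Ch_finite {n : ℕ} (hf : {j | deg j = n}.Finite) : Module.Finite k (Ch k deg k n) := by
  haveI : Finite {j // deg j = n} := hf
  let f : Ch k deg k n →ₗ[k] ({j // deg j = n} → k) :=
    { toFun := fun u j => u.1 (e k j.1)
      map_add' := fun _ _ => rfl
      map_smul' := fun _ _ => rfl }
  refine Module.Finite.of_injective f ?_
  intro u u' h
  apply Subtype.ext
  exact Ch_eq u.2 u'.2 fun j hj => congrFun h ⟨j, hj⟩

theorem finite_of_le_aux {k V : Type*} [Field k] [AddCommGroup V] [Module k V] {S T : Submodule k V}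
    (h : S ≤ T) (hT : Module.Finite k T) : Module.Finite k S :=
  Module.Finite.of_injective (Submodule.inclusion h) (Submodule.inclusion_injective _)

theorem Ch_finrank {n : ℕ} (hf : {j | deg j = n}.Finite) :
    Module.finrank k (Ch k deg k n) = {j | deg j = n}.ncard := by
  haveI : Finite {j // deg j = n} := hf
  haveI : Fintype {j // deg j = n} := Fintype.ofFinite _
  classical
  let f : Ch k deg k n ≃ₗ[k] ({j // deg j = n} → k) :=
    LinearEquiv.ofBijective
    { toFun := fun u j => u.1 (e k j.1)
      map_add' := fun _ _ => rfl
      map_smul' := fun _ _ => rfl }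
    ⟨fun u u' h => Subtype.ext (Ch_eq u.2 u'.2 fun j hj => congrFun h ⟨j, hj⟩),
     fun y => ⟨⟨mkOp fun j => if h : deg j = n then y ⟨j, h⟩ else 0, fun j hj => by
        rw [mkOp_e, dif_neg hj]⟩, by
        funext j
        simp only [LinearMap.coe_mk, AddHom.coe_mk]
        rw [mkOp_e, dif_pos j.2]⟩⟩
  rw [f.finrank_eq, Module.finrank_fintype_fun_eq_card, ← Nat.card_eq_fintype_card]
  rfl
end findim

section GHC

theorem GHabs {k V : Type*} [Field k] [AddCommGroup V] [Module k V] {r : ℕ} (Z : ℕ → Submodule k V)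
    (Bd : Submodule k V) (τ : Fin r → V →ₗ[k] V) [∀ n, Module.Finite k (Z n)]
    (hZT : ∀ j n, ∀ u ∈ Z n, τ j u ∈ Z (n + 2)) (hB : ∀ j, ∀ u ∈ Bd, τ j u ∈ Bd)
    (hTT : ∀ a b n, ∀ u ∈ Z n, τ a (τ b u) - τ b (τ a u) ∈ Bd)
    (hfg : ∃ N, ∀ n ≥ N, ∀ u ∈ Z (n + 2), ∃ v : Fin r → V, (∀ j, v j ∈ Z n) ∧ u - ∑ j, τ j (v j) ∈ Bd)
    (P : ℕ → Submodule k V) (hP : ∀ n, P n ≤ Z n) (hPT : ∀ n j, ∀ u ∈ P n, τ j u ∈ P (n + 2)) :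
    ∃ N, ∀ n ≥ N, ∀ u ∈ P (n + 2), ∃ v : Fin r → V, (∀ j, v j ∈ P n) ∧ u - ∑ j, τ j (v j) ∈ Bd := by
  let E : ℕ → Type _ := fun n => (Z n) ⧸ (Bd.comap (Z n).subtype)
  let rT : Fin r → ∀ n, Z n →ₗ[k] Z (n + 2) := fun j n => (τ j).restrict (hZT j n)
  have hrT : ∀ j n u, ((rT j n u : Z (n + 2)) : V) = τ j u.1 := fun j n u => rfl
  let t : Fin r → ∀ n, E n →ₗ[k] E (n + 2) := fun j n =>
    Submodule.mapQ _ _ (rT j n) (by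
      intro u hu
      exact hB j _ hu)
  have ht : ∀ j n u, t j n (Submodule.Quotient.mk u) = Submodule.Quotient.mk (rT j n u) :=
    fun j n u => Submodule.mapQ_apply _ _ _ _
  have hfin : ∀ n, Module.Finite k (E n) := fun n => Module.Finite.quotient _ _
  have hc : Comm t := by
    intro a b n y
    obtain ⟨u, rfl⟩ := Submodule.Quotient.mk_surjective _ y
    rw [ht, ht, ht, ht, Submodule.Quotient.eq, Submodule.mem_comap, Submodule.coe_subtype]
    exact hTT a b n u.1 u.2
  have hfg' : FGr t (fun _ => ⊤) := by
    obtain ⟨N, hN⟩ := hfg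
    refine ⟨N, fun n hn y _ => ?_⟩
    obtain ⟨u, rfl⟩ := Submodule.Quotient.mk_surjective _ y
    obtain ⟨v, hv, huv⟩ := hN n hn u.1 u.2
    refine ⟨fun j => Submodule.Quotient.mk ⟨v j, hv j⟩, fun _ => trivial, ?_⟩
    simp only [ht]
    rw [← Submodule.mkQ_apply]
    simp only [← Submodule.mkQ_apply]
    rw [← map_sum]
    simp only [Submodule.mkQ_apply]
    rw [Submodule.Quotient.eq, Submodule.mem_comap, Submodule.coe_subtype, AddSubgroupClass.coe_sub,
      AddSubmonoidClass.coe_finsetSum]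
    exact huv
  let S : ∀ n, Submodule k (E n) := fun n => ((P n).comap (Z n).subtype).map (Submodule.mkQ _)
  have hS := GH hc hfg' S (by
    rintro j n _ ⟨u, hu, rfl⟩
    rw [Submodule.mkQ_apply, ht]
    exact ⟨_, hPT n j _ hu, rfl⟩)
  obtain ⟨N, hN⟩ := hS
  refine ⟨N, fun n hn u hu => ?_⟩
  obtain ⟨y, hy, huy⟩ := hN n hn (Submodule.Quotient.mk ⟨u, hP _ hu⟩) ⟨_, hu, rfl⟩
  choose v hv hvy using hy
  have hvy' : ∀ i, t i n (y i) = Submodule.mkQ _ (rT i n (v i)) := fun i => by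
    rw [← hvy i, Submodule.mkQ_apply, ht]; rfl
  rw [Finset.sum_congr rfl (fun i _ => hvy' i)] at huy
  rw [← map_sum] at huy
  simp only [Submodule.mkQ_apply] at huy
  rw [Submodule.Quotient.eq, Submodule.mem_comap, Submodule.coe_subtype] at huy
  refine ⟨fun j => (v j).1, fun j => hv j, ?_⟩
  rw [AddSubgroupClass.coe_sub, AddSubmonoidClass.coe_finsetSum] at huy
  exact huy

variable {k : Type*} [Field k] {J : Type*} {deg : J → ℕ}

theorem GHC (hf : ∀ n, {j | deg j = n}.Finite) {D : (J →₀ k) →ₗ[k] (J →₀ k)}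
    (hD : IsDeg deg deg 0 1 D) {r : ℕ} (T : Fin r → ((J →₀ k) →ₗ[k] (J →₀ k)))
    (hT : ∀ j, IsDeg deg deg 0 2 (T j)) (hTD : ∀ j, D ∘ₗ T j = T j ∘ₗ D)
    (hTT : ∀ a b, ∃ h : (J →₀ k) →ₗ[k] (J →₀ k), T a ∘ₗ T b = T b ∘ₗ T a + (h ∘ₗ D + D ∘ₗ h))
    (hfg : ∃ N, ∀ n ≥ N, ∀ u ∈ Ch k deg k (n + 2), u ∘ₗ D = 0 →
      ∃ v : Fin r → ((J →₀ k) →ₗ[k] k), ∃ w : (J →₀ k) →ₗ[k] k,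
        (∀ j, v j ∈ Ch k deg k n ∧ v j ∘ₗ D = 0) ∧ u = ∑ j, v j ∘ₗ T j + w ∘ₗ D)
    (P : ℕ → Submodule k ((J →₀ k) →ₗ[k] k)) (hP : ∀ n, ∀ u ∈ P n, u ∈ Ch k deg k n ∧ u ∘ₗ D = 0)
    (hPT : ∀ n j, ∀ u ∈ P n, u ∘ₗ T j ∈ P (n + 2)) :
    ∃ N, ∀ n ≥ N, ∀ u ∈ P (n + 2), ∃ v : Fin r → ((J →₀ k) →ₗ[k] k), ∃ w ∈ Ch k deg k (n + 1),
      (∀ j, v j ∈ P n) ∧ u = ∑ j, v j ∘ₗ T j + w ∘ₗ D := by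
  let Z : ℕ → Submodule k ((J →₀ k) →ₗ[k] k) := fun n =>
    Ch k deg k n ⊓ LinearMap.ker (LinearMap.lcomp k k D)
  have hZ : ∀ {n u}, u ∈ Z n ↔ u ∈ Ch k deg k n ∧ u ∘ₗ D = 0 := fun {n u} => by
    simp only [Z, Submodule.mem_inf, LinearMap.mem_ker]; rfl
  let Bd : Submodule k ((J →₀ k) →ₗ[k] k) := LinearMap.range (LinearMap.lcomp k k D)
  have hBd : ∀ {u}, u ∈ Bd ↔ ∃ w : (J →₀ k) →ₗ[k] k, w ∘ₗ D = u := fun {u} => by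
    simp only [Bd, LinearMap.mem_range]; rfl
  have hZT : ∀ j n, ∀ u ∈ Z n, u ∘ₗ T j ∈ Z (n + 2) := by
    intro j n u hu
    rw [hZ] at hu ⊢
    refine ⟨(hT j).ch (by omega) hu.1, ?_⟩
    rw [LinearMap.comp_assoc, ← hTD, ← LinearMap.comp_assoc, hu.2]; simp
  have hfin : ∀ n, Module.Finite k (Z n) := by
    intro n
    haveI : Module.Finite k (Ch k deg k n) := Ch_finite (hf n)
    exact finite_of_le_aux (inf_le_left : Z n ≤ Ch k deg k n) this
  obtain ⟨N, hN⟩ := GHabs Z Bd (fun j => LinearMap.lcomp k k (T j)) hZT (by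
      intro j u hu
      rw [hBd] at hu ⊢
      obtain ⟨w, hw⟩ := hu
      refine ⟨w ∘ₗ T j, ?_⟩
      rw [LinearMap.comp_assoc, ← hTD, ← LinearMap.comp_assoc, hw]; rfl)
    (by
      intro a b n u hu
      rw [hBd]
      obtain ⟨h, hh⟩ := hTT b a
      refine ⟨u ∘ₗ h, ?_⟩
      apply LinearMap.ext; intro z
      have h1 := congrArg u (LinearMap.congr_fun hh z)
      have h2 : u (D (h z)) = 0 := LinearMap.congr_fun (hZ.1 hu).2 (h z)
      simp only [LinearMap.add_apply, LinearMap.comp_apply, map_add, h2, add_zero] at h1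
      change u (h (D z)) = u (T b (T a z)) - u (T a (T b z))
      rw [h1]; ring)
    (by
      obtain ⟨N, hN⟩ := hfg
      refine ⟨N, fun n hn u hu => ?_⟩
      obtain ⟨v, w, hv, huv⟩ := hN n hn u (hZ.1 hu).1 (hZ.1 hu).2
      refine ⟨v, fun j => hZ.2 (hv j), hBd.2 ⟨w, ?_⟩⟩
      rw [eq_sub_iff_add_eq, add_comm]
      exact huv.symm)
    P (fun n u hu => hZ.2 (hP n u hu)) hPT
  refine ⟨N, fun n hn u hu => ?_⟩
  obtain ⟨v, hv, huv⟩ := hN n hn u hu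
  obtain ⟨w, hw⟩ := hBd.1 huv
  have hw' : w ∘ₗ D ∈ Ch k deg k (n + 2) := by
    rw [hw]
    exact Submodule.sub_mem _ (hP _ u hu).1 (Submodule.sum_mem _ fun j _ => (hT j).ch (by omega) (hP _ _ (hv j)).1)
  refine ⟨v, w ∘ₗ pr k deg (n + 1), Ch_pr _ _, hv, ?_⟩
  have hw2 : w ∘ₗ pr k deg (n + 1) ∘ₗ D = (w ∘ₗ D) ∘ₗ pr k deg (n + 2) := by
    apply LinearMap.ext; intro z
    simp only [LinearMap.comp_apply]
    rw [hD.pr_comm (n := n + 2) (m := n + 1) (by omega)]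
  rw [LinearMap.comp_assoc, hw2, Ch_pr_eq hw', hw]
  exact (add_sub_cancel _ _).symm

end GHC
end CX
end Part6

section Part7
open CategoryTheory Opposite Filter IsLocalRing ComplexityTest
namespace CX

section lev
variable {Q : Type*} [CommRing Q] {X : Type*} [AddCommGroup X] [Module Q X]

structure Lev {J : Type*} (x : ℕ → Q) (i : ℕ) (deg : J → ℕ) (d : (J →₀ Q) →ₗ[Q] (J →₀ Q))
    (t : ℕ → ((J →₀ Q) →ₗ[Q] (J →₀ Q))) (aug : (J →₀ Q) →ₗ[Q] X) : Prop where
  fin : ∀ n, {j | deg j = n}.Finite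
  hd : IsDeg deg deg 0 1 d
  ht : ∀ j, IsDeg deg deg 0 2 (t j)
  hdd : d ∘ₗ d = ∑ m ∈ Finset.range i, x m • t m
  haug : aug ∈ Ch Q deg X 0
  augd : aug ∘ₗ d = 0
  surj : Function.Surjective aug
  exact : ∀ a, d a ∈ VI x J i → aug a = 0 → ∃ a', a - d a' ∈ VI x J i

variable {J : Type*} {x : ℕ → Q} {i c : ℕ} {deg : J → ℕ} {d : (J →₀ Q) →ₗ[Q] (J →₀ Q)}
    {t : ℕ → ((J →₀ Q) →ₗ[Q] (J →₀ Q))} {aug : (J →₀ Q) →ₗ[Q] X}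

theorem td_VI (hx : Reg x c) (hi : i ≤ c) (hdd : d ∘ₗ d = ∑ m ∈ Finset.range i, x m • t m)
    {m : ℕ} (hm : m < i) (v) :
    d (t m v) - t m (d v) ∈ VI x J i := by
  have := nat_lemma hx hi hdd d (fun _ => 0) (by
    apply LinearMap.ext; intro z; simp) m hm v
  rw [← neg_sub]
  apply Submodule.neg_mem
  simpa using this

theorem tt_VI (hx : Reg x c) (hi : i ≤ c) (hdd : d ∘ₗ d = ∑ m ∈ Finset.range i, x m • t m)
    {m l : ℕ} (hm : m < i) (hl : l < i) :
    ∃ h : (J →₀ Q) →ₗ[Q] (J →₀ Q), (∀ (deg : J → ℕ), IsDeg deg deg 0 1 d → IsDeg deg deg 0 2 (t l) →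
      IsDeg deg deg 0 3 h) ∧ ∀ v, t m (t l v) - t l (t m v) - (h (d v) + d (h v)) ∈ VI x J i := by
  obtain ⟨h, hh, hh'⟩ := OI_exists (φ := d ∘ₗ t l - t l ∘ₗ d) (x := x) (i := i)
    (fun j => td_VI hx hi hdd hl _)
  refine ⟨h m, fun deg h1 h2 => hh' _ _ _ _ ?_ m, nat_lemma hx hi hdd (t l) h hh m hm⟩
  exact ((h1.comp h2).cast (by omega)).sub ((h2.comp h1).cast (by omega))

theorem td_bar (hx : Reg x c) (hi : i ≤ c) (hdd : d ∘ₗ d = ∑ m ∈ Finset.range i, x m • t m)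
    {k : Type*} [CommRing k] (ε : Q →+* k) (hε : ∀ m < i, ε (x m) = 0) {m : ℕ} (hm : m < i) :
    bc ε d ∘ₗ bc ε (t m) = bc ε (t m) ∘ₗ bc ε d := by
  have := bc_VI ε hε (φ := d ∘ₗ t m - t m ∘ₗ d) (x := x) (i := i) (fun j => td_VI hx hi hdd hm _)
  rw [bc_sub, bc_comp, bc_comp] at this
  exact sub_eq_zero.1 this

theorem tt_bar (hx : Reg x c) (hi : i ≤ c) (hdd : d ∘ₗ d = ∑ m ∈ Finset.range i, x m • t m)
    {k : Type*} [CommRing k] (ε : Q →+* k) (hε : ∀ m < i, ε (x m) = 0) {m l : ℕ} (hm : m < i) (hl : l < i) :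
    ∃ h : (J →₀ k) →ₗ[k] (J →₀ k), (∀ (deg : J → ℕ), IsDeg deg deg 0 1 d → IsDeg deg deg 0 2 (t l) →
      IsDeg deg deg 0 3 h) ∧
      bc ε (t m) ∘ₗ bc ε (t l) = bc ε (t l) ∘ₗ bc ε (t m) + (h ∘ₗ bc ε d + bc ε d ∘ₗ h) := by
  obtain ⟨h, hh, hv⟩ := tt_VI hx hi hdd hm hl
  refine ⟨bc ε h, fun deg h1 h2 => bc_isDeg ε (hh deg h1 h2), ?_⟩
  have := bc_VI ε hε (φ := t m ∘ₗ t l - t l ∘ₗ t m - (h ∘ₗ d + d ∘ₗ h)) (x := x) (i := i) (fun j => hv _)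
  rw [bc_sub, bc_sub, bc_add, bc_comp, bc_comp, bc_comp, bc_comp] at this
  apply LinearMap.ext; intro z
  have h3 := LinearMap.congr_fun this z
  rw [LinearMap.sub_apply, LinearMap.sub_apply, LinearMap.zero_apply, sub_sub] at h3
  exact sub_eq_zero.1 h3

theorem dd_bar (hdd : d ∘ₗ d = ∑ m ∈ Finset.range i, x m • t m)
    {k : Type*} [CommRing k] (ε : Q →+* k) (hε : ∀ m < i, ε (x m) = 0) :
    bc ε d ∘ₗ bc ε d = 0 := by
  rw [← bc_comp, hdd, bc_sum]
  refine Finset.sum_eq_zero fun m hm => ?_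
  rw [bc_smul, hε m (by simpa using hm), zero_smul]

/-- one step down -/
theorem Lev.step (hx : Reg x c) (hX : ∀ m < c, ∀ y : X, x m • y = 0) (hi : i < c)
    (h : Lev x (i + 1) deg d t aug) :
    ∃ hh : ℕ → ((J →₀ Q) →ₗ[Q] (J →₀ Q)),
    Lev x i (Sum.elim deg (fun j => deg j + 1)) (blk d (x i • LinearMap.id) (-t i) (-d))
      (fun j => blk (t j) 0 (hh j) (t j)) (aug ∘ₗ pl Q J J) := by
  have hdd : ∀ v, d (d v) = ∑ m ∈ Finset.range i, x m • t m v + x i • t i v := fun v => by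
    have := LinearMap.congr_fun h.hdd v
    rw [Finset.sum_range_succ] at this
    simpa using this
  have hk : ∀ v, d (t i v) - t i (d v) ∈ VI x J i := by
    intro v
    apply hx.kos_last hi (y := fun m => d (t m v) - t m (d v))
    have h1 := congrArg d (hdd v)
    rw [hdd (d v), map_add, map_sum] at h1
    simp only [map_smul] at h1
    rw [Finset.sum_range_succ]
    simp only [smul_sub, Finset.sum_sub_distrib]
    rw [sub_add_sub_comm, ← h1, sub_self]
  obtain ⟨hh, hh1, hh2⟩ := OI_exists (φ := d ∘ₗ t i - t i ∘ₗ d) (fun j => hk _)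
  have hh3 : ∀ m, IsDeg deg deg 0 3 (hh m) := hh2 deg deg 0 3
    (((h.hd.comp (h.ht i)).cast (by omega)).sub (((h.ht i).comp h.hd).cast (by omega)))
  have hh4 : ∀ v, d (t i v) - t i (d v) = ∑ m ∈ Finset.range i, x m • hh m v := fun v => by
    have := LinearMap.congr_fun hh1 v
    simpa using this
  have hD : IsDeg (Sum.elim deg (fun j => deg j + 1)) (Sum.elim deg (fun j => deg j + 1)) 0 1
      (blk d (x i • LinearMap.id) (-t i) (-d)) := by
    apply isDeg_blk
    · exact h.hd
    · intro j l hl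
      have := (IsDeg.id (B := Q) (deg := deg)).smul (x i) j l hl
      dsimp only
      omega
    · intro j l hl
      have := (h.ht i).neg j l hl
      dsimp only
      omega
    · intro j l hl
      have := h.hd.neg j l hl
      dsimp only
      omega
  have hDD : blk d (x i • LinearMap.id) (-t i) (-d) ∘ₗ blk d (x i • LinearMap.id) (-t i) (-d) =
      ∑ m ∈ Finset.range i, x m • blk (t m) 0 (hh m) (t m) := by
    apply LinearMap.ext
    intro v
    apply blk_ext
    · simp only [LinearMap.comp_apply, pl_blk, pR_blk, LinearMap.sum_apply, map_sum, map_add,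
        LinearMap.smul_apply, LinearMap.id_apply, LinearMap.neg_apply, map_smul, LinearMap.zero_apply]
      rw [hdd]
      simp only [add_zero, smul_add, smul_neg]
      abel
    · simp only [LinearMap.comp_apply, pl_blk, pR_blk, LinearMap.sum_apply, map_sum, map_add,
        LinearMap.smul_apply, LinearMap.id_apply, LinearMap.neg_apply, map_smul, LinearMap.zero_apply,
        map_neg]
      rw [hdd]
      simp only [smul_add, Finset.sum_add_distrib, smul_neg, neg_add_rev, neg_neg]
      rw [← hh4]
      abel
  refine ⟨hh, ⟨?_, hD, ?_, hDD, ?_, ?_, ?_, ?_⟩⟩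
  · intro n
    have : {j | Sum.elim deg (fun j => deg j + 1) j = n} ⊆
        Sum.inl '' {j | deg j = n} ∪ Sum.inr '' {j | deg j = n - 1} := by
      rintro (j | j) hj
      · left; exact ⟨j, hj, rfl⟩
      · right; refine ⟨j, ?_, rfl⟩
        have : deg j + 1 = n := hj
        change deg j = n - 1
        omega
    exact (((h.fin n).image _).union ((h.fin (n - 1)).image _)).subset this
  · intro m
    apply isDeg_blk
    · exact h.ht m
    · exact IsDeg.zero
    · intro j l hl
      have := hh3 m j l hl
      dsimp only
      omega
    · intro j l hl
      have := h.ht m j l hl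
      dsimp only
      omega
  · rintro (j | j) hj
    · rw [LinearMap.comp_apply, pl_e_inl]
      exact h.haug j hj
    · rw [LinearMap.comp_apply, pl_e_inr, map_zero]
  · apply LinearMap.ext; intro v
    simp only [LinearMap.comp_apply, pl_blk, map_add, LinearMap.smul_apply, LinearMap.id_apply, map_smul]
    rw [hX i hi, add_zero]
    exact LinearMap.congr_fun h.augd _
  · intro y
    obtain ⟨a, ha⟩ := h.surj y
    exact ⟨il Q J J a, by simpa using ha⟩
  · intro v hv hav
    have hvl : ∀ w : J ⊕ J →₀ Q, w ∈ VI x (J ⊕ J) i ↔ pl Q J J w ∈ VI x J i ∧ pR Q J J w ∈ VI x J i := by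
      intro w
      constructor
      · intro hw; exact ⟨VI_map _ hw, VI_map _ hw⟩
      · rintro ⟨h1, h2⟩ (l | l)
        · rw [← pl_apply]; exact h1 l
        · rw [← pR_apply]; exact h2 l
    have hv1 := ((hvl _).1 hv).1
    rw [pl_blk] at hv1
    obtain ⟨a', ha'⟩ := h.exact (pl Q J J v) (by
      have h2 := Submodule.sub_mem _ (VI_mono (Nat.le_succ i) hv1)
        (smul_mem_VI (x := x) (Nat.lt_succ_self i) (pR Q J J v))
      simpa using h2) hav
    obtain ⟨y, hy, -⟩ := VI_exists ha'
    rw [Finset.sum_range_succ] at hy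
    let v' := il Q J J a' + ir Q J J (y i)
    set D := blk d (x i • LinearMap.id) (-t i) (-d) with hDdef
    have h1 : pl Q J J (v - D v') ∈ VI x J i := by
      simp only [v', hDdef, map_sub, pl_blk, map_add, pl_il, pl_ir, pR_il, pR_ir, LinearMap.smul_apply,
        LinearMap.id_apply, map_zero, add_zero, zero_add, smul_zero]
      rw [← sub_sub, hy, add_sub_cancel_right]
      exact sum_mem_VI _
    have h2 : D (v - D v') ∈ VI x (J ⊕ J) i := by
      rw [map_sub]
      refine Submodule.sub_mem _ hv ?_
      rw [← LinearMap.comp_apply, hDD, LinearMap.sum_apply]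
      exact sum_mem_VI (x := x) (fun m => blk (t m) 0 (hh m) (t m) v')
    refine ⟨v', (hvl _).2 ⟨h1, ?_⟩⟩
    have h3 := ((hvl _).1 h2).1
    rw [hDdef, pl_blk] at h3
    apply hx.vec hi
    have h4 := Submodule.sub_mem _ h3 (VI_map d h1)
    rw [← hDdef, add_sub_cancel_left] at h4
    exact h4

end lev

section fgl
variable {Q : Type*} [CommRing Q] {X : Type*} [AddCommGroup X] [Module Q X] {x : ℕ → Q} {c : ℕ}
  {k : Type*} [Field k] (ε : Q →+* k)

theorem FGL (hx : Reg x c) (hX : ∀ m < c, ∀ y : X, x m • y = 0) (hε : ∀ m < c, ε (x m) = 0)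
    {J' : Type*} {deg' : J' → ℕ} {d' : (J' →₀ Q) →ₗ[Q] (J' →₀ Q)} {aug' : (J' →₀ Q) →ₗ[Q] X}
    (hF : IsRes deg' d' aug') {ℓ : ℕ} (hℓ : ∀ j, deg' j ≤ ℓ) (i : ℕ) (hi : i ≤ c) :
    ∀ {J : Type*} {deg : J → ℕ} {d : (J →₀ Q) →ₗ[Q] (J →₀ Q)}
    {t : ℕ → ((J →₀ Q) →ₗ[Q] (J →₀ Q))} {aug : (J →₀ Q) →ₗ[Q] X}, Lev x i deg d t aug →
    ∃ N, ∀ n ≥ N, ∀ u ∈ Ch k deg k (n + 2), u ∘ₗ bc ε d = 0 →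
      ∃ v : ℕ → ((J →₀ k) →ₗ[k] k), ∃ w ∈ Ch k deg k (n + 1),
        (∀ j < i, v j ∈ Ch k deg k n ∧ v j ∘ₗ bc ε d = 0) ∧
        u = ∑ j ∈ Finset.range i, v j ∘ₗ bc ε (t j) + w ∘ₗ bc ε d := by
  induction i with
  | zero =>
    intro J deg d t aug h
    have hdd : d ∘ₗ d = 0 := by simpa using h.hdd
    have hV : ∀ v : J →₀ Q, v ∈ VI x J 0 → v = 0 := by
      intro v hv; ext l
      obtain ⟨y, hy⟩ := hv l
      simpa using hy
    have hC : IsRes deg d aug := ⟨h.fin, h.hd, h.haug, hdd, h.augd, h.surj, fun a ha haa => by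
      obtain ⟨a', ha'⟩ := h.exact a (by rw [ha]; exact Submodule.zero_mem _) haa
      exact ⟨a', (sub_eq_zero.1 (hV _ ha')).symm⟩⟩
    obtain ⟨φ, hφ, hφd, hφa⟩ := hC.lift hF LinearMap.id
    obtain ⟨ψ, hψ, hψd, hψa⟩ := hF.lift hC LinearMap.id
    obtain ⟨s, hs, hs'⟩ := hC.homotopy hC (ψ ∘ₗ φ - LinearMap.id)
      (((hψ.comp hφ).cast (by omega)).sub IsDeg.id) (by
        rw [LinearMap.comp_sub, LinearMap.sub_comp, ← LinearMap.comp_assoc, hψd, LinearMap.comp_assoc, hφd]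
        rfl) (by
        rw [LinearMap.comp_sub, ← LinearMap.comp_assoc, hψa]
        rw [LinearMap.id_comp, hφa]
        simp)
    refine ⟨ℓ, fun n hn u hu hud => ⟨0, -(u ∘ₗ bc ε s), ?_, fun j hj => by omega, ?_⟩⟩
    · exact Submodule.neg_mem _ ((bc_isDeg ε hs).ch (by omega) hu)
    · have h1 := congrArg (bc ε) hs'
      rw [bc_sub, bc_add, bc_comp, bc_comp, bc_comp, bc_id] at h1
      have h2 : u ∘ₗ bc ε ψ = 0 := by
        apply op_ext; intro j
        have := (bc_isDeg ε hψ).ch (n := n + 2) (by omega) hu j (by have := hℓ j; omega)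
        exact this
      apply LinearMap.ext; intro z
      have h3 := congrArg u (LinearMap.congr_fun h1 z)
      have h4 := LinearMap.congr_fun h2 (bc ε φ z)
      have h5 := LinearMap.congr_fun hud (bc ε s z)
      simp only [LinearMap.sub_apply, LinearMap.add_apply, LinearMap.comp_apply, map_sub, map_add,
        LinearMap.id_apply, LinearMap.zero_apply] at h3 h4 h5
      rw [h4, h5] at h3
      simp only [Finset.range_zero, Finset.sum_empty, zero_add, LinearMap.neg_comp, LinearMap.neg_apply,
        LinearMap.comp_apply] at h3 ⊢
      rw [← h3]; simp
  | succ i ih =>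
    intro J deg d t aug h
    obtain ⟨hh, hC⟩ := h.step hx hX (by omega)
    have hD : bc ε (blk d (x i • LinearMap.id) (-t i) (-d)) =
        blk (bc ε d) 0 (-bc ε (t i)) (-bc ε d) := by
      rw [bc_blk, bc_smul, hε i (by omega), zero_smul, bc_neg, bc_neg]
    have hT : ∀ j, bc ε (blk (t j) 0 (hh j) (t j)) =
        blk (bc ε (t j)) 0 (bc ε (hh j)) (bc ε (t j)) := by
      intro j; rw [bc_blk, bc_zero]
    have hε' : ∀ m < i, ε (x m) = 0 := fun m hm => hε m (by omega)
    have hFG := ih (by omega) hC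
    set D := blk d (x i • LinearMap.id) (-t i) (-d) with hDdef
    set T : ℕ → ((J ⊕ J →₀ Q) →ₗ[Q] (J ⊕ J →₀ Q)) := fun j => blk (t j) 0 (hh j) (t j) with hTdef
    have hplD : pl k J J ∘ₗ bc ε D = bc ε d ∘ₗ pl k J J := by
      apply LinearMap.ext; intro z
      rw [hD]; simp
    have hplT : ∀ j, pl k J J ∘ₗ bc ε (T j) = bc ε (t j) ∘ₗ pl k J J := by
      intro j
      apply LinearMap.ext; intro z
      rw [hTdef]; simp only []; rw [hT]; simp
    let deg2 : J ⊕ J → ℕ := Sum.elim deg (fun j => deg j + 1)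
    have hplCh : ∀ n, ∀ u ∈ Ch k deg k n, u ∘ₗ pl k J J ∈ Ch k deg2 k n := by
      rintro n u hu (j | j) hj
      · rw [LinearMap.comp_apply, pl_e_inl]; exact hu j hj
      · simp
    let P : ℕ → Submodule k ((J ⊕ J →₀ k) →ₗ[k] k) := fun n =>
      (Ch k deg k n ⊓ LinearMap.ker (LinearMap.lcomp k k (bc ε d))).map (LinearMap.lcomp k k (pl k J J))
    have hP : ∀ {n u}, u ∈ P n ↔ ∃ v, (v ∈ Ch k deg k n ∧ v ∘ₗ bc ε d = 0) ∧ v ∘ₗ pl k J J = u := fun {n u} => by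
      simp only [P, Submodule.mem_map, Submodule.mem_inf, LinearMap.mem_ker]; rfl
    obtain ⟨N, hN⟩ := GHC (k := k) hC.fin (bc_isDeg ε hC.hd) (fun j : Fin i => bc ε (T j))
      (fun j => bc_isDeg ε (hC.ht j)) (fun j => td_bar hx (by omega) hC.hdd ε hε' j.2)
      (fun a b => by
        obtain ⟨h, -, h2⟩ := tt_bar hx (by omega) hC.hdd ε hε' a.2 b.2
        exact ⟨h, h2⟩)
      (by
        obtain ⟨N, hN⟩ := hFG
        refine ⟨N, fun n hn u hu hud => ?_⟩
        obtain ⟨v, w, hw, hv, huv⟩ := hN n hn u hu hud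
        refine ⟨fun j => v j, w, fun j => hv j j.2, ?_⟩
        rw [huv, Finset.sum_range])
      P (by
        intro n u hu
        obtain ⟨v, ⟨hv1, hv2⟩, rfl⟩ := hP.1 hu
        refine ⟨hplCh n v hv1, ?_⟩
        rw [LinearMap.comp_assoc, hplD, ← LinearMap.comp_assoc, hv2, LinearMap.zero_comp])
      (by
        intro n j u hu
        obtain ⟨v, ⟨hv1, hv2⟩, rfl⟩ := hP.1 hu
        refine hP.2 ⟨v ∘ₗ bc ε (t j), ⟨(bc_isDeg ε (h.ht j)).ch (by omega) hv1, ?_⟩, ?_⟩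
        · have hcm := td_bar hx (by omega) h.hdd ε (fun m hm => hε m (by omega)) (m := j) (by omega)
          rw [LinearMap.comp_assoc, ← hcm, ← LinearMap.comp_assoc, hv2, LinearMap.zero_comp]
        · rw [LinearMap.comp_assoc, LinearMap.comp_assoc, hplT])
    refine ⟨N, fun n hn u hu hud => ?_⟩
    obtain ⟨v, w, hw, hv, huv⟩ := hN n hn (u ∘ₗ pl k J J) (hP.2 ⟨u, ⟨hu, hud⟩, rfl⟩)
    choose v' hv' hvv' using fun j => hP.1 (hv j)
    let V : ℕ → ((J →₀ k) →ₗ[k] k) := fun j => if hj : j < i then v' ⟨j, hj⟩ else -(w ∘ₗ ir k J J)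
    have hV1 : ∀ j (hj : j < i), V j = v' ⟨j, hj⟩ := fun j hj => by simp [V, hj]
    have hV2 : V i = -(w ∘ₗ ir k J J) := by simp [V]
    have hval : ∀ z, u (pl k J J z) = ∑ j : Fin i, v' j (bc ε (t j) (pl k J J z)) + w (bc ε D z) := by
      intro z
      have := LinearMap.congr_fun huv z
      simp only [LinearMap.comp_apply, LinearMap.add_apply, LinearMap.sum_apply] at this
      rw [this]
      congr 1
      refine Finset.sum_congr rfl fun j _ => ?_
      rw [← hvv' j, LinearMap.comp_apply, ← LinearMap.comp_apply (pl k J J), hplT]; rfl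
    refine ⟨V, w ∘ₗ il k J J, ?_, ?_, ?_⟩
    · intro j hj
      rw [LinearMap.comp_apply, il_e]
      exact hw (Sum.inl j) hj
    · intro j hj
      rcases Nat.lt_succ_iff_lt_or_eq.1 hj with hj | rfl
      · rw [hV1 j hj]; exact hv' _
      · rw [hV2]
        refine ⟨Submodule.neg_mem _ ?_, ?_⟩
        · intro l hl
          rw [LinearMap.comp_apply, ir_e]
          refine hw (Sum.inr l) ?_
          change deg l + 1 ≠ n + 1
          omega
        · apply LinearMap.ext; intro z
          have := hval (ir k J J z)
          rw [hD] at this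
          simp only [pl_ir, map_zero, Finset.sum_const_zero, zero_add] at this
          simp only [LinearMap.neg_comp, LinearMap.neg_apply, LinearMap.comp_apply, LinearMap.zero_apply]
          rw [eq_comm, this, ← map_neg]
          congr 1
          apply blk_ext <;> simp
    · apply LinearMap.ext; intro z
      have := hval (il k J J z)
      rw [hD, pl_il] at this
      rw [this, Finset.sum_range_succ, Finset.sum_range, hV2]
      simp only [LinearMap.add_apply, LinearMap.sum_apply, LinearMap.comp_apply, LinearMap.neg_comp,
        LinearMap.neg_apply]
      have hs : ∑ j : Fin i, V j (bc ε (t j) z) = ∑ j : Fin i, v' j (bc ε (t j) z) :=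
        Finset.sum_congr rfl (fun (j : Fin i) _ => by rw [hV1 j j.2])
      rw [hs, add_assoc]
      congr 1
      rw [← map_neg, ← map_add]
      congr 1
      apply blk_ext <;> simp

end fgl
end CX
end Part7

section Part8
open CategoryTheory Opposite Filter IsLocalRing ComplexityTest
namespace CX

section eis
variable {Q R : Type*} [CommRing Q] [CommRing R] (g : Q →+* R) {x : ℕ → Q} {c : ℕ} {J : Type*}

theorem mr_surj (hg : Function.Surjective g) (v : J →₀ R) : ∃ w : J →₀ Q, mr g w = v := by
  induction v using Finsupp.induction_linear with
  | zero => exact ⟨0, map_zero _⟩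
  | add a b ha hb =>
    obtain ⟨a, rfl⟩ := ha
    obtain ⟨b, rfl⟩ := hb
    exact ⟨a + b, map_add _ _ _⟩
  | single j r =>
    obtain ⟨q, rfl⟩ := hg r
    refine ⟨q • e Q j, ?_⟩
    rw [mr_smul, mr_e]; simp

theorem VI_of_bc {J' : Type*} (hker : ∀ a, g a = 0 → a ∈ II x c) {φ : (J →₀ Q) →ₗ[Q] (J' →₀ Q)}
    (h : bc g φ = 0) (j) : φ (e Q j) ∈ VI x J' c := by
  intro l
  apply hker
  have := DFunLike.congr_fun (LinearMap.congr_fun h (e R j)) l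
  rw [bc_e, mr_apply] at this
  simpa using this

theorem eisenbud {X : Type*} [AddCommGroup X] [Module Q X] [Module R X] (hgX : ∀ (q : Q) (y : X), q • y = g q • y)
    (hg : Function.Surjective g) (hx : Reg x c) (hker : ∀ a, g a = 0 ↔ a ∈ II x c)
    {deg : J → ℕ} {d' : (J →₀ R) →ₗ[R] (J →₀ R)} {aug' : (J →₀ R) →ₗ[R] X} (hR : IsRes deg d' aug')
    {J₁ : Type*} {deg₁ : J₁ → ℕ} {d₁ : (J₁ →₀ Q) →ₗ[Q] (J₁ →₀ Q)} {aug₁ : (J₁ →₀ Q) →ₗ[Q] X}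
    (hF : IsRes deg₁ d₁ aug₁) {ℓ : ℕ} (hℓ : ∀ j, deg₁ j ≤ ℓ) {k : Type*} [Field k] (ε : R →+* k)
    (hεd : bc ε d' = 0) :
    ∃ T : ℕ → ((J →₀ R) →ₗ[R] (J →₀ R)), (∀ j, IsDeg deg deg 0 2 (T j)) ∧
      (∀ j < c, d' ∘ₗ T j = T j ∘ₗ d') ∧
      (∀ j < c, ∀ W : (J →₀ R) →ₗ[R] (J →₀ R), IsDeg deg deg 0 2 W → d' ∘ₗ W = W ∘ₗ d' →
        ∃ h : (J →₀ R) →ₗ[R] (J →₀ R), IsDeg deg deg 0 3 h ∧ T j ∘ₗ W = W ∘ₗ T j + (h ∘ₗ d' + d' ∘ₗ h)) ∧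
      ∃ N, ∀ n ≥ N, ∀ u ∈ Ch k deg k (n + 2), ∃ v : ℕ → ((J →₀ k) →ₗ[k] k),
        (∀ j < c, v j ∈ Ch k deg k n) ∧ u = ∑ j ∈ Finset.range c, v j ∘ₗ bc ε (T j) := by
  have hgx : ∀ m < c, g (x m) = 0 := fun m hm => (hker _).2 (by
    have := mem_II_of_lt (x := x) hm 1
    rwa [mul_one] at this)
  obtain ⟨d, rfl, hdeg⟩ := bc_lift g hg d'
  have hd := hdeg _ _ _ _ hR.hd
  obtain ⟨t, ht, ht'⟩ := OI_exists (φ := d ∘ₗ d) (x := x) (i := c)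
    (VI_of_bc g (fun a => (hker a).1) (by rw [bc_comp]; exact hR.dd))
  have htd : ∀ j, IsDeg deg deg 0 2 (t j) := ht' _ _ _ _ (hd.comp hd)
  have haug : ∀ v, mkOp (fun j => aug' (e R j)) v = aug' (mr g v) := by
    intro v
    induction v using Finsupp.induction_linear with
    | zero => simp
    | add a b ha hb => rw [map_add, map_add, map_add, ha, hb]
    | single j r =>
      have : Finsupp.single j r = r • e Q j := by simp
      rw [this, map_smul, mkOp_e, mr_smul, map_smul, mr_e, hgX]
  have hL : Lev x c deg d t (mkOp fun j => aug' (e R j)) := by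
    refine ⟨hR.fin, hd, htd, ht, ?_, ?_, ?_, ?_⟩
    · intro j hj
      rw [mkOp_e]; exact hR.haug j hj
    · apply LinearMap.ext; intro v
      rw [LinearMap.comp_apply, haug, ← bc_mr]
      exact LinearMap.congr_fun hR.augd _
    · intro y
      obtain ⟨b, hb⟩ := hR.surj y
      obtain ⟨a, rfl⟩ := mr_surj g hg b
      exact ⟨a, by rw [haug, hb]⟩
    · intro a ha haa
      obtain ⟨b, hb⟩ := hR.exact (mr g a) (by
        rw [bc_mr]
        ext l
        rw [mr_apply]
        exact (hker _).2 (ha l)) (by rw [← haug, haa])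
      obtain ⟨a', rfl⟩ := mr_surj g hg b
      refine ⟨a', fun l => (hker _).1 ?_⟩
      rw [bc_mr] at hb
      have := DFunLike.congr_fun hb l
      simp only [mr_apply] at this
      simp [this]
  refine ⟨fun j => bc g (t j), fun j => bc_isDeg g (htd j), fun j hj => td_bar hx le_rfl ht g hgx hj, ?_, ?_⟩
  · intro j hj W hW hWd
    obtain ⟨W, rfl, hWdeg⟩ := bc_lift g hg W
    obtain ⟨h, hh, hh'⟩ := OI_exists (φ := d ∘ₗ W - W ∘ₗ d) (x := x) (i := c)
      (VI_of_bc g (fun a => (hker a).1) (by rw [bc_sub, bc_comp, bc_comp, hWd]; apply LinearMap.ext; intro z; simp))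
    have hW' := hWdeg _ _ _ _ hW
    refine ⟨bc g (h j), bc_isDeg g (hh' _ _ _ _
      (((hd.comp hW').cast (by omega)).sub ((hW'.comp hd).cast (by omega))) j), ?_⟩
    have := bc_VI g hgx (φ := t j ∘ₗ W - W ∘ₗ t j - (h j ∘ₗ d + d ∘ₗ h j)) (x := x) (i := c)
      (fun l => nat_lemma hx le_rfl ht W h hh j hj _)
    rw [bc_sub, bc_sub, bc_add, bc_comp, bc_comp, bc_comp, bc_comp] at this
    apply LinearMap.ext; intro z
    have h3 := LinearMap.congr_fun this z
    rw [LinearMap.sub_apply, LinearMap.sub_apply, LinearMap.zero_apply, sub_sub] at h3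
    exact sub_eq_zero.1 h3
  · have hεd' : bc (ε.comp g) d = 0 := by rw [← bc_bc, hεd]
    obtain ⟨N, hN⟩ := FGL (ε.comp g) hx (fun m hm y => by rw [hgX, hgx m hm, zero_smul])
      (fun m hm => by rw [RingHom.comp_apply, hgx m hm, map_zero]) hF hℓ c le_rfl hL
    refine ⟨N, fun n hn u hu => ?_⟩
    obtain ⟨v, w, hw, hv, huv⟩ := hN n hn u hu (by rw [hεd', LinearMap.comp_zero])
    refine ⟨v, fun j hj => (hv j hj).1, ?_⟩
    rw [hεd', LinearMap.comp_zero, add_zero] at huv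
    rw [huv]
    refine Finset.sum_congr rfl fun j _ => ?_
    rw [bc_bc]

end eis
end CX
end Part8

section Part9
open CategoryTheory Opposite Filter IsLocalRing ComplexityTest
namespace CX

theorem flat_raw {A R : Type*} [CommRing A] [IsNoetherianRing A] [CommRing R] [Algebra A R] [Module.Flat A R]
    {ι Λ : Type*} [Finite ι] (c : ι → Λ → A) (y : ι → R)
    (h : ∀ l, ∑ᶠ i, y i * algebraMap A R (c i l) = 0) :
    ∃ (n : ℕ) (a : Fin n → ι → A) (z : Fin n → R), (∀ i, y i = ∑ q, algebraMap A R (a q i) * z q) ∧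
      ∀ q l, ∑ᶠ i, a q i * c i l = 0 := by
  classical
  cases nonempty_fintype ι
  simp only [finsum_eq_sum_of_fintype] at h ⊢
  let x : (ι → A) →ₗ[A] R := Fintype.linearCombination A y
  have hx : ∀ i, x (Pi.single i 1) = y i := fun i => by
    simp [x, Fintype.linearCombination_apply_single]
  let K : Submodule A (ι → A) := Submodule.span A (Set.range fun l i => c i l)
  have hK : x ∘ₗ K.subtype = 0 := by
    apply LinearMap.ext
    rintro ⟨v, hv⟩
    simp only [LinearMap.comp_apply, Submodule.subtype_apply, LinearMap.zero_apply]
    have : K ≤ LinearMap.ker x := by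
      apply Submodule.span_le.2
      rintro _ ⟨l, rfl⟩
      refine LinearMap.mem_ker.2 ?_
      rw [Fintype.linearCombination_apply, ← h l]
      apply Finset.sum_congr rfl; intro i _
      rw [Algebra.smul_def, mul_comm]
    exact LinearMap.mem_ker.1 (this hv)
  obtain ⟨n, a, z, h1, h2⟩ := Module.Flat.exists_factorization_of_comp_eq_zero_of_free hK
  refine ⟨n, fun q i => a (Pi.single i 1) q, fun q => z (Finsupp.single q 1), ?_, ?_⟩
  · intro i
    rw [← hx i, h1, LinearMap.comp_apply]
    conv_lhs => rw [← Finsupp.sum_single (a (Pi.single i 1))]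
    rw [Finsupp.sum_fintype _ _ (by simp), map_sum]
    apply Finset.sum_congr rfl; intro q _
    rw [← Algebra.smul_def, ← map_smul]; simp
  · intro q l
    have h3 := LinearMap.congr_fun h2 ⟨fun i => c i l, Submodule.subset_span ⟨l, rfl⟩⟩
    have h4 : (fun i => c i l) = ∑ i, c i l • (Pi.single i 1 : ι → A) := by
      ext i; simp [Finset.sum_apply, Pi.single_apply]
    simp only [LinearMap.comp_apply, Submodule.subtype_apply, LinearMap.zero_apply] at h3
    rw [h4, map_sum] at h3
    have h5 := DFunLike.congr_fun h3 q
    rw [Finsupp.finsetSum_apply] at h5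
    simp only [map_smul, Finsupp.smul_apply, smul_eq_mul, Finsupp.coe_zero, Pi.zero_apply] at h5
    rw [← h5]
    apply Finset.sum_congr rfl; intro i _
    rw [mul_comm]

section stage1
variable {A R : Type*} [CommRing A] [IsNoetherianRing A] [CommRing R] [Algebra A R] [Module.Flat A R]
  {J : Type*} {deg : J → ℕ} {d : (J →₀ A) →ₗ[A] (J →₀ A)}

theorem stage1 (hfin : ∀ n, {j | deg j = n}.Finite) (hd : IsDeg deg deg 0 1 d) (hdd : d ∘ₗ d = 0)
    (hac : Acy deg d) (hac' : Acy deg (bc (algebraMap A R) d))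
    (T : (J →₀ R) →ₗ[R] (J →₀ R)) (hT : IsDeg deg deg 0 2 T)
    (hTd : bc (algebraMap A R) d ∘ₗ T = T ∘ₗ bc (algebraMap A R) d) :
    ∃ (m : ℕ) (w : Fin m → (J →₀ A) →ₗ[A] (J →₀ A)) (y : Fin m → R) (s : (J →₀ R) →ₗ[R] (J →₀ R)),
      (∀ i, IsDeg deg deg 0 2 (w i)) ∧ (∀ i, d ∘ₗ w i = w i ∘ₗ d) ∧
      T = ∑ i, y i • bc (algebraMap A R) (w i) +
        (bc (algebraMap A R) d ∘ₗ s + s ∘ₗ bc (algebraMap A R) d) := by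
  classical
  set f := algebraMap A R with hf
  set d' := bc f d with hd'
  let ι := {x : J × J // (deg x.1 = 2 ∨ deg x.1 = 3) ∧ deg x.2 + 2 = deg x.1}
  have : Finite ι := by
    have h1 : (({j | deg j = 2} ∪ {j | deg j = 3}) ×ˢ ({j | deg j = 0} ∪ {j | deg j = 1}) : Set (J × J)).Finite :=
      Set.Finite.prod ((hfin 2).union (hfin 3)) ((hfin 0).union (hfin 1))
    refine Set.Finite.subset h1 ?_
    rintro ⟨j, l⟩ ⟨h2, h3⟩
    dsimp only at h2 h3
    refine ⟨h2, ?_⟩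
    show deg l = 0 ∨ deg l = 1
    omega
  cases nonempty_fintype ι
  let E : ι → (J →₀ A) →ₗ[A] (J →₀ A) := fun i => mkOp fun j' => if j' = i.1.1 then e A i.1.2 else 0
  have hE : ∀ i, IsDeg deg deg 0 2 (E i) := by
    intro i j l hl
    simp only [E, mkOp_e] at hl
    split_ifs at hl with h1
    · have : l = i.1.2 := by
        by_contra h; exact hl (Finsupp.single_eq_of_ne h)
      rw [this, h1, i.2.2]; rfl
    · exact absurd rfl hl
  let y : ι → R := fun i => T (e R i.1.1) i.1.2
  have hTE : ∀ j, (deg j = 2 ∨ deg j = 3) → T (e R j) = ∑ i, y i • bc f (E i) (e R j) := by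
    intro j hj
    ext l
    simp only [bc_e, E, mkOp_e, Finsupp.finsetSum_apply, Finsupp.smul_apply, mr_apply, smul_eq_mul]
    by_cases hl : deg l + 2 = deg j
    · rw [Finset.sum_eq_single (⟨(j, l), hj, hl⟩ : ι)]
      · simp [y]
      · rintro ⟨⟨a, b⟩, h1, h2⟩ _ hne
        dsimp only
        split_ifs with h3
        · subst h3
          have : l ≠ b := by rintro rfl; exact hne rfl
          rw [Finsupp.single_eq_of_ne this]; simp
        · simp
      · intro h; exact absurd (Finset.mem_univ _) h
    · rw [Finset.sum_eq_zero]
      · by_contra h; exact hl (hT j l h)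
      · rintro ⟨⟨a, b⟩, h1, h2⟩ _
        dsimp only at h1 h2 ⊢
        split_ifs with h3
        · subst h3
          have : l ≠ b := by rintro rfl; exact hl h2
          rw [Finsupp.single_eq_of_ne this]; simp
        · simp
  have hTE' : ∀ n, (n = 2 ∨ n = 3) → ∀ v ∈ Hg R deg n, T v = ∑ i, y i • bc f (E i) v := by
    intro n hn v hv
    have := Hg_eq (φ := T) (ψ := ∑ i, y i • bc f (E i)) (deg := deg) (n := n) (fun j hj => by
      rw [hTE j (by omega)]; simp [LinearMap.sum_apply]) hv
    rw [this]; simp [LinearMap.sum_apply]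
  obtain ⟨m, a, z, h1, h2⟩ := flat_raw (A := A) (R := R) (ι := ι) (Λ := {x : J × J // deg x.1 = 3})
    (fun i x => (E i (d (e A x.1.1)) - d (E i (e A x.1.1))) x.1.2) y (by
      rintro ⟨⟨j, l⟩, hj⟩
      dsimp only at hj ⊢
      rw [finsum_eq_sum_of_fintype]
      have h3 := DFunLike.congr_fun (LinearMap.congr_fun hTd (e R j)) l
      simp only [LinearMap.comp_apply] at h3
      have hdj : d' (e R j) ∈ Hg R deg 2 := (bc_isDeg f hd).e_mem (by omega)
      rw [hTE j (Or.inr hj), hTE' 2 (Or.inl rfl) _ hdj, map_sum] at h3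
      simp only [map_smul] at h3
      have h4 : ∀ i, y i * f ((E i (d (e A j)) - d (E i (e A j))) l) =
          (y i • bc f (E i) (d' (e R j))) l - (y i • d' (bc f (E i) (e R j))) l := by
        intro i
        rw [hd', bc_e, bc_mr, bc_e, bc_mr]
        simp only [Finsupp.smul_apply, mr_apply, smul_eq_mul, Finsupp.sub_apply, map_sub, mul_sub]
      simp only [hf] at h4
      simp only [h4, Finset.sum_sub_distrib]
      rw [Finsupp.finsetSum_apply, Finsupp.finsetSum_apply] at h3
      rw [← h3, sub_self])
  have h2' : ∀ q j, deg j = 3 → (∑ i, a q i • E i) (d (e A j)) = d ((∑ i, a q i • E i) (e A j)) := by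
    intro q j hj
    ext l
    have h3 := h2 q ⟨(j, l), hj⟩
    rw [finsum_eq_sum_of_fintype] at h3
    rw [← sub_eq_zero, ← h3]
    simp only [LinearMap.sum_apply, LinearMap.smul_apply, map_sum, map_smul, Finsupp.finsetSum_apply,
      Finsupp.smul_apply, smul_eq_mul, Finsupp.sub_apply, mul_sub, Finset.sum_sub_distrib]
  have hθ : ∀ q, IsDeg deg deg 0 2 (∑ i, a q i • E i) := fun q => IsDeg.sum fun i _ => (hE i).smul _
  have h5 : ∀ q, ∃ φ : (J →₀ A) →ₗ[A] (J →₀ A), IsDeg deg deg 0 2 φ ∧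
      (∀ j, deg j = 2 → φ (e A j) = (∑ i, a q i • E i) (e A j)) ∧ d ∘ₗ φ = φ ∘ₗ d := by
    intro q
    exact LL hd hd hdd hac 2 (∑ i, a q i • E i) (fun j hj => (hθ q).e_mem (by omega))
      (fun j hj => ⟨_, (hθ q).e_mem (by omega), (h2' q j hj).symm⟩)
  choose w hw hw2 hwd using h5
  have hbd : IsDeg deg deg 0 1 d' := bc_isDeg f hd
  have hS : IsDeg deg deg 0 2 (∑ i, z i • bc f (w i)) := IsDeg.sum fun i _ => (bc_isDeg f (hw i)).smul _
  set ψ := T - ∑ i, z i • bc f (w i) with hψ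
  have hψ1 : IsDeg deg deg 0 2 ψ := hT.sub hS
  have hψd : d' ∘ₗ ψ = ψ ∘ₗ d' := by
    apply LinearMap.ext; intro v
    have h6 := LinearMap.congr_fun hTd v
    simp only [LinearMap.comp_apply] at h6
    simp only [LinearMap.comp_apply, hψ, LinearMap.sub_apply, map_sub, LinearMap.sum_apply, map_sum,
      LinearMap.smul_apply, map_smul, h6]
    congr 1
    apply Finset.sum_congr rfl; intro i _
    have h7 := LinearMap.congr_fun (congrArg (bc f) (hwd i)) v
    rw [bc_comp, bc_comp] at h7
    rw [hd']
    congr 1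
  have hψ2 : ∀ j, deg j = 2 → ψ (e R j) = 0 := by
    intro j hj
    rw [hψ, LinearMap.sub_apply, hTE j (Or.inl hj), sub_eq_zero]
    simp only [LinearMap.sum_apply, LinearMap.smul_apply, bc_e, hw2 _ j hj, map_sum, mr_smul]
    simp only [Finset.smul_sum, h1, Finset.sum_smul, ← hf]
    rw [Finset.sum_comm]
    apply Finset.sum_congr rfl; intro q _
    apply Finset.sum_congr rfl; intro i _
    rw [smul_smul, mul_comm]
  obtain ⟨s, hs, hs0, hs1⟩ := HL hbd (by rw [hd', ← bc_comp, hdd, bc_zero]) hac' 2 ψ hψ1 hψd 0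
    (fun j hj => zero_mem _) (fun j hj => ⟨0, zero_mem _, by rw [hψ2 j hj]; simp⟩)
  refine ⟨m, w, z, s, hw, hwd, ?_⟩
  have : ψ = d' ∘ₗ s + s ∘ₗ d' := by
    apply op_ext; intro j
    simp only [LinearMap.add_apply, LinearMap.comp_apply]
    by_cases hj : 2 ≤ deg j
    · exact hs1 j hj
    · have hz : s (d' (e R j)) = 0 := by
        by_cases h0 : deg j = 0
        · rw [hbd.e_zero (by omega), map_zero]
        · exact hs.eq_zero (n := deg j - 1) (by omega) (hbd.e_mem (by omega))
      rw [hψ1.e_zero (by omega), hz]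
      have : s (e R j) = 0 := by
        by_cases h1 : deg j = 1
        · rw [hs0 j (by omega)]; simp
        · exact hs.e_zero (by omega)
      rw [this]; simp
  rw [← this, hψ]
  apply LinearMap.ext; intro v
  simp
end stage1
end CX
end Part9

section Part10
open CategoryTheory Opposite Filter IsLocalRing ComplexityTest
namespace CX

theorem field_split {k K : Type*} [Field k] [Field K] [Algebra k K] {J : Type*} {ι Λ : Type*} [Fintype ι]
    (W : ι → (J →₀ k) →ₗ[k] (J →₀ k)) (W' : Λ → (J →₀ k) →ₗ[k] (J →₀ k)) (y : ι → K)
    (h : ∀ l, (∑ i, y i • bc (algebraMap k K) (W i)) ∘ₗ bc (algebraMap k K) (W' l) =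
      bc (algebraMap k K) (W' l) ∘ₗ (∑ i, y i • bc (algebraMap k K) (W i))) :
    ∃ (n : ℕ) (a : Fin n → ι → k) (z : Fin n → K), (∀ i, y i = ∑ q, algebraMap k K (a q i) * z q) ∧
      ∀ q l, (∑ i, a q i • W i) ∘ₗ W' l = W' l ∘ₗ (∑ i, a q i • W i) := by
  classical
  obtain ⟨n, a, z, h1, h2⟩ := flat_raw (A := k) (R := K) (ι := ι) (Λ := Λ × J × J)
    (fun i x => (W i (W' x.1 (e k x.2.1)) - W' x.1 (W i (e k x.2.1))) x.2.2) y (by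
      rintro ⟨l, j, j'⟩
      dsimp only
      rw [finsum_eq_sum_of_fintype]
      have h3 := DFunLike.congr_fun (LinearMap.congr_fun (h l) (e K j)) j'
      simp only [LinearMap.comp_apply, LinearMap.sum_apply, map_sum, LinearMap.smul_apply, map_smul,
        Finsupp.finsetSum_apply, Finsupp.smul_apply, bc_e, bc_mr, mr_apply, smul_eq_mul] at h3
      simp only [Finsupp.sub_apply, map_sub, mul_sub, Finset.sum_sub_distrib]
      rw [h3, sub_self])
  refine ⟨n, a, z, h1, ?_⟩
  intro q l
  apply op_ext; intro j
  ext j'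
  have h3 := h2 q (l, j, j')
  rw [finsum_eq_sum_of_fintype] at h3
  rw [← sub_eq_zero, ← h3]
  simp only [LinearMap.comp_apply, LinearMap.sum_apply, LinearMap.smul_apply, map_sum, map_smul, Finsupp.finsetSum_apply,
      Finsupp.smul_apply, smul_eq_mul, Finsupp.sub_apply, mul_sub, Finset.sum_sub_distrib]

theorem field_descend {k K : Type*} [Field k] [Field K] [Algebra k K] {J : Type*} {ι : Type*} [Fintype ι]
    {deg : J → ℕ} (W : ι → (J →₀ k) →ₗ[k] (J →₀ k)) {n : ℕ}
    (u : (J →₀ k) →ₗ[k] k) (u' : (J →₀ K) →ₗ[K] K) (huu : ∀ j, u' (e K j) = algebraMap k K (u (e k j)))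
    (v : ι → (J →₀ K) →ₗ[K] K) (hv : ∀ i, v i ∈ Ch K deg K n)
    (h : u' = ∑ i, v i ∘ₗ bc (algebraMap k K) (W i)) :
    ∃ v : ι → (J →₀ k) →ₗ[k] k, (∀ i, v i ∈ Ch k deg k n) ∧ u = ∑ i, v i ∘ₗ W i := by
  obtain ⟨ρ, hρ⟩ : ∃ ρ : K →ₗ[k] k, ∀ a, ρ (algebraMap k K a) = a := by
    obtain ⟨ρ, hρ⟩ := LinearMap.exists_leftInverse_of_injective (Algebra.linearMap k K)
      (LinearMap.ker_eq_bot.2 (algebraMap k K).injective)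
    exact ⟨ρ, fun a => LinearMap.congr_fun hρ a⟩
  refine ⟨fun i => mkOp fun j => ρ (v i (e K j)), ?_, ?_⟩
  · intro i j hj
    rw [mkOp_e, hv i j hj, map_zero]
  · have key : ∀ i (x : J →₀ k), ρ (v i (mr (algebraMap k K) x)) = mkOp (fun j => ρ (v i (e K j))) x := by
      intro i x
      induction x using Finsupp.induction_linear with
      | zero => simp
      | add a b ha hb => simp only [map_add, ha, hb]
      | single j r =>
        have : Finsupp.single j r = r • e k j := by simp
        rw [this, mr_smul, mr_e, map_smul (v i), map_smul (mkOp _), mkOp_e, smul_eq_mul, ← Algebra.smul_def, map_smul]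
    apply op_ext; intro j
    rw [← hρ (u (e k j)), ← huu, h]
    simp only [LinearMap.sum_apply, LinearMap.comp_apply, bc_e, map_sum, key]

theorem descent {A R : Type*} [CommRing A] [IsNoetherianRing A] [CommRing R] [Algebra A R] [Module.Flat A R]
    {J : Type*} {deg : J → ℕ} {d : (J →₀ A) →ₗ[A] (J →₀ A)}
    (hfin : ∀ n, {j | deg j = n}.Finite) (hd : IsDeg deg deg 0 1 d) (hdd : d ∘ₗ d = 0)
    (hac : Acy deg d) (hac' : Acy deg (bc (algebraMap A R) d))
    {k K : Type*} [Field k] [Field K] [Algebra k K] (π : A →+* k) (hπ : Function.Surjective π) (ε : R →+* K)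
    (hεπ : ε.comp (algebraMap A R) = (algebraMap k K).comp π) (hπd : bc π d = 0)
    {c : ℕ} (T : ℕ → (J →₀ R) →ₗ[R] (J →₀ R)) (hT : ∀ j, IsDeg deg deg 0 2 (T j))
    (hTd : ∀ j < c, bc (algebraMap A R) d ∘ₗ T j = T j ∘ₗ bc (algebraMap A R) d)
    (hTc : ∀ j < c, ∀ W : (J →₀ R) →ₗ[R] (J →₀ R), IsDeg deg deg 0 2 W →
        bc (algebraMap A R) d ∘ₗ W = W ∘ₗ bc (algebraMap A R) d →
        ∃ h : (J →₀ R) →ₗ[R] (J →₀ R), IsDeg deg deg 0 3 h ∧ T j ∘ₗ W = W ∘ₗ T j +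
          (h ∘ₗ bc (algebraMap A R) d + bc (algebraMap A R) d ∘ₗ h))
    {N : ℕ} (hTN : ∀ n ≥ N, ∀ u ∈ Ch K deg K (n + 2), ∃ v : ℕ → ((J →₀ K) →ₗ[K] K),
        (∀ j < c, v j ∈ Ch K deg K n) ∧ u = ∑ j ∈ Finset.range c, v j ∘ₗ bc ε (T j)) :
    ∃ (r : ℕ) (θ : Fin r → (J →₀ A) →ₗ[A] (J →₀ A)), (∀ i, IsDeg deg deg 0 2 (θ i)) ∧
      (∀ i, d ∘ₗ θ i = θ i ∘ₗ d) ∧ (∀ i i', bc π (θ i) ∘ₗ bc π (θ i') = bc π (θ i') ∘ₗ bc π (θ i)) ∧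
      ∀ n ≥ N, ∀ u ∈ Ch k deg k (n + 2), ∃ v : Fin r → ((J →₀ k) →ₗ[k] k),
        (∀ j, v j ∈ Ch k deg k n) ∧ u = ∑ j, v j ∘ₗ bc π (θ j) := by
  classical
  have hεd : bc ε (bc (algebraMap A R) d) = 0 := by
    rw [bc_bc, hεπ, ← bc_bc, hπd, bc_zero]
  have h1 := fun j : Fin c => stage1 hfin hd hdd hac hac' (T j) (hT j) (hTd j j.2)
  choose m w y s hw hwd hwT using h1
  have hTb : ∀ j : Fin c, bc ε (T j) = ∑ i, ε (y j i) • bc (algebraMap k K) (bc π (w j i)) := by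
    intro j
    rw [hwT j, bc_add, bc_add, bc_comp, bc_comp, hεd, bc_sum]
    simp only [bc_smul, bc_bc, hεπ, LinearMap.zero_comp, LinearMap.comp_zero, add_zero]
  have h2 := fun j : Fin c => field_split (k := k) (K := K) (J := J) (fun i => bc π (w j i))
    (fun l : (Σ j, Fin (m j)) => bc π (w l.1 l.2)) (fun i => ε (y j i)) (by
      intro l
      obtain ⟨h, -, hh⟩ := hTc j j.2 (bc (algebraMap A R) (w l.1 l.2)) (bc_isDeg _ (hw _ _)) (by
        rw [← bc_comp, ← bc_comp, hwd])
      have h3 := congrArg (bc ε) hh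
      rw [bc_add, bc_add, bc_comp, bc_comp, bc_comp, bc_comp, hεd, bc_bc, hεπ, ← bc_bc, hTb] at h3
      simpa using h3)
  choose n a z hy hc using h2
  choose a' ha' using fun (j : Fin c) (q : Fin (n j)) (i : Fin (m j)) => hπ (a j q i)
  let θ : (Σ j, Fin (n j)) → (J →₀ A) →ₗ[A] (J →₀ A) := fun q => ∑ i, a' q.1 q.2 i • w q.1 i
  have hθb : ∀ q, bc π (θ q) = ∑ i, a q.1 q.2 i • bc π (w q.1 i) := by
    intro q
    simp only [θ, bc_sum, bc_smul, ha']
  let φ := (Fintype.equivFin (Σ j, Fin (n j))).symm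
  refine ⟨_, fun i => θ (φ i), ?_, ?_, ?_, ?_⟩
  · intro i
    exact IsDeg.sum fun i _ => (hw _ _).smul _
  · intro i
    apply LinearMap.ext; intro v
    simp only [θ, LinearMap.comp_apply, LinearMap.sum_apply, map_sum, LinearMap.smul_apply, map_smul]
    apply Finset.sum_congr rfl; intro i' _
    congr 1
    exact LinearMap.congr_fun (hwd _ _) v
  · intro i i'
    rw [hθb (φ i')]
    apply LinearMap.ext; intro v
    simp only [LinearMap.comp_apply, LinearMap.sum_apply, map_sum, LinearMap.smul_apply, map_smul]
    apply Finset.sum_congr rfl; intro l _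
    congr 1
    rw [hθb]
    exact LinearMap.congr_fun (hc (φ i).1 (φ i).2 ⟨(φ i').1, l⟩) v
  · intro n' hn' u hu
    obtain ⟨v, hv, huv⟩ := hTN n' hn' (mkOp fun j => algebraMap k K (u (e k j))) (by
      intro j hj
      rw [mkOp_e, hu j hj, map_zero])
    refine field_descend (k := k) (K := K) (deg := deg) (fun i => bc π (θ (φ i))) u _ (fun j => mkOp_e _ j)
      (fun i => z (φ i).1 (φ i).2 • v (φ i).1) (fun i => Submodule.smul_mem _ _ (hv _ (φ i).1.2)) ?_
    rw [huv, Finset.sum_range]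
    rw [Equiv.sum_comp φ (fun x => (z x.1 x.2 • v x.1) ∘ₗ bc (algebraMap k K) (bc π (θ x))), Fintype.sum_sigma]
    apply Finset.sum_congr rfl; intro j _
    rw [hTb]
    apply LinearMap.ext; intro x
    simp only [hθb, bc_sum, bc_smul, hy, LinearMap.comp_apply, LinearMap.sum_apply, map_sum, LinearMap.smul_apply,
      map_smul, smul_eq_mul, Finset.sum_mul, Finset.mul_sum, Finset.sum_smul]
    rw [Finset.sum_comm]
    apply Finset.sum_congr rfl; intro q _
    apply Finset.sum_congr rfl; intro i _
    ring
end CX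
end Part10

section Part11
open CategoryTheory Opposite Filter IsLocalRing ComplexityTest TensorProduct
namespace CX

theorem II_ofList {Q : Type*} [CommRing Q] (rs : List Q) {i : ℕ} (hi : i ≤ rs.length) :
    II (fun m => rs.getD m 0) i = Ideal.ofList (rs.take i) := by
  apply le_antisymm
  · rintro _ ⟨y, rfl⟩
    refine Ideal.sum_mem _ fun m hm => Ideal.mul_mem_right _ _ (Ideal.subset_span ?_)
    simp only [Finset.mem_range] at hm
    have hm' : m < rs.length := by omega
    show rs.getD m 0 ∈ rs.take i
    rw [List.getD_eq_getElem _ _ hm', List.mem_take_iff_getElem]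
    exact ⟨m, by omega, rfl⟩
  · refine Ideal.span_le.2 ?_
    intro a ha
    have ha' : a ∈ rs.take i := ha
    rw [List.mem_take_iff_getElem] at ha'
    obtain ⟨m, hm, rfl⟩ := ha'
    have := mem_II_of_lt (x := fun m => rs.getD m 0) (i := i) (m := m) (by omega) 1
    rw [mul_one, List.getD_eq_getElem _ _ (by omega)] at this
    exact this

theorem reg_ofList {Q : Type*} [CommRing Q] (rs : List Q) (h : RingTheory.Sequence.IsWeaklyRegular Q rs) :
    Reg (fun m => rs.getD m 0) rs.length := by
  intro i hi a ha
  have h1 := h.regular_mod_prev i hi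
  rw [II_ofList _ hi.le] at ha ⊢
  have e1 : (Ideal.ofList (rs.take i) • ⊤ : Submodule Q Q) = Ideal.ofList (rs.take i) := by
    simp
  have h2 := isSMulRegular_iff_right_eq_zero_of_smul.1 h1 (Submodule.Quotient.mk a) (by
    rw [← Submodule.Quotient.mk_smul, Submodule.Quotient.mk_eq_zero, e1, smul_eq_mul]
    have ha2 : rs.getD i 0 * a ∈ _ := ha
    rwa [List.getD_eq_getElem _ _ hi] at ha2)
  rwa [Submodule.Quotient.mk_eq_zero, e1] at h2

section bcres
variable {A R : Type*} [CommRing A] [CommRing R] [Algebra A R] [Module.Flat A R]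
  {J : Type*} {deg : J → ℕ} {d : (J →₀ A) →ₗ[A] (J →₀ A)} {X : Type*} [AddCommGroup X] [Module A X]
  {aug : (J →₀ A) →ₗ[A] X}

theorem bc_isRes (h : IsRes deg d aug) : IsRes deg (bc (algebraMap A R) d)
    (mkOp fun j => (1 : R) ⊗ₜ[A] aug (e A j)) := by
  classical
  let E := finsuppScalarRight A R R J
  have hE : ∀ (r : R) (v : J →₀ A), E (r ⊗ₜ v) = r • mr (algebraMap A R) v := by
    intro r v
    ext j
    rw [finsuppScalarRight_apply_tmul_apply]
    simp [Algebra.smul_def, mul_comm]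
  have h1 : ∀ t, E (d.lTensor R t) = bc (algebraMap A R) d (E t) := by
    intro t
    induction t using TensorProduct.induction_on with
    | zero => simp
    | add a b ha hb => simp only [map_add, ha, hb]
    | tmul r v => rw [LinearMap.lTensor_tmul, hE, hE, map_smul, bc_mr]
  have h2 : ∀ t, aug.lTensor R t = mkOp (fun j => (1 : R) ⊗ₜ[A] aug (e A j)) (E t) := by
    intro t
    induction t using TensorProduct.induction_on with
    | zero => simp
    | add a b ha hb => simp only [map_add, ha, hb]
    | tmul r v =>
      rw [LinearMap.lTensor_tmul, hE, map_smul]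
      have : ∀ v : J →₀ A, mkOp (fun j => (1 : R) ⊗ₜ[A] aug (e A j)) (mr (algebraMap A R) v) = 1 ⊗ₜ aug v := by
        intro v
        induction v using Finsupp.induction_linear with
        | zero => simp
        | add a b ha hb => simp only [map_add, ha, hb, tmul_add]
        | single j a =>
          have : Finsupp.single j a = a • e A j := by simp
          rw [this, mr_smul, mr_e, map_smul, mkOp_e, map_smul, tmul_smul, algebraMap_smul]
      rw [this, smul_tmul']
      simp
  refine ⟨h.fin, bc_isDeg _ h.hd, ?_, ?_, ?_, ?_, ?_⟩
  · intro j hj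
    rw [mkOp_e, h.haug j hj, tmul_zero]
  · rw [← bc_comp, h.dd, bc_zero]
  · apply op_ext; intro j
    have h3 : E (1 ⊗ₜ e A j) = e R j := by rw [hE, mr_e, one_smul]
    rw [LinearMap.comp_apply, ← h3, ← h1, ← h2, LinearMap.lTensor_tmul, LinearMap.lTensor_tmul,
      show aug (d (e A j)) = 0 from LinearMap.congr_fun h.augd _, tmul_zero]
    rfl
  · intro x
    obtain ⟨t, rfl⟩ := LinearMap.lTensor_surjective R h.surj x
    exact ⟨E t, (h2 t).symm⟩
  · intro a ha haa
    obtain ⟨t, rfl⟩ := E.surjective a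
    rw [← h1] at ha
    rw [← h2] at haa
    have ha' : d.lTensor R t = 0 := E.injective (by rw [ha, map_zero])
    have hex : Function.Exact d (d.prod aug) := by
      intro v
      constructor
      · intro hv
        exact h.exact v (Prod.ext_iff.1 hv).1 (Prod.ext_iff.1 hv).2
      · rintro ⟨w, rfl⟩
        exact Prod.ext (LinearMap.congr_fun h.dd w) (LinearMap.congr_fun h.augd w)
    have hP : ∀ t, prodRight A A R (J →₀ A) X ((d.prod aug).lTensor R t) = (d.lTensor R t, aug.lTensor R t) := by
      intro t
      induction t using TensorProduct.induction_on with
      | zero => simp only [map_zero]; rfl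
      | add a b ha hb => simp only [map_add, ha, hb]; rfl
      | tmul r v => simp
    have h0 : (d.prod aug).lTensor R t = 0 := by
      apply (prodRight A A R (J →₀ A) X).injective
      rw [hP, ha', haa, map_zero]; rfl
    obtain ⟨w, rfl⟩ := (Module.Flat.lTensor_exact R hex t).1 h0
    exact ⟨E w, (h1 w).symm⟩
end bcres

theorem bc_eq_zero {A k J J' : Type*} [CommRing A] [CommRing k] (π : A →+* k) {φ : (J →₀ A) →ₗ[A] (J' →₀ A)}
    (h : ∀ j l, π (φ (e A j) l) = 0) : bc π φ = 0 := by
  apply op_ext; intro j; ext l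
  rw [bc_e, mr_apply, h]; rfl

theorem main_ops {A : Type u} [CommRing A] [IsLocalRing A] [IsNoetherianRing A] {X : Type u} [AddCommGroup X]
    [Module A X] (F : MinFreeRes A X) (qd : QuasiDeformation A)
    (h : letI : Module qd.Q (TensorProduct A qd.R X) := Module.compHom _ qd.g
      HasFiniteProjDim qd.Q (TensorProduct A qd.R X)) :
    ∃ (r N : ℕ) (θ : Fin r → (TJ F →₀ A) →ₗ[A] (TJ F →₀ A)), (∀ i, IsDeg (tdeg F) (tdeg F) 0 2 (θ i)) ∧
      (∀ i, td F ∘ₗ θ i = θ i ∘ₗ td F) ∧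
      (∀ i i', bc (residue A) (θ i) ∘ₗ bc (residue A) (θ i') = bc (residue A) (θ i') ∘ₗ bc (residue A) (θ i)) ∧
      ∀ n ≥ N, ∀ u ∈ Ch (ResidueField A) (tdeg F) (ResidueField A) (n + 2),
        ∃ v : Fin r → ((TJ F →₀ ResidueField A) →ₗ[ResidueField A] ResidueField A),
        (∀ j, v j ∈ Ch (ResidueField A) (tdeg F) (ResidueField A) n) ∧ u = ∑ j, v j ∘ₗ bc (residue A) (θ j) := by
  letI : Module qd.Q (TensorProduct A qd.R X) := Module.compHom _ qd.g
  obtain ⟨ℓ, G, hG⟩ := h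
  haveI := qd.isLocalHom_to_R
  haveI := qd.faithfullyFlat
  have hπd : bc (residue A) (td F) = 0 := bc_eq_zero _ fun j l => (residue_eq_zero_iff _).2 (td_minimal F j l)
  have hεπ : (residue qd.R).comp (algebraMap A qd.R) =
    (algebraMap (ResidueField A) (ResidueField qd.R)).comp (residue A) := by
    ext a; rfl
  have hRes := bc_isRes (R := qd.R) (t_isRes F)
  obtain ⟨T, hT, hTd, hTc, N, hN⟩ := eisenbud (x := fun m => qd.rs.getD m 0) (c := qd.rs.length) qd.g
    (X := TensorProduct A qd.R X) (fun q y => rfl) qd.g_surjective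
    (reg_ofList _ qd.rs_regular.toIsWeaklyRegular)
    (fun a => by
      rw [← RingHom.mem_ker, qd.ker_g, II_ofList _ le_rfl, List.take_length]) hRes (t_isRes G)
    (ℓ := ℓ) (fun j => by
      by_contra hj
      have h1 := hG j.1 (by exact not_le.1 hj)
      exact (h1 ▸ j.2 : Fin 0).elim0) (residue qd.R)
    (by rw [bc_bc, hεπ, ← bc_bc, hπd, bc_zero])
  obtain ⟨r, θ, h1, h2, h3, h4⟩ := descent (t_isRes F).fin (t_isRes F).hd (t_isRes F).dd (t_isRes F).acy hRes.acy (residue A)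
    residue_surjective (residue qd.R) hεπ hπd T hT hTd hTc hN
  exact ⟨r, N, θ, h1, h2, h3, h4⟩
end CX
end Part11

section Part12
open CategoryTheory Opposite Filter IsLocalRing ComplexityTest
namespace CX

section abs
variable {k : Type u} {V : Type v} [Field k] [AddCommGroup V] [Module k V] {r : ℕ} (Z : ℕ → Submodule k V)
    (τ : Fin r → V →ₗ[k] V)

noncomputable def subT (hZT : ∀ j n, ∀ u ∈ Z n, τ j u ∈ Z (n + 2)) (j : Fin r) (n : ℕ) : Z n →ₗ[k] Z (n + 2) :=
  (τ j).restrict (hZT j n)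

theorem subT_comm (hZT : ∀ j n, ∀ u ∈ Z n, τ j u ∈ Z (n + 2)) (hc : ∀ a b u, τ a (τ b u) = τ b (τ a u)) :
    Comm (E := fun n => Z n) (subT Z τ hZT) := by
  intro i j n x
  exact Subtype.ext (hc i j x.1)

theorem subT_fg (hZT : ∀ j n, ∀ u ∈ Z n, τ j u ∈ Z (n + 2))
    (hfg : ∃ N, ∀ n ≥ N, ∀ u ∈ Z (n + 2), ∃ v : Fin r → V, (∀ j, v j ∈ Z n) ∧ u = ∑ j, τ j (v j)) :
    FGr (E := fun n => Z n) (subT Z τ hZT) (fun _ => ⊤) := by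
  obtain ⟨N, hN⟩ := hfg
  refine ⟨N, fun n hn x _ => ?_⟩
  obtain ⟨v, hv, hx⟩ := hN n hn x.1 x.2
  refine ⟨fun j => ⟨v j, hv j⟩, fun _ => trivial, Subtype.ext ?_⟩
  rw [AddSubmonoidClass.coe_finsetSum]
  exact hx

theorem abs_delta [∀ n, Module.Finite k (Z n)] (hZT : ∀ j n, ∀ u ∈ Z n, τ j u ∈ Z (n + 2))
    (hc : ∀ a b u, τ a (τ b u) = τ b (τ a u))
    (hfg : ∃ N, ∀ n ≥ N, ∀ u ∈ Z (n + 2), ∃ v : Fin r → V, (∀ j, v j ∈ Z n) ∧ u = ∑ j, τ j (v j)) :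
    ∃ N, ∀ n ≥ N, Delta^[r] (fun n => (Module.finrank k (Z n) : ℤ)) n = 0 :=
  delta_lemma r (fun n => Z n) (subT Z τ hZT) (subT_comm Z τ hZT hc) (subT_fg Z τ hZT hfg)

theorem abs_reg [∀ n, Module.Finite k (Z n)] (hZT : ∀ j n, ∀ u ∈ Z n, τ j u ∈ Z (n + 2))
    (hc : ∀ a b u, τ a (τ b u) = τ b (τ a u))
    (hfg : ∃ N, ∀ n ≥ N, ∀ u ∈ Z (n + 2), ∃ v : Fin r → V, (∀ j, v j ∈ Z n) ∧ u = ∑ j, τ j (v j))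
    (O : ℕ → (V →ₗ[k] V) → Prop)
    (hmul : ∀ p q x y, O p x → O q y → O (p + q) (x ∘ₗ y))
    (hadd : ∀ p x y, O p x → O p y → O p (x + y)) (h0 : O 1 0)
    (hT : ∀ j, O 1 (τ j)) :
    ∃ q f, 1 ≤ q ∧ O q f ∧ ∃ N, ∀ n ≥ N, ∀ x ∈ Z n, f x = 0 → x = 0 := by
  obtain ⟨q, F, hq, ⟨f, hf, hfF⟩, N, hN⟩ := exists_filter_regular (E := fun n => Z n) (t := subT Z τ hZT) (subT_comm Z τ hZT hc)
    (subT_fg Z τ hZT hfg) (fun q F => ∃ f, O q f ∧ ∀ n (x : Z n) m (hm : m = n + 2 * q), ∃ hx : f x.1 ∈ Z m,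
      F (DirectSum.lof k ℕ (fun n => Z n) n x) = DirectSum.lof k ℕ (fun n => Z n) m ⟨f x.1, hx⟩)
    (by
      rintro p q F G ⟨f, hf, hF⟩ ⟨g, hg, hG⟩
      refine ⟨f ∘ₗ g, hmul _ _ _ _ hf hg, ?_⟩
      rintro n x m hm
      obtain ⟨h1, h2⟩ := hG n x _ rfl
      obtain ⟨h3, h4⟩ := hF _ ⟨g x.1, h1⟩ m (by omega)
      refine ⟨h3, ?_⟩
      rw [Module.End.mul_apply, h2, h4]; rfl)
    (by
      rintro p F G ⟨f, hf, hF⟩ ⟨g, hg, hG⟩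
      refine ⟨f + g, hadd _ _ _ hf hg, ?_⟩
      rintro n x m hm
      obtain ⟨h1, h2⟩ := hG n x m hm
      obtain ⟨h3, h4⟩ := hF n x m hm
      refine ⟨(Z m).add_mem h3 h1, ?_⟩
      rw [LinearMap.add_apply, h2, h4, ← map_add]; rfl)
    ⟨0, h0, by
      rintro n x m hm
      refine ⟨(Z m).zero_mem, ?_⟩
      have : (⟨(0 : V →ₗ[k] V) x.1, (Z m).zero_mem⟩ : Z m) = 0 := rfl
      rw [this, map_zero]; rfl⟩
    (by
      intro j
      refine ⟨τ j, hT j, ?_⟩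
      rintro n x m rfl
      exact ⟨hZT j n _ x.2, by rw [tauOp_lof]; rfl⟩)
  refine ⟨q, f, hq, hf, N, fun n hn x hx hfx => ?_⟩
  have := hN n hn ⟨x, hx⟩ (by
    obtain ⟨h1, h2⟩ := hfF n ⟨x, hx⟩ _ rfl
    rw [h2]
    have : (⟨f x, h1⟩ : Z (n + 2 * q)) = 0 := Subtype.ext hfx
    rw [this, map_zero])
  exact congrArg Subtype.val this
end abs

section appl
variable {A : Type*} [CommRing A] {k : Type*} [Field k] (π : A →+* k) {J : Type*} {deg : J → ℕ}
  {d : (J →₀ A) →ₗ[A] (J →₀ A)} {r N : ℕ} (θ : Fin r → (J →₀ A) →ₗ[A] (J →₀ A))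

theorem delta_J (hfin : ∀ n, {j | deg j = n}.Finite) (hθ : ∀ i, IsDeg deg deg 0 2 (θ i))
    (hcom : ∀ i i', bc π (θ i) ∘ₗ bc π (θ i') = bc π (θ i') ∘ₗ bc π (θ i))
    (hgen : ∀ n ≥ N, ∀ u ∈ Ch k deg k (n + 2), ∃ v : Fin r → ((J →₀ k) →ₗ[k] k),
        (∀ j, v j ∈ Ch k deg k n) ∧ u = ∑ j, v j ∘ₗ bc π (θ j)) :
    ∃ N, ∀ n ≥ N, Delta^[r] (fun n => ({j | deg j = n}.ncard : ℤ)) n = 0 := by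
  haveI : ∀ n, Module.Finite k (Ch k deg k n) := fun n => Ch_finite (hfin n)
  have := abs_delta (k := k) (V := (J →₀ k) →ₗ[k] k) (Ch k deg k) (fun i => LinearMap.lcomp k k (bc π (θ i)))
    (fun j n u hu => (bc_isDeg π (hθ j)).ch (by omega) hu)
    (fun a b u => by
      show (u ∘ₗ _) ∘ₗ _ = (u ∘ₗ _) ∘ₗ _
      rw [LinearMap.comp_assoc, LinearMap.comp_assoc, hcom])
    ⟨N, hgen⟩
  simpa only [Ch_finrank (hfin _)] using this

theorem reg_J (hfin : ∀ n, {j | deg j = n}.Finite) (hθ : ∀ i, IsDeg deg deg 0 2 (θ i))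
    (hθd : ∀ i, d ∘ₗ θ i = θ i ∘ₗ d)
    (hcom : ∀ i i', bc π (θ i) ∘ₗ bc π (θ i') = bc π (θ i') ∘ₗ bc π (θ i))
    (hgen : ∀ n ≥ N, ∀ u ∈ Ch k deg k (n + 2), ∃ v : Fin r → ((J →₀ k) →ₗ[k] k),
        (∀ j, v j ∈ Ch k deg k n) ∧ u = ∑ j, v j ∘ₗ bc π (θ j)) :
    ∃ (q : ℕ) (η : (J →₀ A) →ₗ[A] (J →₀ A)) (N : ℕ), 1 ≤ q ∧ IsDeg deg deg 0 (2 * q) η ∧ d ∘ₗ η = η ∘ₗ d ∧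
      ∀ n ≥ N, ∀ u ∈ Ch k deg k n, u ∘ₗ bc π η = 0 → u = 0 := by
  haveI : ∀ n, Module.Finite k (Ch k deg k n) := fun n => Ch_finite (hfin n)
  obtain ⟨q, f, hq, ⟨η, h1, h2, rfl⟩, N, hN⟩ := abs_reg (k := k) (V := (J →₀ k) →ₗ[k] k) (Ch k deg k) (fun i => LinearMap.lcomp k k (bc π (θ i)))
    (fun j n u hu => (bc_isDeg π (hθ j)).ch (by omega) hu)
    (fun a b u => by
      show (u ∘ₗ _) ∘ₗ _ = (u ∘ₗ _) ∘ₗ _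
      rw [LinearMap.comp_assoc, LinearMap.comp_assoc, hcom])
    ⟨N, hgen⟩
    (fun q f => ∃ η : (J →₀ A) →ₗ[A] (J →₀ A), IsDeg deg deg 0 (2 * q) η ∧ d ∘ₗ η = η ∘ₗ d ∧
      f = LinearMap.lcomp k k (bc π η))
    (by
      rintro p q _ _ ⟨η, h1, h2, rfl⟩ ⟨η', h1', h2', rfl⟩
      refine ⟨η' ∘ₗ η, (h1'.comp h1).cast (by omega), ?_, ?_⟩
      · rw [← LinearMap.comp_assoc, h2', LinearMap.comp_assoc, h2, LinearMap.comp_assoc]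
      · rw [bc_comp]; rfl)
    (by
      rintro p _ _ ⟨η, h1, h2, rfl⟩ ⟨η', h1', h2', rfl⟩
      refine ⟨η + η', h1.add h1', ?_, ?_⟩
      · rw [LinearMap.comp_add, LinearMap.add_comp, h2, h2']
      · rw [bc_add]
        apply LinearMap.ext; intro u
        exact (LinearMap.comp_add _ _ u).symm)
    ⟨0, IsDeg.zero, by simp, by
      rw [bc_zero]
      apply LinearMap.ext; intro u
      exact (LinearMap.comp_zero u).symm⟩
    (fun j => ⟨θ j, hθ j, hθd j, rfl⟩)
  exact ⟨q, η, N, hq, h1, h2, hN⟩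
end appl

/-- A package: the resolution admits an eventually injective chain endomorphism of even degree. -/
theorem main_reg {A : Type u} [CommRing A] [IsLocalRing A] [IsNoetherianRing A] {X : Type u} [AddCommGroup X]
    [Module A X] (F : MinFreeRes A X) (qd : QuasiDeformation A)
    (h : letI : Module qd.Q (TensorProduct A qd.R X) := Module.compHom _ qd.g
      HasFiniteProjDim qd.Q (TensorProduct A qd.R X)) :
    (∃ r N, ∀ n ≥ N, Delta^[r] (fun n => (F.b n : ℤ)) n = 0) ∧
    ∃ (q : ℕ) (η : (TJ F →₀ A) →ₗ[A] (TJ F →₀ A)) (N : ℕ), 1 ≤ q ∧ IsDeg (tdeg F) (tdeg F) 0 (2 * q) η ∧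
      td F ∘ₗ η = η ∘ₗ td F ∧ ∀ n ≥ N, ∀ u ∈ Ch (ResidueField A) (tdeg F) (ResidueField A) n,
        u ∘ₗ bc (residue A) η = 0 → u = 0 := by
  obtain ⟨r, N, θ, h1, h2, h3, h4⟩ := main_ops F qd h
  refine ⟨⟨r, ?_⟩, ?_⟩
  · have := delta_J (residue A) θ (t_isRes F).fin h1 h3 h4
    simpa only [t_card] using this
  · exact reg_J (residue A) θ (t_isRes F).fin h1 h2 h3 h4
end CX
end Part12

section Part13
open CategoryTheory Opposite Filter IsLocalRing ComplexityTest
namespace CX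

/-- finite resolutions by finitely generated projectives of length at most `n` -/
def FFR (Q : Type u) [CommRing Q] : ℕ → ∀ (X : Type u) [AddCommGroup X] [Module Q X], Prop
  | 0, X, _, _ => Module.Finite Q X ∧ Module.Projective Q X
  | n + 1, X, _, _ => ∃ (P : Type u) (_ : AddCommGroup P) (_ : Module Q P) (f : P →ₗ[Q] X), Module.Finite Q P ∧
      Module.Projective Q P ∧ Function.Surjective f ∧ FFR Q n (LinearMap.ker f)

section ffr
variable {Q : Type u} [CommRing Q]

theorem FFR.equiv {n : ℕ} : ∀ {X Y : Type u} [AddCommGroup X] [Module Q X] [AddCommGroup Y] [Module Q Y],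
    FFR Q n X → ∀ (_ : X ≃ₗ[Q] Y), FFR Q n Y := by
  cases n with
  | zero =>
    intro X Y _ _ _ _ h E
    haveI := h.1
    haveI := h.2
    exact ⟨Module.Finite.equiv E, Module.Projective.of_equiv E⟩
  | succ n =>
    intro X Y _ _ _ _ h E
    obtain ⟨P, _, _, f, h1, h2, h3, h4⟩ := h
    refine ⟨P, _, _, E.toLinearMap ∘ₗ f, h1, h2, E.surjective.comp h3, ?_⟩
    rwa [LinearEquiv.ker_comp]

/-- the kernel of a map in a short exact sequence -/
noncomputable def kerEquiv {X K Z : Type*} [AddCommGroup X] [Module Q X] [AddCommGroup K] [Module Q K] [AddCommGroup Z]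
    [Module Q Z] {f : X →ₗ[Q] K} {p : K →ₗ[Q] Z} (hf : Function.Injective f) (he : Function.Exact f p) :
    X ≃ₗ[Q] LinearMap.ker p :=
  (LinearEquiv.ofInjective f hf).trans (LinearEquiv.ofEq _ _ (LinearMap.exact_iff.1 he).symm)

theorem FFR.step {n : ℕ} {X P K : Type u} [AddCommGroup X] [Module Q X] [AddCommGroup P] [Module Q P] [AddCommGroup K]
    [Module Q K] [Module.Finite Q P] [Module.Projective Q P] {f : K →ₗ[Q] P} {p : P →ₗ[Q] X}
    (hf : Function.Injective f) (he : Function.Exact f p) (hp : Function.Surjective p) (h : FFR Q n K) :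
    FFR Q (n + 1) X :=
  ⟨P, _, _, p, inferInstance, inferInstance, hp, h.equiv (kerEquiv hf he)⟩

theorem FFR.of_subsingleton (n : ℕ) : ∀ (X : Type u) [AddCommGroup X] [Module Q X] [Subsingleton X], FFR Q n X := by
  induction n with
  | zero =>
    intro X _ _ _
    exact ⟨inferInstance, inferInstance⟩
  | succ n ih =>
    intro X _ _ _
    exact ⟨X, _, _, LinearMap.id, inferInstance, inferInstance, Function.surjective_id, ih _⟩

theorem FFR.succ {n : ℕ} : ∀ {X : Type u} [AddCommGroup X] [Module Q X], FFR Q n X → FFR Q (n + 1) X := by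
  induction n with
  | zero =>
    intro X _ _ h
    refine ⟨X, _, _, LinearMap.id, h.1, h.2, Function.surjective_id, ?_⟩
    haveI : Subsingleton (LinearMap.ker (LinearMap.id : X →ₗ[Q] X)) := by
      rw [LinearMap.ker_id]; infer_instance
    exact FFR.of_subsingleton 0 _
  | succ n ih =>
    intro X _ _ h
    obtain ⟨P, _, _, f, h1, h2, h3, h4⟩ := h
    exact ⟨P, _, _, f, h1, h2, h3, ih h4⟩

theorem FFR.mono {n m : ℕ} (h : n ≤ m) {X : Type u} [AddCommGroup X] [Module Q X] (hX : FFR Q n X) : FFR Q m X := by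
  induction m, h using Nat.le_induction with
  | base => exact hX
  | succ m _ ih => exact ih.succ

theorem FFR.finite {n : ℕ} {X : Type u} [AddCommGroup X] [Module Q X] (hX : FFR Q n X) : Module.Finite Q X := by
  cases n with
  | zero => exact hX.1
  | succ n =>
    obtain ⟨P, _, _, f, h1, h2, h3, h4⟩ := hX
    exact Module.Finite.of_surjective f h3

theorem FFR.prod {n : ℕ} : ∀ {X P : Type u} [AddCommGroup X] [Module Q X] [AddCommGroup P] [Module Q P]
    [Module.Finite Q P] [Module.Projective Q P], FFR Q n X → FFR Q n (X × P) := by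
  cases n with
  | zero =>
    intro X P _ _ _ _ _ _ h
    haveI := h.1
    haveI := h.2
    exact ⟨inferInstance, inferInstance⟩
  | succ n =>
    intro X P _ _ _ _ _ _ h
    obtain ⟨P0, _, _, f, h1, h2, h3, h4⟩ := h
    refine FFR.step (f := LinearMap.inl Q P0 P ∘ₗ (LinearMap.ker f).subtype) (p := f.prodMap LinearMap.id) ?_ ?_ ?_ h4
    · exact LinearMap.inl_injective.comp (Submodule.injective_subtype _)
    · rintro ⟨a, b⟩
      constructor
      · intro h
        have h5 := Prod.ext_iff.1 h
        simp only [LinearMap.prodMap_apply] at h5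
        refine ⟨⟨a, h5.1⟩, ?_⟩
        exact Prod.ext rfl h5.2.symm
      · rintro ⟨⟨x, hx⟩, h⟩
        rw [← h]
        exact Prod.ext hx rfl
    · rintro ⟨x, y⟩
      obtain ⟨a, rfl⟩ := h3 x
      exact ⟨(a, y), rfl⟩

theorem FFR.of_prod {n : ℕ} : ∀ {X P : Type u} [AddCommGroup X] [Module Q X] [AddCommGroup P] [Module Q P]
    [Module.Finite Q P] [Module.Projective Q P], FFR Q n (X × P) → FFR Q n X := by
  cases n with
  | zero =>
    intro X P _ _ _ _ _ _ h
    haveI := h.1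
    haveI := h.2
    exact ⟨Module.Finite.of_surjective (LinearMap.fst Q X P) LinearMap.fst_surjective,
      Module.Projective.of_split (LinearMap.inl Q X P) (LinearMap.fst Q X P) (by ext; rfl)⟩
  | succ n =>
    intro X P _ _ _ _ _ _ h
    obtain ⟨P0, _, _, f, h1, h2, h3, h4⟩ := h
    let g : P0 →ₗ[Q] P := LinearMap.snd Q X P ∘ₗ f
    have hg : Function.Surjective g := (LinearMap.snd_surjective (R := Q) (M := X) (M₂ := P)).comp h3
    obtain ⟨s, hs⟩ := Module.projective_lifting_property g LinearMap.id hg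
    have hs' : ∀ x, g (s x) = x := fun x => LinearMap.congr_fun hs x
    let ρ : P0 →ₗ[Q] LinearMap.ker g := (LinearMap.id - s ∘ₗ g).codRestrict _ (by
      intro x
      rw [LinearMap.mem_ker]
      simp [hs'])
    have hρ : ρ ∘ₗ (LinearMap.ker g).subtype = LinearMap.id := by
      apply LinearMap.ext; rintro ⟨x, hx⟩
      apply Subtype.ext
      have hx' : g x = 0 := hx
      simp [ρ, hx']
    haveI : Module.Finite Q (LinearMap.ker g) := Module.Finite.of_surjective ρ (fun x => ⟨x.1, LinearMap.congr_fun hρ x⟩)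
    haveI : Module.Projective Q (LinearMap.ker g) := Module.Projective.of_split _ ρ hρ
    refine FFR.step (P := LinearMap.ker g) (f := Submodule.inclusion (p := LinearMap.ker f) (p' := LinearMap.ker g) ?_)
      (p := LinearMap.fst Q X P ∘ₗ f ∘ₗ (LinearMap.ker g).subtype) ?_ ?_ ?_ h4
    · intro x hx
      rw [LinearMap.mem_ker] at hx ⊢
      simp [g, hx]
    · exact Submodule.inclusion_injective _
    · rintro ⟨x, hx⟩
      constructor
      · intro h5
        refine ⟨⟨x, ?_⟩, rfl⟩
        exact Prod.ext h5 hx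
      · rintro ⟨⟨y, hy⟩, h⟩
        have : y = x := congrArg Subtype.val h
        subst this
        exact (Prod.ext_iff.1 (LinearMap.mem_ker.1 hy)).1
    · intro x
      obtain ⟨y, hy⟩ := h3 (x, 0)
      refine ⟨⟨y, ?_⟩, ?_⟩
      · rw [LinearMap.mem_ker]; simp [g, hy]
      · simp [hy]

/-- half of Schanuel -/
theorem schanuel {X P P' : Type u} [AddCommGroup X] [Module Q X] [AddCommGroup P] [Module Q P] [AddCommGroup P'] [Module Q P']
    [Module.Projective Q P'] (f : P →ₗ[Q] X) (g : P' →ₗ[Q] X) (hf : Function.Surjective f) :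
    Nonempty ((LinearMap.ker f × P') ≃ₗ[Q] LinearMap.ker (f.coprod (-g))) := by
  obtain ⟨s, hs⟩ := Module.projective_lifting_property f g hf
  have hs' : ∀ x, f (s x) = g x := fun x => LinearMap.congr_fun hs x
  refine ⟨LinearEquiv.ofBijective (LinearMap.codRestrict _
    (((LinearMap.ker f).subtype.coprod s).prod (LinearMap.snd Q _ _)) ?_) ⟨?_, ?_⟩⟩
  · rintro ⟨⟨x, hx⟩, y⟩
    rw [LinearMap.mem_ker] at hx ⊢
    simp [hx, hs']
  · rintro ⟨⟨x, hx⟩, y⟩ ⟨⟨x', hx'⟩, y'⟩ h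
    have h1 := Prod.ext_iff.1 (congrArg Subtype.val h)
    simp at h1
    obtain ⟨h1, rfl⟩ := h1
    simp at h1
    subst h1; rfl
  · rintro ⟨⟨x, y⟩, h⟩
    rw [LinearMap.mem_ker] at h
    simp at h
    refine ⟨(⟨x - s y, ?_⟩, y), ?_⟩
    · rw [LinearMap.mem_ker, map_sub, hs']
      rw [← sub_eq_add_neg] at h; exact h
    · apply Subtype.ext
      simp

theorem FFR.cover {n : ℕ} {X P' : Type u} [AddCommGroup X] [Module Q X] [AddCommGroup P'] [Module Q P']
    [Module.Finite Q P'] [Module.Projective Q P'] (h : FFR Q (n + 1) X) (g : P' →ₗ[Q] X) (hg : Function.Surjective g) :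
    FFR Q n (LinearMap.ker g) := by
  obtain ⟨P, _, _, f, h1, h2, h3, h4⟩ := h
  obtain ⟨E1⟩ := schanuel f g h3
  obtain ⟨E2⟩ := schanuel g f hg
  have E3 : LinearMap.ker (f.coprod (-g)) ≃ₗ[Q] LinearMap.ker (g.coprod (-f)) :=
    LinearEquiv.ofSubmodules (LinearEquiv.prodComm Q P P') _ _ (by
      ext ⟨a, b⟩
      simp only [Submodule.mem_map, LinearMap.mem_ker, LinearMap.coprod_apply, LinearMap.neg_apply]
      constructor
      · rintro ⟨⟨x, y⟩, h, h'⟩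
        have h'' := Prod.ext_iff.1 h'
        obtain ⟨rfl, rfl⟩ : y = a ∧ x = b := h''
        dsimp only at h
        rw [← neg_eq_zero, ← h]; abel
      · intro h
        refine ⟨(b, a), ?_, rfl⟩
        rw [← neg_eq_zero, ← h]; abel)
  exact (h4.prod.equiv ((E1.trans E3).trans E2.symm)).of_prod
theorem FFR.ext {n : ℕ} : ∀ {X K Z : Type u} [AddCommGroup X] [Module Q X] [AddCommGroup K] [Module Q K]
    [AddCommGroup Z] [Module Q Z] {f : X →ₗ[Q] K} {p : K →ₗ[Q] Z} (_ : Function.Injective f)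
    (_ : Function.Exact f p) (_ : Function.Surjective p), FFR Q n X → FFR Q n Z → FFR Q n K := by
  induction n with
  | zero =>
    intro X K Z _ _ _ _ _ _ f p hf he hp hX hZ
    haveI := hX.1
    haveI := hX.2
    haveI := hZ.1
    haveI := hZ.2
    obtain ⟨s, hs⟩ := Module.projective_lifting_property p LinearMap.id hp
    have hs' : ∀ x, p (s x) = x := fun x => LinearMap.congr_fun hs x
    have E : (X × Z) ≃ₗ[Q] K := LinearEquiv.ofBijective (f.coprod s) ⟨by
      rw [injective_iff_map_eq_zero]
      rintro ⟨x, z⟩ h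
      simp only [LinearMap.coprod_apply] at h
      have h1 := congrArg p h
      rw [map_add, he.apply_apply_eq_zero, hs', zero_add, map_zero] at h1
      subst h1
      rw [map_zero, add_zero] at h
      rw [hf (h.trans (map_zero f).symm)]; rfl, by
      intro y
      obtain ⟨x, hx⟩ := (he (y - s (p y))).1 (by rw [map_sub, hs', sub_self])
      exact ⟨(x, p y), by simp [hx]⟩⟩
    exact FFR.equiv (n := 0) ⟨inferInstance, inferInstance⟩ E
  | succ n ih =>
    intro X K Z _ _ _ _ _ _ f p hf he hp hX hZ
    obtain ⟨P, _, _, a, h1, h2, h3, h4⟩ := hX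
    obtain ⟨P', _, _, b, h1', h2', h3', h4'⟩ := hZ
    obtain ⟨s, hs⟩ := Module.projective_lifting_property p b hp
    have hs' : ∀ x, p (s x) = b x := fun x => LinearMap.congr_fun hs x
    let c : P × P' →ₗ[Q] K := (f ∘ₗ a).coprod s
    have hc : ∀ x y, c (x, y) = f (a x) + s y := fun x y => rfl
    have hpf : ∀ x, p (f x) = 0 := he.apply_apply_eq_zero
    refine ⟨P × P', _, _, c, inferInstance, inferInstance, ?_, ?_⟩
    · intro y
      obtain ⟨z, hz⟩ := h3' (p y)
      obtain ⟨x, hx⟩ := (he (y - s z)).1 (by rw [map_sub, hs', hz, sub_self])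
      obtain ⟨x, rfl⟩ := h3 x
      exact ⟨(x, z), by rw [hc, hx]; abel⟩
    · refine ih (f := LinearMap.codRestrict _ (LinearMap.inl Q P P' ∘ₗ (LinearMap.ker a).subtype) ?_)
        (p := LinearMap.codRestrict _ (LinearMap.snd Q P P' ∘ₗ (LinearMap.ker c).subtype) ?_) ?_ ?_ ?_ h4 h4'
      · rintro ⟨x, hx⟩
        rw [LinearMap.mem_ker] at hx ⊢
        show c (x, 0) = 0
        rw [hc, hx]; simp
      · rintro ⟨⟨x, y⟩, hx⟩
        rw [LinearMap.mem_ker] at hx ⊢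
        show b y = 0
        rw [← hs']
        have := congrArg p hx
        rwa [hc, map_add, hpf, zero_add, map_zero] at this
      · rintro ⟨x, hx⟩ ⟨y, hy⟩ h
        have h5 := (Prod.ext_iff.1 (congrArg Subtype.val h)).1
        exact Subtype.ext h5
      · rintro ⟨⟨x, y⟩, hx⟩
        constructor
        · intro h
          have h5 : y = 0 := congrArg Subtype.val h
          subst h5
          rw [LinearMap.mem_ker, hc, map_zero, add_zero] at hx
          exact ⟨⟨x, hf (hx.trans (map_zero f).symm)⟩, rfl⟩
        · rintro ⟨⟨z, hz⟩, h⟩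
          have h5 := (Prod.ext_iff.1 (congrArg Subtype.val h)).2
          exact Subtype.ext h5.symm
      · rintro ⟨y, hy⟩
        rw [LinearMap.mem_ker] at hy
        obtain ⟨x, hx⟩ := (he (s y)).1 (by rw [hs', hy])
        obtain ⟨x, rfl⟩ := h3 x
        refine ⟨⟨(-x, y), ?_⟩, rfl⟩
        rw [LinearMap.mem_ker, hc, map_neg, map_neg, hx]; simp

theorem FFR.coker {n : ℕ} {X K Z : Type u} [AddCommGroup X] [Module Q X] [AddCommGroup K] [Module Q K]
    [AddCommGroup Z] [Module Q Z] {f : X →ₗ[Q] K} {p : K →ₗ[Q] Z} (hf : Function.Injective f)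
    (he : Function.Exact f p) (hp : Function.Surjective p) (hX : FFR Q n X) (hK : FFR Q (n + 1) K) : FFR Q (n + 1) Z := by
  obtain ⟨P, _, _, a, h1, h2, h3, h4⟩ := hK
  refine ⟨P, _, _, p ∘ₗ a, h1, h2, hp.comp h3, ?_⟩
  have hX' := hX.equiv (kerEquiv hf he)
  refine FFR.ext (X := LinearMap.ker a) (Z := LinearMap.ker p) (f := Submodule.inclusion (LinearMap.ker_le_ker_comp a p))
    (p := a.restrict (p := LinearMap.ker (p ∘ₗ a)) (q := LinearMap.ker p) (fun x hx => hx)) ?_ ?_ ?_ h4 hX'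
  · exact Submodule.inclusion_injective _
  · rintro ⟨x, hx⟩
    constructor
    · intro h
      exact ⟨⟨x, congrArg Subtype.val h⟩, rfl⟩
    · rintro ⟨⟨y, hy⟩, h⟩
      have : y = x := congrArg Subtype.val h
      subst this
      exact Subtype.ext hy
  · rintro ⟨y, hy⟩
    obtain ⟨x, rfl⟩ := h3 y
    exact ⟨⟨x, hy⟩, rfl⟩

theorem FFR.kernel {n : ℕ} {X K Z : Type u} [AddCommGroup X] [Module Q X] [AddCommGroup K] [Module Q K]
    [AddCommGroup Z] [Module Q Z] {f : X →ₗ[Q] K} {p : K →ₗ[Q] Z} (hf : Function.Injective f)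
    (he : Function.Exact f p) (hp : Function.Surjective p) (hK : FFR Q n K) (hZ : FFR Q (n + 1) Z) : FFR Q n X := by
  suffices h : FFR Q n (LinearMap.ker p) from h.equiv (kerEquiv hf he).symm
  cases n with
  | zero =>
    haveI := hK.1
    haveI := hK.2
    exact hZ.cover p hp
  | succ n =>
    obtain ⟨P, _, _, a, h1, h2, h3, h4⟩ := hK
    have h5 := hZ.cover (p ∘ₗ a) (hp.comp h3)
    refine FFR.coker (X := LinearMap.ker a) (K := LinearMap.ker (p ∘ₗ a)) (f := Submodule.inclusion (LinearMap.ker_le_ker_comp a p))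
      (p := a.restrict (p := LinearMap.ker (p ∘ₗ a)) (q := LinearMap.ker p) (fun x hx => hx)) ?_ ?_ ?_ h4 h5
    · exact Submodule.inclusion_injective _
    · rintro ⟨x, hx⟩
      constructor
      · intro h
        exact ⟨⟨x, congrArg Subtype.val h⟩, rfl⟩
      · rintro ⟨⟨y, hy⟩, h⟩
        have : y = x := congrArg Subtype.val h
        subst this
        exact Subtype.ext hy
    · rintro ⟨y, hy⟩
      obtain ⟨x, rfl⟩ := h3 y
      exact ⟨⟨x, hy⟩, rfl⟩
end ffr
end CX
end Part13

section Part14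
open CategoryTheory Opposite Filter IsLocalRing ComplexityTest
namespace CX

section minres
variable {B : Type u} [CommRing B] [IsLocalRing B]

/-- A free cover whose kernel has entries in the maximal ideal. -/
theorem min_cover (X : Type u) [AddCommGroup X] [Module B X] [Module.Finite B X] :
    ∃ (b : ℕ) (f : (Fin b → B) →ₗ[B] X), Function.Surjective f ∧
      ∀ v, f v = 0 → ∀ i, v i ∈ maximalIdeal B := by
  classical
  have hex : ∃ b : ℕ, ∃ f : (Fin b → B) →ₗ[B] X, Function.Surjective f := Module.Finite.exists_fin' B X
  obtain ⟨f, hf⟩ := Nat.find_spec hex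
  have hmin : ∀ m, m < Nat.find hex → ¬ ∃ f : (Fin m → B) →ₗ[B] X, Function.Surjective f :=
    fun m hm => Nat.find_min hex hm
  generalize Nat.find hex = b at f hf hmin
  refine ⟨b, f, hf, ?_⟩
  intro v hv i
  by_contra hi
  rw [mem_maximalIdeal, mem_nonunits_iff, not_not] at hi
  obtain ⟨w, hw⟩ := hi.exists_left_inv
  cases b with
  | zero => exact i.elim0
  | succ m =>
    refine hmin m (Nat.lt_succ_self m) ⟨Fintype.linearCombination B (fun j => f (Pi.single (i.succAbove j) 1)), ?_⟩
    intro x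
    obtain ⟨y, hy⟩ := hf x
    set y' : Fin (m + 1) → B := y - (y i * w) • v with hy'
    have h1 : f y' = x := by rw [hy', map_sub, map_smul, hv, smul_zero, sub_zero, hy]
    have h2 : y' i = 0 := by
      simp only [hy', Pi.sub_apply, Pi.smul_apply, smul_eq_mul, mul_assoc, hw, mul_one, sub_self]
    refine ⟨fun j => y' (i.succAbove j), ?_⟩
    rw [Fintype.linearCombination_apply, ← h1]
    conv_rhs => rw [pi_eq_sum_univ' y', map_sum, Fin.sum_univ_succAbove _ i]
    rw [h2, zero_smul, map_zero, zero_add]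
    refine Finset.sum_congr rfl fun j _ => ?_
    rw [map_smul]

/-- States of the recursive construction of a minimal resolution. -/
structure MSt (B : Type u) [CommRing B] [IsLocalRing B]
    (𝒞 : ℕ → ∀ (X : Type u) [AddCommGroup X] [Module B X], Prop) (n : ℕ) where
  b : ℕ
  K : Submodule B (Fin b → B)
  hK : 𝒞 (n + 1) K
  hm : ∀ v ∈ K, ∀ i, v i ∈ maximalIdeal B

theorem exists_minres (𝒞 : ℕ → ∀ (X : Type u) [AddCommGroup X] [Module B X], Prop)
    (hfin : ∀ n (X : Type u) [AddCommGroup X] [Module B X], 𝒞 n X → Module.Finite B X)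
    (hker : ∀ n (X : Type u) [AddCommGroup X] [Module B X], 𝒞 n X → ∀ (b : ℕ) (f : (Fin b → B) →ₗ[B] X),
      Function.Surjective f → (∀ v, f v = 0 → ∀ i, v i ∈ maximalIdeal B) → 𝒞 (n + 1) (LinearMap.ker f))
    (X : Type u) [AddCommGroup X] [Module B X] (hX : 𝒞 0 X) :
    ∃ F : MinFreeRes B X, ∀ i, ∃ (Y : Type u) (_ : AddCommGroup Y) (_ : Module B Y) (f : (Fin (F.b i) → B) →ₗ[B] Y),
      𝒞 i Y ∧ Function.Surjective f ∧ ∀ v, f v = 0 → ∀ i, v i ∈ maximalIdeal B := by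
  have hstep : ∀ n (s : MSt B 𝒞 n), ∃ (s' : MSt B 𝒞 (n + 1)) (f : (Fin s'.b → B) →ₗ[B] s.K),
      Function.Surjective f ∧ LinearMap.ker f = s'.K := by
    intro n s
    haveI := hfin _ _ s.hK
    obtain ⟨b, f, hf, hm⟩ := min_cover (B := B) s.K
    exact ⟨⟨b, LinearMap.ker f, hker _ _ s.hK b f hf hm, fun v hv => hm v (LinearMap.mem_ker.1 hv)⟩, f, hf, rfl⟩
  choose nx nf hnf hnk using hstep
  haveI := hfin _ _ hX
  obtain ⟨b0, f0, hf0, hm0⟩ := min_cover (B := B) X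
  let s0 : MSt B 𝒞 0 := ⟨b0, LinearMap.ker f0, hker _ _ hX b0 f0 hf0 hm0, fun v hv => hm0 v (LinearMap.mem_ker.1 hv)⟩
  let s : (n : ℕ) → MSt B 𝒞 n := fun n => Nat.rec s0 (fun n s => nx n s) n
  have hs : ∀ n, s (n + 1) = nx n (s n) := fun n => rfl
  let d : (n : ℕ) → ((Fin (s (n + 1)).b → B) →ₗ[B] (Fin (s n).b → B)) := fun n =>
    (s n).K.subtype ∘ₗ nf n (s n)
  have hdr : ∀ n, LinearMap.range (d n) = (s n).K := by
    intro n
    rw [LinearMap.range_comp, LinearMap.range_eq_top.2 (hnf n (s n)), Submodule.map_top, Submodule.range_subtype]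
  have hdk : ∀ n, LinearMap.ker (d n) = (s (n + 1)).K := by
    intro n
    rw [LinearMap.ker_comp, Submodule.ker_subtype]
    exact hnk n (s n)
  refine ⟨⟨fun n => (s n).b, d, f0, hf0, ?_, ?_, ?_⟩, ?_⟩
  · rw [LinearMap.exact_iff, hdr]
    rfl
  · intro n
    rw [LinearMap.exact_iff, hdr, hdk]
  · intro n x i
    refine (s n).hm _ ?_ i
    rw [← hdr]
    exact ⟨x, rfl⟩
  · intro i
    cases i with
    | zero => exact ⟨X, _, _, f0, hX, hf0, hm0⟩
    | succ n =>
      refine ⟨(s n).K, _, _, nf n (s n), (s n).hK, hnf n (s n), ?_⟩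
      intro v hv
      refine (s (n + 1)).hm v ?_
      have : LinearMap.ker (nf n (s n)) = (s (n + 1)).K := hnk n (s n)
      rw [← this]
      exact LinearMap.mem_ker.2 hv

theorem exists_minres_noeth [IsNoetherianRing B] (X : Type u) [AddCommGroup X] [Module B X] [Module.Finite B X] :
    Nonempty (MinFreeRes B X) := by
  obtain ⟨F, -⟩ := exists_minres (B := B) (fun _ X _ _ => Module.Finite B X) (fun n X _ _ h => h)
    (fun n X _ _ h b f hf hm => inferInstance) X inferInstance
  exact ⟨F⟩

theorem min_ker_zero {X : Type u} [AddCommGroup X] [Module B X] [Module.Projective B X] {b : ℕ}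
    (f : (Fin b → B) →ₗ[B] X) (hf : Function.Surjective f) (hm : ∀ v, f v = 0 → ∀ i, v i ∈ maximalIdeal B) :
    Subsingleton (LinearMap.ker f) := by
  obtain ⟨s, hs⟩ := Module.projective_lifting_property f LinearMap.id hf
  have hs' : ∀ x, f (s x) = x := fun x => LinearMap.congr_fun hs x
  -- the projection to the kernel
  let p : (Fin b → B) →ₗ[B] LinearMap.ker f := LinearMap.codRestrict _ (LinearMap.id - s ∘ₗ f) (by
    intro x; rw [LinearMap.mem_ker]; simp [hs'])
  have hp : ∀ x : LinearMap.ker f, p x = x := by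
    intro x
    apply Subtype.ext
    have := LinearMap.mem_ker.1 x.2
    simp [p, this]
  have hps : Function.Surjective p := fun x => ⟨x, hp x⟩
  haveI : Module.Finite B (LinearMap.ker f) := Module.Finite.of_surjective p hps
  have htop : (⊤ : Submodule B (LinearMap.ker f)) ≤ maximalIdeal B • ⊤ := by
    intro x _
    have h1 : (x : Fin b → B) = ∑ i, (x : Fin b → B) i • (Pi.single i (1 : B) : Fin b → B) := by
      rw [← pi_eq_sum_univ']
    rw [← hp x, h1, map_sum]
    refine Submodule.sum_mem _ fun i _ => ?_
    rw [map_smul]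
    exact Submodule.smul_mem_smul (hm _ (LinearMap.mem_ker.1 x.2) i) trivial
  have := Submodule.eq_bot_of_le_smul_of_le_jacobson_bot (maximalIdeal B) (⊤ : Submodule B (LinearMap.ker f))
    Module.Finite.fg_top htop (maximalIdeal_le_jacobson _)
  exact (Submodule.subsingleton_iff B).1 (subsingleton_of_bot_eq_top this.symm)

theorem FFR.finProjDim {ℓ : ℕ} {X : Type u} [AddCommGroup X] [Module B X] (h : FFR B ℓ X) : HasFiniteProjDim B X := by
  have hker : ∀ n (X : Type u) [AddCommGroup X] [Module B X], (FFR B (ℓ - n) X ∧ (ℓ < n → Subsingleton X)) →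
      ∀ (b : ℕ) (f : (Fin b → B) →ₗ[B] X), Function.Surjective f → (∀ v, f v = 0 → ∀ i, v i ∈ maximalIdeal B) →
      (FFR B (ℓ - (n + 1)) (LinearMap.ker f) ∧ (ℓ < n + 1 → Subsingleton (LinearMap.ker f))) := by
    intro n X _ _ h b f hf hm
    rcases Nat.lt_or_ge n ℓ with hn | hn
    · refine ⟨?_, fun h => absurd h (by omega)⟩
      have h1 := h.1
      obtain ⟨m, hm'⟩ : ∃ m, ℓ - n = m + 1 := ⟨ℓ - n - 1, by omega⟩
      have hm2 : ℓ - (n + 1) = m := by omega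
      rw [hm'] at h1
      rw [hm2]
      exact h1.cover f hf
    · have h1 := h.1
      have h0 : ℓ - n = 0 := by omega
      rw [h0] at h1
      haveI := h1.2
      haveI := min_ker_zero f hf hm
      exact ⟨FFR.of_subsingleton _ _, fun _ => inferInstance⟩
  obtain ⟨F, hF⟩ := exists_minres (B := B) (fun i X _ _ => FFR B (ℓ - i) X ∧ (ℓ < i → Subsingleton X))
    (fun n X _ _ h => h.1.finite) hker X ⟨by simpa using h, fun h => absurd h (by omega)⟩
  · refine ⟨ℓ, F, ?_⟩
    intro i hi
    obtain ⟨Y, _, _, f, h1, h2, h3⟩ := hF i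
    haveI := h1.2 hi
    by_contra hb
    have : (1 : B) ∈ maximalIdeal B := h3 (fun _ => 1) (Subsingleton.elim _ _) ⟨0, Nat.pos_of_ne_zero hb⟩
    exact (Ideal.ne_top_iff_one _).1 (maximalIdeal.isMaximal B).ne_top this

theorem ffr_of_finProjDim {X : Type u} [AddCommGroup X] [Module B X] (h : HasFiniteProjDim B X) :
    ∃ n, FFR B n X := by
  obtain ⟨ℓ, F, hF⟩ := h
  have key : ∀ m n, ℓ ≤ n + m → FFR B m (LinearMap.ker (F.d n)) := by
    intro m
    induction m with
    | zero =>
      intro n hn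
      haveI : IsEmpty (Fin (F.b (n + 1))) := by rw [hF (n + 1) (by omega)]; infer_instance
      exact FFR.of_subsingleton _ _
    | succ m ih =>
      intro n hn
      have hr : ∀ x, F.d (n + 1) x ∈ LinearMap.ker (F.d n) := fun x =>
        LinearMap.mem_ker.2 ((F.exact_succ n (F.d (n + 1) x)).2 ⟨x, rfl⟩)
      have hk : LinearMap.ker ((F.d (n + 1)).codRestrict _ hr) = LinearMap.ker (F.d (n + 1)) :=
        LinearMap.ker_codRestrict _ _ _
      refine ⟨_, _, _, (F.d (n + 1)).codRestrict _ hr, inferInstance, inferInstance, ?_, ?_⟩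
      · rintro ⟨x, hx⟩
        obtain ⟨y, hy⟩ := (F.exact_succ n x).1 (LinearMap.mem_ker.1 hx)
        exact ⟨y, Subtype.ext hy⟩
      · exact (ih (n + 1) (by omega)).equiv (LinearEquiv.ofEq _ _ hk.symm)
  have h0 : FFR B (ℓ + 1) (LinearMap.ker F.aug) := by
    have hr : ∀ x, F.d 0 x ∈ LinearMap.ker F.aug := fun x =>
      LinearMap.mem_ker.2 ((F.exact_zero (F.d 0 x)).2 ⟨x, rfl⟩)
    have hk : LinearMap.ker ((F.d 0).codRestrict _ hr) = LinearMap.ker (F.d 0) :=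
      LinearMap.ker_codRestrict _ _ _
    refine ⟨_, _, _, (F.d 0).codRestrict _ hr, inferInstance, inferInstance, ?_, ?_⟩
    · rintro ⟨x, hx⟩
      obtain ⟨y, hy⟩ := (F.exact_zero x).1 (LinearMap.mem_ker.1 hx)
      exact ⟨y, Subtype.ext hy⟩
    · exact (key ℓ 0 (by omega)).equiv (LinearEquiv.ofEq _ _ hk.symm)
  exact ⟨ℓ + 2, _, _, _, F.aug, inferInstance, inferInstance, F.aug_surjective, h0⟩

end minres
end CX
end Part14

section Part15
open CategoryTheory Opposite Filter IsLocalRing ComplexityTest TensorProduct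
namespace CX

section koszulQuot
variable {Q : Type u} [CommRing Q]

theorem ffr_quot (x : ℕ → Q) (c : ℕ) (hx : Reg x c) : ∀ i ≤ c, FFR Q i (Q ⧸ II x i) := by
  intro i
  induction i with
  | zero =>
    intro _
    have h0 : II x 0 = ⊥ := by
      rw [eq_bot_iff]
      rintro _ ⟨y, rfl⟩
      simp
    have : FFR Q 0 Q := ⟨inferInstance, inferInstance⟩
    exact this.equiv (Submodule.quotEquivOfEqBot _ h0).symm
  | succ i ih =>
    intro hi
    have h1 := ih (by omega)
    have hle : II x i ≤ Submodule.comap (LinearMap.mulLeft Q (x i)) (II x i) := fun a ha => Ideal.mul_mem_left _ _ ha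
    refine FFR.coker (X := Q ⧸ II x i) (K := Q ⧸ II x i)
      (f := Submodule.mapQ (II x i) (II x i) (LinearMap.mulLeft Q (x i)) hle)
      (p := Submodule.factor (II_mono (Nat.le_succ i))) ?_ ?_ ?_ h1 h1.succ
    · rw [← LinearMap.ker_eq_bot, eq_bot_iff]
      intro a ha
      obtain ⟨a, rfl⟩ := Submodule.Quotient.mk_surjective _ a
      rw [LinearMap.mem_ker] at ha
      rw [Submodule.mem_bot]
      erw [Submodule.mapQ_apply] at ha
      rw [Submodule.Quotient.mk_eq_zero] at ha ⊢
      exact hx i (by omega) a ha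
    · intro a
      obtain ⟨a, rfl⟩ := Submodule.Quotient.mk_surjective _ a
      constructor
      · intro ha
        have ha' : (Submodule.Quotient.mk a : Q ⧸ II x (i + 1)) = 0 := ha
        rw [Submodule.Quotient.mk_eq_zero] at ha'
        obtain ⟨y, rfl⟩ := ha'
        refine ⟨Submodule.Quotient.mk (y i), ?_⟩
        erw [Submodule.mapQ_apply]
        rw [Submodule.Quotient.eq, Finset.sum_range_succ]
        simp only [LinearMap.mulLeft_apply]
        rw [sub_add_cancel_right]
        exact (II x i).neg_mem ⟨y, rfl⟩
      · rintro ⟨b, hb⟩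
        obtain ⟨b, rfl⟩ := Submodule.Quotient.mk_surjective _ b
        rw [← hb]
        show (Submodule.Quotient.mk (x i * b) : Q ⧸ II x (i + 1)) = 0
        rw [Submodule.Quotient.mk_eq_zero]
        exact mem_II_of_lt (Nat.lt_succ_self i) b
    · intro a
      obtain ⟨a, rfl⟩ := Submodule.Quotient.mk_surjective _ a
      exact ⟨Submodule.Quotient.mk a, rfl⟩
end koszulQuot

section TQs
variable {A : Type u} [CommRing A] [IsLocalRing A] (qd : QuasiDeformation A)

/-- the base change to `R`, as a `Q`-module -/
def TQ (X : Type u) [AddCommGroup X] [Module A X] : Type u := TensorProduct A qd.R X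

noncomputable instance (X : Type u) [AddCommGroup X] [Module A X] : AddCommGroup (TQ qd X) :=
  inferInstanceAs (AddCommGroup (TensorProduct A qd.R X))

noncomputable instance (X : Type u) [AddCommGroup X] [Module A X] : Module qd.Q (TQ qd X) :=
  letI : Module qd.Q (TensorProduct A qd.R X) := Module.compHom _ qd.g
  inferInstanceAs (Module qd.Q (TensorProduct A qd.R X))

variable {qd}

noncomputable def TQmap {X Y : Type u} [AddCommGroup X] [Module A X] [AddCommGroup Y] [Module A Y] (f : X →ₗ[A] Y) :
    TQ qd X →ₗ[qd.Q] TQ qd Y where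
  toFun := f.baseChange qd.R
  map_add' := fun a b => map_add (f.baseChange qd.R) a b
  map_smul' := fun c a => map_smul (f.baseChange qd.R) (qd.g c) (show TensorProduct A qd.R X from a)

theorem TQ_ses {X K Z : Type u} [AddCommGroup X] [Module A X] [AddCommGroup K] [Module A K]
    [AddCommGroup Z] [Module A Z] {f : X →ₗ[A] K} {p : K →ₗ[A] Z} (hf : Function.Injective f)
    (he : Function.Exact f p) (hp : Function.Surjective p) :
    Function.Injective (TQmap (qd := qd) f) ∧ Function.Exact (TQmap (qd := qd) f) (TQmap (qd := qd) p) ∧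
      Function.Surjective (TQmap (qd := qd) p) := by
  haveI := qd.faithfullyFlat
  haveI : Module.Flat A qd.R := inferInstance
  exact ⟨Module.Flat.lTensor_preserves_injective_linearMap f hf, lTensor_exact qd.R he hp,
    LinearMap.lTensor_surjective qd.R hp⟩

theorem TQ_self : FFR qd.Q qd.rs.length (TQ qd A) := by
  have h1 := ffr_quot _ _ (reg_ofList qd.rs qd.rs_regular.toIsWeaklyRegular) _ le_rfl
  rw [II_ofList qd.rs le_rfl, List.take_length] at h1
  let m : qd.Q →ₗ[qd.Q] TQ qd A := LinearMap.toSpanSingleton qd.Q (TQ qd A) ((1 : qd.R) ⊗ₜ[A] (1 : A))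
  have hm : ∀ q : qd.Q, m q = ((qd.g q) ⊗ₜ[A] (1 : A) : TensorProduct A qd.R A) := by
    intro q
    have : m q = (qd.g q) • ((1 : qd.R) ⊗ₜ[A] (1 : A) : TensorProduct A qd.R A) := rfl
    rw [this, TensorProduct.smul_tmul', smul_eq_mul, mul_one]
  have hr : ∀ q : qd.Q, TensorProduct.rid A qd.R (m q) = qd.g q := by
    intro q
    rw [hm]
    erw [TensorProduct.rid_tmul]
    rw [one_smul]
  have hs : Function.Surjective m := by
    intro y
    obtain ⟨q, hq⟩ := qd.g_surjective (TensorProduct.rid A qd.R y)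
    refine ⟨q, ?_⟩
    apply (TensorProduct.rid A qd.R).injective
    rw [← hq]
    exact hr q
  have hk : LinearMap.ker m = Ideal.ofList qd.rs := by
    have h2 : Ideal.ofList qd.rs = RingHom.ker qd.g := qd.ker_g.symm
    rw [h2]
    ext q
    rw [LinearMap.mem_ker, RingHom.mem_ker, ← hr]
    exact (LinearEquiv.map_eq_zero_iff (TensorProduct.rid A qd.R)).symm
  exact h1.equiv ((Submodule.quotEquivOfEq _ _ hk.symm).trans (m.quotKerEquivOfSurjective hs))

theorem TQ_free (b : ℕ) : FFR qd.Q qd.rs.length (TQ qd (Fin b → A)) := by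
  induction b with
  | zero =>
    haveI : Subsingleton (TQ qd (Fin 0 → A)) :=
      inferInstanceAs (Subsingleton (TensorProduct A qd.R (Fin 0 → A)))
    exact FFR.of_subsingleton _ _
  | succ b ih =>
    have h := TQ_ses (qd := qd) (X := A) (K := Fin (b + 1) → A) (Z := Fin b → A)
      (f := LinearMap.single A (fun _ => A) 0) (p := LinearMap.funLeft A A Fin.succ) ?_ ?_ ?_
    · exact FFR.ext h.1 h.2.1 h.2.2 TQ_self ih
    · exact Pi.single_injective (M := fun _ : Fin (b + 1) => A) 0
    · intro v
      constructor
      · intro hv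
        refine ⟨v 0, ?_⟩
        ext i
        refine Fin.cases ?_ (fun j => ?_) i
        · simp
        · have := congrFun hv j
          simp [LinearMap.funLeft] at this
          simp [this]
      · rintro ⟨a, rfl⟩
        ext i
        simp [LinearMap.funLeft]
    · exact LinearMap.funLeft_surjective_of_injective _ _ _ (Fin.succ_injective _)

/-- the base changes of syzygies have finite projective dimension over `Q` -/
theorem TQ_syz {X : Type u} [AddCommGroup X] [Module A X] (F : MinFreeRes A X)
    (h : HasFiniteProjDim qd.Q (TQ qd X)) (p : ℕ) :
    ∃ n, FFR qd.Q n (TQ qd (LinearMap.range (F.d p))) := by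
  induction p with
  | zero =>
    obtain ⟨n, hn⟩ := ffr_of_finProjDim h
    have hs := TQ_ses (qd := qd) (f := (LinearMap.range (F.d 0)).subtype) (p := F.aug)
      (Submodule.subtype_injective _) (by
        rw [LinearMap.exact_iff, Submodule.range_subtype, ← LinearMap.exact_iff]; exact F.exact_zero) F.aug_surjective
    exact ⟨n + qd.rs.length, FFR.kernel hs.1 hs.2.1 hs.2.2 ((TQ_free (F.b 0)).mono (by omega)) (hn.mono (by omega))⟩
  | succ p ih =>
    obtain ⟨n, hn⟩ := ih
    have hs := TQ_ses (qd := qd) (f := (LinearMap.range (F.d (p + 1))).subtype) (p := (F.d p).rangeRestrict)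
      (Submodule.subtype_injective _) (by
        rw [LinearMap.exact_iff, Submodule.range_subtype, LinearMap.ker_rangeRestrict, ← LinearMap.exact_iff]
        exact F.exact_succ p) (LinearMap.surjective_rangeRestrict _)
    exact ⟨n + qd.rs.length, FFR.kernel hs.1 hs.2.1 hs.2.2 ((TQ_free (F.b (p + 1))).mono (by omega)) (hn.mono (by omega))⟩

theorem TQ_ext {X K : Type u} [AddCommGroup X] [Module A X] [AddCommGroup K] [Module A K] (F : MinFreeRes A X)
    (h : HasFiniteProjDim qd.Q (TQ qd X)) (q : ℕ) {f : X →ₗ[A] K} {p : K →ₗ[A] LinearMap.range (F.d q)}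
    (hf : Function.Injective f) (he : Function.Exact f p) (hp : Function.Surjective p) :
    HasFiniteProjDim qd.Q (TQ qd K) := by
  obtain ⟨n, hn⟩ := ffr_of_finProjDim h
  obtain ⟨m, hm⟩ := TQ_syz F h q
  have hs := TQ_ses (qd := qd) hf he hp
  exact (FFR.ext hs.1 hs.2.1 hs.2.2 (hn.mono (Nat.le_add_right n m)) (hm.mono (Nat.le_add_left m n))).finProjDim

end TQs
end CX
end Part15

section Part16
open CategoryTheory Opposite Filter IsLocalRing ComplexityTest
namespace CX

section cone
variable {B : Type u} [CommRing B] {J J2 : Type} {X Z : Type u} [AddCommGroup X] [Module B X] [AddCommGroup Z]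
  [Module B Z] {deg : J → ℕ} {deg2 : J2 → ℕ} {d : (J →₀ B) →ₗ[B] (J →₀ B)} {d2 : (J2 →₀ B) →ₗ[B] (J2 →₀ B)}
  {aug : (J →₀ B) →ₗ[B] X} {aug2 : (J2 →₀ B) →ₗ[B] Z} {η : (J2 →₀ B) →ₗ[B] (J →₀ B)}

/-- relations defining the cone module -/
noncomputable def WW (deg2 : J2 → ℕ) (d2 : (J2 →₀ B) →ₗ[B] (J2 →₀ B)) (aug : (J →₀ B) →ₗ[B] X)
    (η : (J2 →₀ B) →ₗ[B] (J →₀ B)) : Submodule B (X × (J2 →₀ B)) :=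
  LinearMap.range (((aug ∘ₗ η).prod (-d2)).coprod ((0 : (J2 →₀ B) →ₗ[B] X).prod (LinearMap.id - pr B deg2 0)))

theorem mem_WW {x : X} {y : J2 →₀ B} : (x, y) ∈ WW deg2 d2 aug η ↔
    ∃ c p, x = aug (η c) ∧ y = -d2 c + (p - pr B deg2 0 p) := by
  constructor
  · rintro ⟨⟨c, p⟩, h⟩
    refine ⟨c, p, ?_, ?_⟩
    · have := congrArg Prod.fst h
      simpa using this.symm
    · have := congrArg Prod.snd h
      simpa using this.symm
  · rintro ⟨c, p, rfl, rfl⟩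
    exact ⟨(c, p), by simp⟩

theorem pr_pr (p : J2 →₀ B) : pr B deg2 0 (p - pr B deg2 0 p) = 0 := by
  rw [map_sub, pr_of_mem (pr_mem 0 p), sub_self]

theorem cone_aux (h : IsRes deg d aug) (h2 : IsRes deg2 d2 aug2) (hη : IsDeg deg2 deg 0 1 η)
    (hc : d ∘ₗ η = η ∘ₗ d2) (c : J2 →₀ B) (h0 : pr B deg2 0 (d2 c) = 0) : aug (η c) = 0 := by
  have h1 : d2 (pr B deg2 1 c) = 0 := by rw [h2.hd.pr_comm (m := 0) (by omega), h0]
  obtain ⟨w, hw, hw'⟩ := h2.acy 0 _ (pr_mem 1 c) h1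
  have h3 : aug (η c) = aug (η (pr B deg2 1 c)) := by
    rw [hη.pr_comm (m := 0) (by omega)]
    have := LinearMap.congr_fun (Ch_pr_eq h.haug) (η c)
    rw [← this]; rfl
  have h4 : d (η w) = η (d2 w) := LinearMap.congr_fun hc w
  rw [h3, ← hw', ← h4]
  exact LinearMap.congr_fun h.augd (η w)

/-- the cone module -/
abbrev KK (deg2 : J2 → ℕ) (d2 : (J2 →₀ B) →ₗ[B] (J2 →₀ B)) (aug : (J →₀ B) →ₗ[B] X)
    (η : (J2 →₀ B) →ₗ[B] (J →₀ B)) : Type u := (X × (J2 →₀ B)) ⧸ WW deg2 d2 aug η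

theorem KK_ses (h : IsRes deg d aug) (h2 : IsRes deg2 d2 aug2) (hη : IsDeg deg2 deg 0 1 η)
    (hc : d ∘ₗ η = η ∘ₗ d2) : ∃ (f : X →ₗ[B] KK deg2 d2 aug η) (p : KK deg2 d2 aug η →ₗ[B] Z),
    Function.Injective f ∧ Function.Exact f p ∧ Function.Surjective p := by
  have ha : ∀ y, aug2 (y - pr B deg2 0 y) = 0 := by
    intro y
    rw [map_sub, sub_eq_zero]
    exact (LinearMap.congr_fun (Ch_pr_eq h2.haug) y).symm
  have hle : WW deg2 d2 aug η ≤ LinearMap.ker (aug2 ∘ₗ LinearMap.snd B X (J2 →₀ B)) := by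
    rintro ⟨x, y⟩ hxy
    obtain ⟨c, p, h3, h4⟩ := mem_WW.1 hxy
    rw [LinearMap.mem_ker, LinearMap.comp_apply, LinearMap.snd_apply, h4, map_add, ha, map_neg]
    have : aug2 (d2 c) = 0 := LinearMap.congr_fun h2.augd c
    rw [this]; simp
  refine ⟨(WW deg2 d2 aug η).mkQ ∘ₗ LinearMap.inl B X (J2 →₀ B),
    (WW deg2 d2 aug η).liftQ (aug2 ∘ₗ LinearMap.snd B X (J2 →₀ B)) hle, ?_, ?_, ?_⟩
  · rw [← LinearMap.ker_eq_bot, eq_bot_iff]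
    intro x hx
    rw [LinearMap.mem_ker, LinearMap.comp_apply, Submodule.mkQ_apply, Submodule.Quotient.mk_eq_zero] at hx
    have hx' : (x, (0 : J2 →₀ B)) ∈ WW deg2 d2 aug η := hx
    obtain ⟨c, p, h3, h4⟩ := mem_WW.1 hx'
    rw [Submodule.mem_bot, h3]
    refine cone_aux h h2 hη hc c ?_
    have h5 : d2 c = p - pr B deg2 0 p := by
      have := h4.symm
      rwa [neg_add_eq_zero] at this
    rw [h5, pr_pr]
  · intro k
    obtain ⟨⟨x, y⟩, rfl⟩ := Submodule.Quotient.mk_surjective _ k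
    constructor
    · intro hk
      have hk' : aug2 y = 0 := hk
      have h3 : aug2 (pr B deg2 0 y) = 0 := by
        rw [← hk']; exact LinearMap.congr_fun (Ch_pr_eq h2.haug) y
      obtain ⟨w, hw, hw'⟩ := h2.exact0 (pr_mem 0 y) h3
      refine ⟨x + aug (η w), ?_⟩
      rw [LinearMap.comp_apply, Submodule.mkQ_apply, Submodule.Quotient.eq]
      show (x + aug (η w) - x, 0 - y) ∈ _
      rw [mem_WW]
      refine ⟨w, -y, by abel, ?_⟩
      rw [hw', map_neg]; abel
    · rintro ⟨x', hx'⟩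
      rw [← hx']
      show aug2 0 = 0
      exact map_zero _
  · intro z
    obtain ⟨y, hy⟩ := h2.surj z
    exact ⟨Submodule.Quotient.mk (0, y), hy⟩

/-- augmentation of the cone -/
noncomputable def augC (deg2 : J2 → ℕ) (d2 : (J2 →₀ B) →ₗ[B] (J2 →₀ B)) (aug : (J →₀ B) →ₗ[B] X)
    (η : (J2 →₀ B) →ₗ[B] (J →₀ B)) : (J ⊕ J2 →₀ B) →ₗ[B] KK deg2 d2 aug η :=
  (WW deg2 d2 aug η).mkQ ∘ₗ (aug ∘ₗ pl B J J2).prod (pR B J J2)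

theorem augC_zero {v : J ⊕ J2 →₀ B} : augC deg2 d2 aug η v = 0 ↔
    ∃ c p, aug (pl B J J2 v) = aug (η c) ∧ pR B J J2 v = -d2 c + (p - pr B deg2 0 p) := by
  rw [← mem_WW, augC, LinearMap.comp_apply, Submodule.mkQ_apply, Submodule.Quotient.mk_eq_zero]
  rfl

theorem cone_isRes (h : IsRes deg d aug) (h2 : IsRes deg2 d2 aug2) (hη : IsDeg deg2 deg 0 1 η)
    (hc : d ∘ₗ η = η ∘ₗ d2) :
    IsRes (Sum.elim deg deg2) (blk d η 0 (-d2)) (augC deg2 d2 aug η) := by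
  have hdd : ∀ v, d (d v) = 0 := fun v => LinearMap.congr_fun h.dd v
  have hdd2 : ∀ v, d2 (d2 v) = 0 := fun v => LinearMap.congr_fun h2.dd v
  have hc' : ∀ v, d (η v) = η (d2 v) := fun v => LinearMap.congr_fun hc v
  have had : ∀ v, aug (d v) = 0 := fun v => LinearMap.congr_fun h.augd v
  refine ⟨?_, ?_, ?_, ?_, ?_, ?_, ?_⟩
  · intro n
    have : {j | Sum.elim deg deg2 j = n} = Sum.inl '' {j | deg j = n} ∪ Sum.inr '' {j | deg2 j = n} := by
      ext (j | j) <;> simp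
    rw [this]
    exact ((h.fin n).image _).union ((h2.fin n).image _)
  · exact isDeg_blk _ _ _ _ h.hd hη IsDeg.zero h2.hd.neg
  · rintro (j | j) hj
    · rw [augC_zero]
      refine ⟨0, 0, ?_, by simp⟩
      rw [pl_e_inl, h.haug j hj]; simp
    · rw [augC_zero]
      refine ⟨0, e B j, by simp, ?_⟩
      have hj' : deg2 j ≠ 0 := hj
      rw [pR_e_inr, pr_e, if_neg hj']; simp
  · apply LinearMap.ext; intro v
    apply blk_ext
    · simp [hdd, hc']
    · simp [hdd2]
  · apply LinearMap.ext; intro v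
    rw [LinearMap.comp_apply, LinearMap.zero_apply, augC_zero]
    refine ⟨pR B J J2 v, 0, ?_, ?_⟩
    · rw [pl_blk, map_add, had, zero_add]
    · simp
  · intro k
    obtain ⟨⟨x, y⟩, rfl⟩ := Submodule.Quotient.mk_surjective _ k
    obtain ⟨a, ha⟩ := h.surj x
    refine ⟨il B J J2 a + ir B J J2 y, ?_⟩
    have h3 : pl B J J2 (il B J J2 a + ir B J J2 y) = a := by simp
    have h4 : pR B J J2 (il B J J2 a + ir B J J2 y) = y := by simp
    show Submodule.Quotient.mk (aug (pl B J J2 (il B J J2 a + ir B J J2 y)), pR B J J2 (il B J J2 a + ir B J J2 y)) = _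
    rw [h3, h4, ha]
  · intro v hv1 hv2
    have ha : d (pl B J J2 v) + η (pR B J J2 v) = 0 := by
      have := congrArg (pl B J J2) hv1
      simpa using this
    have hb : d2 (pR B J J2 v) = 0 := by
      have := congrArg (pR B J J2) hv1
      simpa using this
    obtain ⟨c, p, h3, h4⟩ := augC_zero.1 hv2
    have h5 : aug2 (pR B J J2 v) = 0 := by
      rw [h4, map_add, map_neg, map_sub]
      have e1 : aug2 (d2 c) = 0 := LinearMap.congr_fun h2.augd c
      have e2 : aug2 (pr B deg2 0 p) = aug2 p := LinearMap.congr_fun (Ch_pr_eq h2.haug) p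
      rw [e1, e2]; simp
    obtain ⟨b, hb'⟩ := h2.exact _ hb h5
    have h6 : aug (η (b + c)) = 0 := by
      refine cone_aux h h2 hη hc _ ?_
      have : d2 (b + c) = p - pr B deg2 0 p := by
        rw [map_add, hb', h4]; abel
      rw [this, pr_pr]
    obtain ⟨a, ha'⟩ := h.exact (pl B J J2 v + η b) (by rw [map_add, hc', hb', ha])
      (by rw [map_add, h3, ← map_add, ← map_add, add_comm c b, h6])
    refine ⟨il B J J2 a + ir B J J2 (-b), ?_⟩
    apply blk_ext
    · simp [ha']
    · simp [hb']

theorem KK_finite (h : IsRes deg d aug) (h2 : IsRes deg2 d2 aug2) (hη : IsDeg deg2 deg 0 1 η)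
    (hc : d ∘ₗ η = η ∘ₗ d2) : Module.Finite B (KK deg2 d2 aug η) := by
  have hC := cone_isRes h h2 hη hc
  haveI : Finite {j // Sum.elim deg deg2 j = 0} := hC.fin 0
  have hs : Function.Surjective (augC deg2 d2 aug η ∘ₗ
      (mkOp (B := B) fun j : {j // Sum.elim deg deg2 j = 0} => e B j.1)) := by
    rw [← LinearMap.range_eq_top, eq_top_iff]
    intro k _
    obtain ⟨v, hv, rfl⟩ := hC.surj0 k
    refine Hg_map (fun j hj => ?_) hv
    refine ⟨e B ⟨j, hj⟩, ?_⟩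
    rw [LinearMap.comp_apply, mkOp_e]
  exact Module.Finite.of_surjective _ hs
end cone
end CX
end Part16

section Part17
open CategoryTheory Opposite Filter IsLocalRing ComplexityTest
namespace CX

section shift
variable {B : Type u} [CommRing B] [IsLocalRing B] {X : Type u} [AddCommGroup X] [Module B X] (F : MinFreeRes B X)

/-- the shifted minimal resolution of a syzygy -/
noncomputable def shiftRes (p : ℕ) : MinFreeRes B (LinearMap.range (F.d p)) where
  b n := F.b (p + 1 + n)
  d n := F.d (p + 1 + n)
  aug := (F.d p).rangeRestrict
  aug_surjective := LinearMap.surjective_rangeRestrict _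
  exact_zero := by
    rw [LinearMap.exact_iff, LinearMap.ker_rangeRestrict, ← LinearMap.exact_iff]
    exact F.exact_succ p
  exact_succ n := F.exact_succ (p + 1 + n)
  minimal n := F.minimal (p + 1 + n)

def shEmb (p : ℕ) : TJ (shiftRes F p) → TJ F := fun j => ⟨p + 1 + j.1, j.2⟩

theorem shEmb_inj (p : ℕ) : Function.Injective (shEmb F p) := by
  rintro ⟨n, i⟩ ⟨m, i'⟩ h
  have h1 : p + 1 + n = p + 1 + m := congrArg Sigma.fst h
  have : n = m := by omega
  subst this
  have h2 : HEq i i' := (Sigma.mk.inj_iff.1 (show (⟨p + 1 + n, i⟩ : TJ F) = ⟨p + 1 + n, i'⟩ from h)).2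
  rw [eq_of_heq h2]

noncomputable def sg (p : ℕ) : (TJ (shiftRes F p) →₀ B) →ₗ[B] (TJ F →₀ B) := mkOp fun j => e B (shEmb F p j)

noncomputable def tau (p : ℕ) : (TJ F →₀ B) →ₗ[B] (TJ (shiftRes F p) →₀ B) :=
  Finsupp.lcomapDomain (shEmb F p) (shEmb_inj F p)

theorem tau_apply (p : ℕ) (v : TJ F →₀ B) (j) : tau F p v j = v (shEmb F p j) := rfl

theorem tau_sg (p : ℕ) (v) : tau F p (sg F p v) = v := by
  classical
  suffices h : tau F p ∘ₗ sg F p = LinearMap.id from LinearMap.congr_fun h v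
  apply op_ext; intro j
  ext l
  rw [LinearMap.comp_apply, tau_apply, sg, mkOp_e, LinearMap.id_apply, Finsupp.single_apply, Finsupp.single_apply]
  simp only [(shEmb_inj F p).eq_iff]

theorem sg_isDeg (p : ℕ) : IsDeg (tdeg (shiftRes F p)) (tdeg F) (p + 1) 0 (sg F p) := by
  intro j l hl
  rw [sg, mkOp_e] at hl
  have := e_mem_Hg (B := B) (deg := tdeg F) (j := shEmb F p j) rfl l hl
  rw [this]
  show p + 1 + j.1 + 0 = j.1 + (p + 1)
  omega

theorem tau_isDeg (p : ℕ) : IsDeg (tdeg F) (tdeg (shiftRes F p)) 0 (p + 1) (tau F p) := by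
  intro j l hl
  rw [tau_apply] at hl
  have := e_mem_Hg (B := B) (deg := tdeg F) (j := j) rfl _ hl
  have h2 : tdeg F (shEmb F p l) = p + 1 + tdeg (shiftRes F p) l := rfl
  omega

theorem tau_td (p : ℕ) : tau F p ∘ₗ td F = td (shiftRes F p) ∘ₗ tau F p := by
  apply LinearMap.ext; intro v
  apply t_ext; intro n
  rw [LinearMap.comp_apply, LinearMap.comp_apply, tres_td]
  have h1 : ∀ n w, tres (shiftRes F p) n (tau F p w) = tres F (p + 1 + n) w := fun n w => rfl
  rw [h1, h1, tres_td]
  rfl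

theorem sg_temb (p n : ℕ) (v) : sg F p (temb (shiftRes F p) n v) = temb F (p + 1 + n) v := by
  refine Eq.trans ?_ (temb_apply F (p + 1 + n) v).symm
  rw [temb_apply, map_sum]
  refine Finset.sum_congr rfl fun i _ => ?_
  rw [map_smul, sg, mkOp_e]
  rfl

theorem sg_td (p : ℕ) (j) (hj : 1 ≤ tdeg (shiftRes F p) j) :
    td F (sg F p (e B j)) = sg F p (td (shiftRes F p) (e B j)) := by
  rcases j with ⟨n, i⟩
  cases n with
  | zero => simp [tdeg] at hj
  | succ n =>
    rw [← temb_single, td_succ, sg_temb, sg_temb]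
    exact td_succ F (p + 1 + n) _

theorem eta2_isDeg {p : ℕ} {η : (TJ F →₀ B) →ₗ[B] (TJ F →₀ B)} (hη : IsDeg (tdeg F) (tdeg F) 0 (p + 2) η) :
    IsDeg (tdeg (shiftRes F p)) (tdeg F) 0 1 (η ∘ₗ sg F p) :=
  (hη.comp (sg_isDeg F p)).cast (by omega)

theorem eta2_chain {p : ℕ} {η : (TJ F →₀ B) →ₗ[B] (TJ F →₀ B)} (hη : IsDeg (tdeg F) (tdeg F) 0 (p + 2) η)
    (hc : td F ∘ₗ η = η ∘ₗ td F) : td F ∘ₗ (η ∘ₗ sg F p) = (η ∘ₗ sg F p) ∘ₗ td (shiftRes F p) := by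
  apply op_ext; intro j
  simp only [LinearMap.comp_apply]
  have h1 : td F (η (sg F p (e B j))) = η (td F (sg F p (e B j))) := LinearMap.congr_fun hc _
  rw [h1]
  by_cases hj : 1 ≤ tdeg (shiftRes F p) j
  · rw [sg_td F p j hj]
  · have hj0 : tdeg (shiftRes F p) j = 0 := by omega
    rw [(td_isDeg (shiftRes F p)).e_zero (by omega), map_zero, map_zero]
    have h2 : sg F p (e B j) ∈ Hg B (tdeg F) (p + 1) := (sg_isDeg F p).e_mem (by omega)
    have h3 : td F (sg F p (e B j)) ∈ Hg B (tdeg F) p := (td_isDeg F).mem (by omega) h2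
    exact hη.eq_zero (by omega) h3

theorem exists_shEmb (p : ℕ) (j : TJ F) (hj : p + 1 ≤ tdeg F j) : ∃ l, shEmb F p l = j := by
  rcases j with ⟨n, i⟩
  obtain ⟨m, rfl⟩ := Nat.exists_eq_add_of_le (show p + 1 ≤ n from hj)
  exact ⟨⟨m, i⟩, rfl⟩

theorem eta2_inj {k : Type*} [CommRing k] (π : B →+* k) {p : ℕ} {η : (TJ F →₀ B) →ₗ[B] (TJ F →₀ B)}
    (hη : IsDeg (tdeg F) (tdeg F) 0 (p + 2) η) {n : ℕ}
    (hinj : ∀ u ∈ Ch k (tdeg F) k n, u ∘ₗ bc π η = 0 → u = 0) :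
    ∀ u ∈ Ch k (tdeg F) k n, u ∘ₗ bc π (η ∘ₗ sg F p) = 0 → u = 0 := by
  intro u hu h0
  refine hinj u hu ?_
  have h1 : u ∘ₗ bc π η ∈ Ch k (tdeg F) k (n + (p + 2)) := (bc_isDeg π hη).ch (by omega) hu
  refine Ch_eq h1 (Submodule.zero_mem _) fun j hj => ?_
  obtain ⟨l, rfl⟩ := exists_shEmb F p j (by omega)
  have h2 := LinearMap.congr_fun h0 (e k l)
  rw [bc_comp] at h2
  have h3 : bc π (sg F p) (e k l) = e k (shEmb F p l) := by
    rw [bc_e, sg, mkOp_e, mr_e]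
  rw [LinearMap.comp_apply, LinearMap.comp_apply, h3] at h2
  exact h2

end shift

section ev
variable {B : Type*} [CommRing B] {J J' : Type*}

/-- vanishing of the cohomology of the dual complex in degree `i+1` -/
def EV (deg : J → ℕ) (d : (J →₀ B) →ₗ[B] (J →₀ B)) (N : Type*) [AddCommGroup N] [Module B N] (i : ℕ) : Prop :=
  ∀ u ∈ Ch B deg N (i + 1), u ∘ₗ d = 0 → ∃ w ∈ Ch B deg N i, w ∘ₗ d = u

variable {X : Type*} [AddCommGroup X] [Module B X] {N : Type*} [AddCommGroup N] [Module B N]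
  {deg : J → ℕ} {deg' : J' → ℕ} {d : (J →₀ B) →ₗ[B] (J →₀ B)} {d' : (J' →₀ B) →ₗ[B] (J' →₀ B)}

theorem EV_transfer {aug : (J →₀ B) →ₗ[B] X} {aug' : (J' →₀ B) →ₗ[B] X} (h : IsRes deg d aug)
    (h' : IsRes deg' d' aug') {i : ℕ} (hE : EV deg d N i) : EV deg' d' N i := by
  obtain ⟨φ, hφ1, hφ2, hφ3⟩ := h.lift h' LinearMap.id
  obtain ⟨ψ, hψ1, hψ2, hψ3⟩ := h'.lift h LinearMap.id
  have hψ2' : ∀ v, d (ψ v) = ψ (d' v) := fun v => LinearMap.congr_fun hψ2 v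
  have hφ2' : ∀ v, d' (φ v) = φ (d v) := fun v => LinearMap.congr_fun hφ2 v
  have hψ3' : ∀ v, aug (ψ v) = aug' v := fun v => LinearMap.congr_fun hψ3 v
  have hφ3' : ∀ v, aug' (φ v) = aug v := fun v => LinearMap.congr_fun hφ3 v
  obtain ⟨s, hs1, hs2⟩ := h'.homotopy h' (LinearMap.id - φ ∘ₗ ψ) (IsDeg.id.sub (hφ1.comp hψ1))
    (by apply LinearMap.ext; intro z; simp [hφ2', hψ2']) (by apply LinearMap.ext; intro z; simp [hφ3', hψ3'])
  have hs2' : ∀ v, v - φ (ψ v) = d' (s v) + s (d' v) := fun v => LinearMap.congr_fun hs2 v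
  intro u hu hud
  have hud' : ∀ v, u (d' v) = 0 := fun v => LinearMap.congr_fun hud v
  obtain ⟨w, hw, hwd⟩ := hE (u ∘ₗ φ) (hφ1.ch (by omega) hu) (by
    apply LinearMap.ext; intro z
    simp only [LinearMap.comp_apply, ← hφ2', hud']; rfl)
  have hwd' : ∀ v, w (d v) = u (φ v) := fun v => LinearMap.congr_fun hwd v
  refine ⟨w ∘ₗ ψ + u ∘ₗ s, Submodule.add_mem _ (hψ1.ch (by omega) hw) (hs1.ch (by omega) hu), ?_⟩
  apply LinearMap.ext; intro z
  simp only [LinearMap.comp_apply, LinearMap.add_apply]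
  rw [← hψ2', hwd']
  have h1 := congrArg u (hs2' z)
  rw [map_sub, map_add, hud', zero_add] at h1
  rw [← h1]; abel

theorem EV_cone {d2 : (J' →₀ B) →ₗ[B] (J' →₀ B)} {η : (J' →₀ B) →ₗ[B] (J →₀ B)} (hη : IsDeg deg' deg 0 1 η)
    (hc : d ∘ₗ η = η ∘ₗ d2) {i : ℕ} (h1 : EV deg d N i) (h2 : EV deg' d2 N i) :
    EV (Sum.elim deg deg') (blk d η 0 (-d2)) N i := by
  intro u hu hud
  have hc' : ∀ v, d (η v) = η (d2 v) := fun v => LinearMap.congr_fun hc v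
  have hu1 : u ∘ₗ il B J J' ∈ Ch B deg N (i + 1) := by
    intro j hj
    rw [LinearMap.comp_apply, il_e]
    exact hu _ hj
  have hu2 : u ∘ₗ ir B J J' ∈ Ch B deg' N (i + 1) := by
    intro j hj
    rw [LinearMap.comp_apply, ir_e]
    exact hu _ hj
  have huu : ∀ v, u v = u (il B J J' (pl B J J' v)) + u (ir B J J' (pR B J J' v)) := by
    intro v
    rw [← map_add, ilpl_add]
  have hD : ∀ v, u (il B J J' (d (pl B J J' v) + η (pR B J J' v))) - u (ir B J J' (d2 (pR B J J' v))) = 0 := by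
    intro v
    have h3 := LinearMap.congr_fun hud v
    rw [LinearMap.comp_apply, huu, pl_blk, pR_blk] at h3
    simpa [sub_eq_add_neg] using h3
  have hD1 : ∀ a, u (il B J J' (d a)) = 0 := by
    intro a
    have := hD (il B J J' a)
    simpa using this
  have hD2 : ∀ b, u (il B J J' (η b)) = u (ir B J J' (d2 b)) := by
    intro b
    have := hD (ir B J J' b)
    simpa [sub_eq_zero] using this
  obtain ⟨w1, hw1, hw1d⟩ := h1 _ hu1 (by
    apply LinearMap.ext; intro z
    exact hD1 z)
  have hw1d' : ∀ v, w1 (d v) = u (il B J J' v) := fun v => LinearMap.congr_fun hw1d v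
  obtain ⟨w2, hw2, hw2d⟩ := h2 (u ∘ₗ ir B J J' - w1 ∘ₗ η) (Submodule.sub_mem _ hu2 (hη.ch (by omega) hw1)) (by
    apply LinearMap.ext; intro z
    simp only [LinearMap.comp_apply, LinearMap.sub_apply, ← hc', hw1d', hD2, sub_self]; rfl)
  have hw2d' : ∀ v, w2 (d2 v) = u (ir B J J' v) - w1 (η v) := fun v => LinearMap.congr_fun hw2d v
  refine ⟨w1 ∘ₗ pl B J J' - w2 ∘ₗ pR B J J', ?_, ?_⟩
  · rintro (j | j) hj
    · have hj' : deg j ≠ i := hj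
      simp [hw1 j hj']
    · have hj' : deg' j ≠ i := hj
      simp [hw2 j hj']
  · apply LinearMap.ext; intro z
    rw [huu z]
    simp only [LinearMap.comp_apply, LinearMap.sub_apply, pl_blk, pR_blk, map_add, LinearMap.zero_apply, LinearMap.neg_apply,
      map_neg, hw1d', hw2d', zero_add]
    abel
end ev

section evshift
variable {B : Type u} [CommRing B] [IsLocalRing B] {X : Type u} [AddCommGroup X] [Module B X] (F : MinFreeRes B X)
  {N : Type*} [AddCommGroup N] [Module B N]

theorem EV_shift {p i : ℕ} (h : EV (tdeg F) (td F) N (i + (p + 1))) :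
    EV (tdeg (shiftRes F p)) (td (shiftRes F p)) N i := by
  intro u hu hud
  have hud' : ∀ v, u (td (shiftRes F p) v) = 0 := fun v => LinearMap.congr_fun hud v
  have ht : ∀ v, tau F p (td F v) = td (shiftRes F p) (tau F p v) := fun v => LinearMap.congr_fun (tau_td F p) v
  obtain ⟨w, hw, hwd⟩ := h (u ∘ₗ tau F p) ((tau_isDeg F p).ch (by omega) hu) (by
    apply LinearMap.ext; intro z
    simp only [LinearMap.comp_apply, ht, hud']; rfl)
  have hwd' : ∀ v, w (td F v) = u (tau F p v) := fun v => LinearMap.congr_fun hwd v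
  have h1 : w ∘ₗ sg F p ∈ Ch B (tdeg (shiftRes F p)) N i := (sg_isDeg F p).ch (by omega) hw
  refine ⟨w ∘ₗ sg F p, h1, ?_⟩
  refine Ch_eq ((td_isDeg _).ch (by omega) h1) hu fun j hj => ?_
  rw [LinearMap.comp_apply, LinearMap.comp_apply, ← sg_td F p j (by omega), hwd', tau_sg]
end evshift
end CX
end Part17

section Part18
open CategoryTheory Opposite Filter IsLocalRing ComplexityTest
namespace CX

theorem finrank_ses {k V W U : Type*} [Field k] [AddCommGroup V] [Module k V] [AddCommGroup W] [Module k W]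
    [AddCommGroup U] [Module k U] [Module.Finite k W] (f : V →ₗ[k] W) (g : W →ₗ[k] U)
    (hf0 : ∀ v, f v = 0 → v = 0) (hg : Function.Surjective g) (he : ∀ w, g w = 0 ↔ ∃ v, f v = w) :
    Module.finrank k U + Module.finrank k V = Module.finrank k W := by
  have hf : Function.Injective f := (injective_iff_map_eq_zero f).2 hf0
  have h1 := LinearMap.finrank_range_add_finrank_ker g
  rw [LinearMap.range_eq_top.2 hg, finrank_top] at h1
  have h2 : LinearMap.ker g = LinearMap.range f := by
    ext w
    rw [LinearMap.mem_ker, he, LinearMap.mem_range]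
  rw [h2, LinearMap.finrank_range_of_inj hf] at h1
  exact h1

section betti
variable {B k : Type*} [CommRing B] [Field k] (π : B →+* k) {J J2 J3 : Type*} {K : Type*} [AddCommGroup K] [Module B K]
  {deg : J → ℕ} {deg2 : J2 → ℕ} {deg3 : J3 → ℕ} {d : (J →₀ B) →ₗ[B] (J →₀ B)} {d2 : (J2 →₀ B) →ₗ[B] (J2 →₀ B)}
  {d3 : (J3 →₀ B) →ₗ[B] (J3 →₀ B)} {η : (J2 →₀ B) →ₗ[B] (J →₀ B)} {aug : (J ⊕ J2 →₀ B) →ₗ[B] K}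
  {aug3 : (J3 →₀ B) →ₗ[B] K}

theorem betti_cone (hη : IsDeg deg2 deg 0 1 η) (hd : bc π d = 0) (hd2 : bc π d2 = 0) (hd3 : bc π d3 = 0)
    (fin : ∀ n, {j | deg j = n}.Finite) (fin2 : ∀ n, {j | deg2 j = n}.Finite)
    (hC : IsRes (Sum.elim deg deg2) (blk d η 0 (-d2)) aug) (hG : IsRes deg3 d3 aug3) (n : ℕ)
    (hinj : ∀ u ∈ Ch k deg k n, u ∘ₗ bc π η = 0 → u = 0)
    (hinj' : ∀ u ∈ Ch k deg k (n + 1), u ∘ₗ bc π η = 0 → u = 0) :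
    {j | deg3 j = n + 1}.ncard + {j | deg j = n}.ncard = {j | deg2 j = n + 1}.ncard := by
  obtain ⟨φ, hφ1, hφ2, hφ3⟩ := hC.lift hG LinearMap.id
  obtain ⟨ψ, hψ1, hψ2, hψ3⟩ := hG.lift hC LinearMap.id
  have hψ2' : ∀ v, blk d η 0 (-d2) (ψ v) = ψ (d3 v) := fun v => LinearMap.congr_fun hψ2 v
  have hφ2' : ∀ v, d3 (φ v) = φ (blk d η 0 (-d2) v) := fun v => LinearMap.congr_fun hφ2 v
  have hψ3' : ∀ v, aug (ψ v) = aug3 v := fun v => LinearMap.congr_fun hψ3 v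
  have hφ3' : ∀ v, aug3 (φ v) = aug v := fun v => LinearMap.congr_fun hφ3 v
  obtain ⟨s, hs1, hs2⟩ := hG.homotopy hG (LinearMap.id - φ ∘ₗ ψ) (IsDeg.id.sub (hφ1.comp hψ1))
    (by apply LinearMap.ext; intro z; simp [hφ2', hψ2']) (by apply LinearMap.ext; intro z; simp [hφ3', hψ3'])
  obtain ⟨s', hs1', hs2'⟩ := hC.homotopy hC (LinearMap.id - ψ ∘ₗ φ) (IsDeg.id.sub (hψ1.comp hφ1))
    (by apply LinearMap.ext; intro z; simp only [LinearMap.comp_apply, LinearMap.sub_apply, LinearMap.id_apply, map_sub, hφ2', hψ2'])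
    (by apply LinearMap.ext; intro z; simp [hφ3', hψ3'])
  -- reductions
  have hDb : bc π (blk d η 0 (-d2)) = blk 0 (bc π η) 0 0 := by
    rw [bc_blk, hd, bc_neg, hd2, bc_zero]
    congr 1
    apply LinearMap.ext; intro z
    simp
  have r1 : ∀ v, bc π φ (bc π ψ v) = v := by
    intro v
    have h1 := congrArg (bc π) hs2
    rw [bc_sub, bc_add, bc_comp, bc_comp, bc_comp, hd3, bc_id] at h1
    have h2 := LinearMap.congr_fun h1 v
    simp only [LinearMap.sub_apply, LinearMap.comp_apply, LinearMap.id_apply, LinearMap.add_apply, LinearMap.zero_apply,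
      map_zero, add_zero] at h2
    exact (sub_eq_zero.1 h2).symm
  set D : (J ⊕ J2 →₀ k) →ₗ[k] (J ⊕ J2 →₀ k) := blk 0 (bc π η) 0 0 with hDdef
  have r2 : ∀ v, v - bc π ψ (bc π φ v) = D (bc π s' v) + bc π s' (D v) := by
    intro v
    have h1 := congrArg (bc π) hs2'
    rw [bc_sub, bc_add, bc_comp, bc_comp, bc_comp, hDb, bc_id] at h1
    exact LinearMap.congr_fun h1 v
  have r3 : ∀ v, bc π φ (D v) = 0 := by
    intro v
    have h1 := congrArg (bc π) hφ2
    rw [bc_comp, bc_comp, hDb, hd3] at h1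
    have h2 := LinearMap.congr_fun h1 v
    exact h2.symm
  have r4 : ∀ v, D (bc π ψ v) = 0 := by
    intro v
    have h1 := congrArg (bc π) hψ2
    rw [bc_comp, bc_comp, hDb, hd3] at h1
    have h2 := LinearMap.congr_fun h1 v
    simpa using h2
  have hplD : ∀ v, pl k J J2 (D v) = bc π η (pR k J J2 v) := by intro v; simp [hDdef]
  have hpRD : ∀ v, pR k J J2 (D v) = 0 := by intro v; simp [hDdef]
  have hηb := bc_isDeg π hη
  have hψb := bc_isDeg π hψ1
  have hφb := bc_isDeg π hφ1
  have hsb := bc_isDeg π hs1'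
  have hpl : ∀ {m : ℕ} {u}, u ∈ Ch k deg k m → u ∘ₗ pl k J J2 ∈ Ch k (Sum.elim deg deg2) k m := by
    intro m u hu
    rintro (j | j) hj
    · have hj' : deg j ≠ m := hj
      simp [hu j hj']
    · simp
  have hpR : ∀ {m : ℕ} {u}, u ∈ Ch k deg2 k m → u ∘ₗ pR k J J2 ∈ Ch k (Sum.elim deg deg2) k m := by
    intro m u hu
    rintro (j | j) hj
    · simp
    · have hj' : deg2 j ≠ m := hj
      simp [hu j hj']
  have hil : ∀ {m : ℕ} {u}, u ∈ Ch k (Sum.elim deg deg2) k m → u ∘ₗ il k J J2 ∈ Ch k deg k m := by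
    intro m u hu j hj
    rw [LinearMap.comp_apply, il_e]
    exact hu _ hj
  have hir : ∀ {m : ℕ} {u}, u ∈ Ch k (Sum.elim deg deg2) k m → u ∘ₗ ir k J J2 ∈ Ch k deg2 k m := by
    intro m u hu j hj
    rw [LinearMap.comp_apply, ir_e]
    exact hu _ hj
  have huu : ∀ (u : (J ⊕ J2 →₀ k) →ₗ[k] k) v, u v = u (il k J J2 (pl k J J2 v)) + u (ir k J J2 (pR k J J2 v)) := by
    intro u v
    rw [← map_add, ilpl_add]
  let f : Ch k deg k n →ₗ[k] Ch k deg2 k (n + 1) :=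
    (LinearMap.lcomp k k (bc π η)).restrict (fun u hu => hηb.ch (by omega) hu)
  let g : Ch k deg2 k (n + 1) →ₗ[k] Ch k deg3 k (n + 1) :=
    (LinearMap.lcomp k k (pR k J J2 ∘ₗ bc π ψ)).restrict (fun u hu => hψb.ch (by omega) (hpR hu))
  have hf : ∀ u, ((f u : Ch k deg2 k (n + 1)) : (J2 →₀ k) →ₗ[k] k) = u.1 ∘ₗ bc π η := fun u => rfl
  have hg : ∀ u, ((g u : Ch k deg3 k (n + 1)) : (J3 →₀ k) →ₗ[k] k) = u.1 ∘ₗ (pR k J J2 ∘ₗ bc π ψ) := fun u => rfl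
  haveI := Ch_finite (k := k) (fin2 (n + 1))
  rw [← Ch_finrank (k := k) (hG.fin (n + 1)), ← Ch_finrank (k := k) (fin n), ← Ch_finrank (k := k) (fin2 (n + 1))]
  refine finrank_ses (k := k) (V := Ch k deg k n) (W := Ch k deg2 k (n + 1)) (U := Ch k deg3 k (n + 1)) f g ?_ ?_ ?_
  · intro u hu
    have h1 := congrArg Subtype.val hu
    rw [hf] at h1
    exact Subtype.ext (hinj u.1 u.2 h1)
  · rintro ⟨u, hu⟩
    have h1 : u ∘ₗ bc π φ ∈ Ch k (Sum.elim deg deg2) k (n + 1) := hφb.ch (by omega) hu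
    have h2 : (u ∘ₗ bc π φ) ∘ₗ il k J J2 = 0 := by
      refine hinj' _ (hil h1) ?_
      apply LinearMap.ext; intro v
      have h3 := r3 (ir k J J2 v)
      have h4 : D (ir k J J2 v) = il k J J2 (bc π η v) := by
        apply blk_ext
        · rw [hplD]; simp
        · rw [hpRD]; simp
      rw [h4] at h3
      simp only [LinearMap.comp_apply, h3, map_zero]; rfl
    refine ⟨⟨_, hir h1⟩, ?_⟩
    apply Subtype.ext
    rw [hg]
    apply LinearMap.ext; intro v
    have h3 := huu (u ∘ₗ bc π φ) (bc π ψ v)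
    have h5 := LinearMap.congr_fun h2 (pl k J J2 (bc π ψ v))
    simp only [LinearMap.comp_apply, LinearMap.zero_apply] at h3 h5 ⊢
    rw [r1, h5, zero_add] at h3
    exact h3.symm
  · rintro ⟨u, hu⟩
    constructor
    · intro h0
      have h1 := congrArg Subtype.val h0
      rw [hg] at h1
      have h1' : ∀ v, u (pR k J J2 (bc π ψ v)) = 0 := fun v => LinearMap.congr_fun h1 v
      have h2 : (u ∘ₗ pR k J J2) ∘ₗ bc π s' ∈ Ch k (Sum.elim deg deg2) k n := hsb.ch (by omega) (hpR hu)
      refine ⟨⟨_, hil h2⟩, ?_⟩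
      apply Subtype.ext
      rw [hf]
      apply LinearMap.ext; intro v
      have h3 := congrArg (fun z => u (pR k J J2 z)) (r2 (ir k J J2 v))
      simp only [map_sub, map_add, h1', hpRD, pR_ir, map_zero, zero_add, sub_zero] at h3
      have h4 : D (ir k J J2 v) = il k J J2 (bc π η v) := by
        apply blk_ext
        · rw [hplD]; simp
        · rw [hpRD]; simp
      rw [h4] at h3
      exact h3.symm
    · rintro ⟨w, hw⟩
      apply Subtype.ext
      rw [hg, ← hw, hf]
      apply LinearMap.ext; intro v
      have h3 := congrArg (pl k J J2) (r4 v)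
      rw [hplD, map_zero] at h3
      simp only [LinearMap.comp_apply, h3, map_zero]
      rfl
end betti

section nullh
variable {A : Type u} [CommRing A] [IsLocalRing A] {X : Type u} [AddCommGroup X] [Module A X] (F : MinFreeRes A X)

theorem bc_td : bc (residue A) (td F) = 0 :=
  bc_eq_zero _ fun j l => (residue_eq_zero_iff _).2 (td_minimal F j l)

theorem eta_pow {q N : ℕ} {η : (TJ F →₀ A) →ₗ[A] (TJ F →₀ A)} (hη : IsDeg (tdeg F) (tdeg F) 0 q η)
    (hc : td F ∘ₗ η = η ∘ₗ td F)
    (hinj : ∀ n ≥ N, ∀ u ∈ Ch (ResidueField A) (tdeg F) (ResidueField A) n, u ∘ₗ bc (residue A) η = 0 → u = 0) (m : ℕ) :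
    ∃ θ : (TJ F →₀ A) →ₗ[A] (TJ F →₀ A), IsDeg (tdeg F) (tdeg F) 0 (m * q) θ ∧ td F ∘ₗ θ = θ ∘ₗ td F ∧
      ∀ n ≥ N, ∀ u ∈ Ch (ResidueField A) (tdeg F) (ResidueField A) n, u ∘ₗ bc (residue A) θ = 0 → u = 0 := by
  induction m with
  | zero =>
    refine ⟨LinearMap.id, IsDeg.id.cast (by omega), by simp, ?_⟩
    intro n hn u hu h0
    rw [bc_id] at h0
    simpa using h0
  | succ m ih =>
    obtain ⟨θ, h1, h2, h3⟩ := ih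
    refine ⟨θ ∘ₗ η, (h1.comp hη).cast (by ring), ?_, ?_⟩
    · rw [← LinearMap.comp_assoc, h2, LinearMap.comp_assoc, hc, LinearMap.comp_assoc]
    · intro n hn u hu h0
      rw [bc_comp, ← LinearMap.comp_assoc] at h0
      refine h3 n hn u hu (hinj (n + m * q) (by omega) _ ((bc_isDeg _ h1).ch (by omega) hu) h0)

theorem null_lemma {q N i0 : ℕ} (hq : 1 ≤ q) {η : (TJ F →₀ A) →ₗ[A] (TJ F →₀ A)}
    (hη : IsDeg (tdeg F) (tdeg F) 0 q η) (hc : td F ∘ₗ η = η ∘ₗ td F)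
    (hinj : ∀ n ≥ N, ∀ u ∈ Ch (ResidueField A) (tdeg F) (ResidueField A) n, u ∘ₗ bc (residue A) η = 0 → u = 0)
    (hE : ∀ i ≥ i0, EV (tdeg F) (td F) X i) : ∀ n ≥ N, F.b n = 0 := by
  obtain ⟨θ, h1, h2, h3⟩ := eta_pow F hη hc hinj (i0 + 1)
  obtain ⟨i, hi, hi0⟩ : ∃ i, (i0 + 1) * q = i + 1 ∧ i0 ≤ i := by
    refine ⟨(i0 + 1) * q - 1, ?_, ?_⟩ <;> have := Nat.mul_le_mul_left (i0 + 1) hq <;> omega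
  rw [hi] at h1
  have hR := t_isRes F
  have h2' : ∀ v, td F (θ v) = θ (td F v) := fun v => LinearMap.congr_fun h2 v
  have had : ∀ v, taug F (td F v) = 0 := fun v => LinearMap.congr_fun hR.augd v
  obtain ⟨w, hw, hwd⟩ := hE i hi0 (taug F ∘ₗ θ) (h1.ch (by omega) hR.haug) (by
    apply LinearMap.ext; intro z
    simp only [LinearMap.comp_apply, ← h2', had]; rfl)
  have hwd' : ∀ v, w (td F v) = taug F (θ v) := fun v => LinearMap.congr_fun hwd v
  choose s hs hs' using fun j => hR.surj0 (w (e A j))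
  have hs0 : taug F ∘ₗ mkOp (B := A) s = w := by
    apply op_ext; intro j
    rw [LinearMap.comp_apply, mkOp_e, hs']
  have hs0' : ∀ v, taug F (mkOp (B := A) s v) = w v := fun v => LinearMap.congr_fun hs0 v
  obtain ⟨S, hS1, hS2, hS3⟩ := HL (deg := tdeg F) (deg' := tdeg F) (d := td F) (d' := td F) hR.hd hR.dd hR.acy (i + 1) θ h1 h2
    (mkOp s) (fun j _ => by rw [mkOp_e]; exact hs j) (by
    intro j hj
    refine hR.exact0 (Submodule.sub_mem _ (h1.e_mem (by omega)) ?_) ?_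
    · have h5 : td F (e A j) ∈ Hg A (tdeg F) i := hR.hd.e_mem (by omega)
      exact Hg_map (fun l _ => by rw [mkOp_e]; exact hs l) h5
    · rw [map_sub, hs0', hwd', sub_self])
  have hmax : ∀ v l, td F v l ∈ maximalIdeal A := by
    intro v l
    have h6 : v ∈ Submodule.comap (Finsupp.lapply l ∘ₗ td F) (maximalIdeal A) := by
      rw [sum_e v]
      exact Submodule.sum_mem _ fun j _ => Submodule.smul_mem _ _ (td_minimal F j l)
    exact h6
  have hmr : ∀ v, mr (residue A) (td F v) = 0 := by
    intro v
    ext l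
    rw [mr_apply, (residue_eq_zero_iff _).2 (hmax v l)]; rfl
  intro n hn
  rw [← t_card F n, ← Ch_finrank (k := ResidueField A) (hR.fin n)]
  have hz : ∀ u : Ch (ResidueField A) (tdeg F) (ResidueField A) n, u = 0 := by
    rintro ⟨u, hu⟩
    apply Subtype.ext
    refine h3 n hn u hu ?_
    refine Ch_eq ((bc_isDeg _ h1).ch (n := n + (i + 1)) (by omega) hu) (Submodule.zero_mem _) fun j hj => ?_
    rw [LinearMap.comp_apply, bc_e, hS3 j (by omega), map_add, hmr, ← bc_mr, hmr]
    simp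
  haveI : Subsingleton (Ch (ResidueField A) (tdeg F) (ResidueField A) n) := ⟨fun a b => by rw [hz a, hz b]⟩
  exact Module.finrank_zero_of_subsingleton
end nullh
end CX
end Part18

section Part19
open CategoryTheory Opposite Filter IsLocalRing ComplexityTest
namespace CX

section extbridge
variable {A : Type u} [CommRing A] [IsLocalRing A] {M : Type u} [AddCommGroup M] [Module A M] (F : MinFreeRes A M)

theorem d_d (n : ℕ) (x) : F.d n (F.d (n + 1) x) = 0 := (F.exact_succ n).apply_apply_eq_zero x

noncomputable def cpx : ChainComplex (ModuleCat.{u} A) ℕ :=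
  ChainComplex.of (fun n => ModuleCat.of A (Fin (F.b n) → A)) (fun n => ModuleCat.ofHom (F.d n)) (fun n => by
    apply ModuleCat.hom_ext
    apply LinearMap.ext; intro x
    exact d_d F n x)

theorem cpx_d (n : ℕ) : (cpx F).d (n + 1) n = ModuleCat.ofHom (F.d n) := by
  exact ChainComplex.of_d (fun n => ModuleCat.of A (Fin (F.b n) → A)) (fun n => ModuleCat.ofHom (F.d n)) n

theorem cpx_aug : (cpx F).d 1 0 ≫ (ModuleCat.ofHom F.aug : (cpx F).X 0 ⟶ ModuleCat.of A M) = 0 := by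
  rw [cpx_d]
  apply ModuleCat.hom_ext
  apply LinearMap.ext; intro x
  exact F.exact_zero.apply_apply_eq_zero _

theorem cpx_exact (n : ℕ) : (cpx F).ExactAt (n + 1) := by
  rw [HomologicalComplex.exactAt_iff' _ (n + 1 + 1) (n + 1) n (by simp) (by simp), ShortComplex.moduleCat_exact_iff]
  intro x hx
  have h1 : (cpx F).d (n + 1) n x = 0 := hx
  rw [cpx_d] at h1
  obtain ⟨y, hy⟩ := (F.exact_succ n x).1 h1
  refine ⟨y, ?_⟩
  change (cpx F).d (n + 1 + 1) (n + 1) y = x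
  rw [cpx_d]
  exact hy

instance cpx_proj (n : ℕ) : Projective ((cpx F).X n) :=
  (IsProjective.iff_projective (Fin (F.b n) → A)).1 inferInstance

noncomputable def presol : ProjectiveResolution (ModuleCat.of A M) where
  complex := cpx F
  π := (ChainComplex.toSingle₀Equiv _ _).symm ⟨ModuleCat.ofHom F.aug, cpx_aug F⟩
  quasiIso := ⟨fun n => by
    cases n
    · rw [ChainComplex.quasiIsoAt₀_iff, ShortComplex.quasiIso_iff_of_zeros']
      · refine (ShortComplex.exact_and_epi_g_iff_of_iso (S₂ := ShortComplex.mk _ _ (cpx_aug F)) ?_).2 ⟨?_, ?_⟩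
        · exact ShortComplex.isoMk (Iso.refl _) (Iso.refl _) (Iso.refl _) (by
            exact (Category.id_comp _).trans (Category.comp_id _).symm) (by
            refine (Category.id_comp _).trans (Eq.trans ?_ (Category.comp_id _).symm)
            exact (ChainComplex.toSingle₀Equiv_symm_apply_f_zero _ (cpx_aug F)).symm)
        · rw [ShortComplex.moduleCat_exact_iff]
          intro x hx
          obtain ⟨y, hy⟩ := (F.exact_zero x).1 hx
          refine ⟨y, ?_⟩
          change (cpx F).d 1 0 y = x
          rw [cpx_d]
          exact hy
        · exact (ModuleCat.epi_iff_surjective _).2 F.aug_surjective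
      all_goals rfl
    · rw [quasiIsoAt_iff_exactAt']
      · apply cpx_exact
      · apply ChainComplex.exactAt_succ_single_obj⟩

theorem extVanish_iff (i : ℕ) (N : Type u) [AddCommGroup N] [Module A N] :
    extVanish A M (i + 1) N ↔ ∀ u : (Fin (F.b (i + 1)) → A) →ₗ[A] N, u ∘ₗ F.d (i + 1) = 0 →
      ∃ w : (Fin (F.b i) → A) →ₗ[A] N, w ∘ₗ F.d i = u := by
  have h0 : extVanish A M (i + 1) N ↔ Limits.IsZero (extModule A M (i + 1) N) :=
    (ModuleCat.isZero_iff_subsingleton).symm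
  rw [h0]
  refine ((presol F).isoExt (R := A) (i + 1) (ModuleCat.of A N)).isZero_iff.trans ?_
  rw [    ← HomologicalComplex.exactAt_iff_isZero_homology,
    HomologicalComplex.exactAt_iff' _ i (i + 1) (i + 1 + 1) (by simp) (by simp), ShortComplex.moduleCat_exact_iff]
  constructor
  · intro h u hu
    obtain ⟨w, hw⟩ := h (ModuleCat.ofHom u : (cpx F).X (i + 1) ⟶ ModuleCat.of A N) (by
      change (cpx F).d (i + 1 + 1) (i + 1) ≫ (ModuleCat.ofHom u : (cpx F).X (i + 1) ⟶ ModuleCat.of A N) = 0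
      rw [cpx_d]
      apply ModuleCat.hom_ext
      exact hu)
    have hw1 : (cpx F).d (i + 1) i ≫ (show (cpx F).X i ⟶ ModuleCat.of A N from w) = ModuleCat.ofHom u := hw
    rw [cpx_d] at hw1
    exact ⟨ModuleCat.Hom.hom (show (cpx F).X i ⟶ ModuleCat.of A N from w), congrArg ModuleCat.Hom.hom hw1⟩
  · intro h u hu
    have hu1 : (cpx F).d (i + 1 + 1) (i + 1) ≫ (show (cpx F).X (i + 1) ⟶ ModuleCat.of A N from u) = 0 := hu
    rw [cpx_d] at hu1
    obtain ⟨w, hw⟩ := h (ModuleCat.Hom.hom (show (cpx F).X (i + 1) ⟶ ModuleCat.of A N from u)) (congrArg ModuleCat.Hom.hom hu1)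
    refine ⟨(ModuleCat.ofHom w : (cpx F).X i ⟶ ModuleCat.of A N), ?_⟩
    change (cpx F).d (i + 1) i ≫ (ModuleCat.ofHom w : (cpx F).X i ⟶ ModuleCat.of A N) = u
    rw [cpx_d]
    apply ModuleCat.hom_ext
    exact hw

theorem EV_of_ext {i : ℕ} {N : Type u} [AddCommGroup N] [Module A N] (h : extVanish A M (i + 1) N) :
    EV (tdeg F) (td F) N i := by
  intro u hu hud
  have hd : ∀ v, u (td F v) = 0 := fun v => LinearMap.congr_fun hud v
  obtain ⟨w, hw⟩ := (extVanish_iff F i N).1 h (u ∘ₗ temb F (i + 1)) (by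
    apply LinearMap.ext; intro z
    have h1 := hd (temb F (i + 1 + 1) z)
    rw [td_succ] at h1
    exact h1)
  refine ⟨w ∘ₗ tres F i, ?_, ?_⟩
  · rintro ⟨m, l⟩ hj
    have hj' : m ≠ i := hj
    rw [← temb_single, LinearMap.comp_apply, tres_temb_ne F hj', map_zero]
  · apply op_ext
    rintro ⟨m, l⟩
    have h1 := LinearMap.congr_fun hw (tres F (i + 1) (e A ⟨m, l⟩))
    rw [LinearMap.comp_apply, LinearMap.comp_apply, ← tres_td] at h1
    rw [LinearMap.comp_apply, LinearMap.comp_apply, h1]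
    by_cases hm : m = i + 1
    · subst hm
      rw [← temb_single, tres_temb]
    · rw [hu ⟨m, l⟩ hm, ← temb_single, tres_temb_ne F hm, map_zero, map_zero]

theorem ext_of_b {i : ℕ} (N : Type u) [AddCommGroup N] [Module A N] (h : F.b (i + 1) = 0) : extVanish A M (i + 1) N := by
  rw [extVanish_iff F]
  intro u _
  refine ⟨0, ?_⟩
  haveI : IsEmpty (Fin (F.b (i + 1))) := by rw [h]; infer_instance
  apply LinearMap.ext; intro z
  rw [Subsingleton.elim z 0]; simp
end extbridge
end CX
end Part19

section Part20
open CategoryTheory Opposite Filter IsLocalRing ComplexityTest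
namespace CX

section numerics

theorem Delta_iter_shift (c : ℕ) (h : ℕ → ℤ) (r : ℕ) : ∀ n, Delta^[r] (fun n => h (n + c)) n = Delta^[r] h (n + c) := by
  induction r with
  | zero => intro n; rfl
  | succ r ih =>
    intro n
    rw [Function.iterate_succ_apply', Function.iterate_succ_apply']
    simp only [Delta]
    rw [ih, ih, show n + 2 + c = n + c + 2 by omega]

theorem Delta_iter_congr {f g : ℕ → ℤ} {N : ℕ} (h : ∀ n ≥ N, f n = g n) (r : ℕ) :
    ∀ n ≥ N, Delta^[r] f n = Delta^[r] g n := by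
  induction r with
  | zero => exact h
  | succ r ih =>
    intro n hn
    rw [Function.iterate_succ_apply', Function.iterate_succ_apply']
    simp only [Delta]
    rw [ih n hn, ih (n + 2) (by omega)]

theorem Delta_drop {h g : ℕ → ℤ} {q r N N' : ℕ} (hg : ∀ n ≥ N, g (n + 1) = h (n + 2 * q) - h n)
    (hh : ∀ n ≥ N', Delta^[r + 1] h n = 0) : ∃ N'', ∀ n ≥ N'', Delta^[r] g n = 0 := by
  have h1 : ∀ n ≥ N', ∀ m, Delta^[r] h (n + 2 * m) = Delta^[r] h n := by
    intro n hn m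
    induction m with
    | zero => rfl
    | succ m ih =>
      have := hh (n + 2 * m) (by omega)
      rw [Function.iterate_succ_apply'] at this
      simp only [Delta] at this
      rw [show n + 2 * (m + 1) = n + 2 * m + 2 by ring]
      linarith
  refine ⟨N + N' + 1, fun n hn => ?_⟩
  obtain ⟨m, rfl⟩ : ∃ m, n = m + 1 := ⟨n - 1, by omega⟩
  rw [← Delta_iter_shift 1 g r m]
  rw [Delta_iter_congr (f := fun n => g (n + 1)) (g := (fun n => h (n + 2 * q)) - h) (N := N) hg r m (by omega),
    Delta_iter_sub, Pi.sub_apply, Delta_iter_shift, h1 m (by omega), sub_self]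

theorem growth_aux {f : ℕ → ℕ} {p N s : ℕ} {a : ℝ} (ha : 0 ≤ a) (hp : 1 ≤ p)
    (h : ∀ n ≥ N, (f (n + p) : ℝ) ≤ f n + a * ((n : ℝ) + 1) ^ s) :
    ∃ C : ℝ, 0 ≤ C ∧ ∀ n ≥ N, (f n : ℝ) ≤ C + a * (n : ℝ) ^ (s + 1) := by
  refine ⟨∑ i ∈ Finset.range (N + p), (f i : ℝ), Finset.sum_nonneg fun _ _ => Nat.cast_nonneg _, ?_⟩
  intro n
  induction n using Nat.strong_induction_on with
  | _ n ih =>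
    intro hn
    by_cases hnp : n < N + p
    · have h1 := Finset.single_le_sum (f := fun i => (f i : ℝ)) (fun _ _ => Nat.cast_nonneg _) (Finset.mem_range.2 hnp)
      have h2 : 0 ≤ a * (n : ℝ) ^ (s + 1) := by positivity
      linarith
    · obtain ⟨m, rfl⟩ : ∃ m, n = m + p := ⟨n - p, by omega⟩
      have h1 := ih m (by omega) (by omega)
      have h2 := h m (by omega)
      have hp' : (1 : ℝ) ≤ p := by exact_mod_cast hp
      have hm : (0 : ℝ) ≤ m := Nat.cast_nonneg _
      have h3 : ((m : ℝ) + 1) ^ s ≤ ((m : ℝ) + p) ^ s := by gcongr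
      have h4 : (m : ℝ) ^ s ≤ ((m : ℝ) + p) ^ s := by gcongr; linarith
      have h5 : (m : ℝ) ^ (s + 1) + ((m : ℝ) + 1) ^ s ≤ ((m : ℝ) + p) ^ (s + 1) := by
        have e1 : (m : ℝ) ^ (s + 1) ≤ ((m : ℝ) + p) ^ s * m := by
          rw [pow_succ]; gcongr
        have e2 : ((m : ℝ) + p) ^ s * (m + 1) ≤ ((m : ℝ) + p) ^ (s + 1) := by
          rw [pow_succ]; gcongr
        nlinarith
      have h6 := mul_le_mul_of_nonneg_left h5 ha
      push_cast
      linarith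

theorem eventually_zero {g : ℕ → ℕ} {a : ℝ}
    (hg : ∀ᶠ n : ℕ in atTop, (g n : ℝ) ≤ a * (n : ℝ) ^ (((0 : ℕ) : ℤ) - 1)) : ∃ N, ∀ n ≥ N, g n = 0 := by
  obtain ⟨N, hN⟩ := eventually_atTop.1 hg
  obtain ⟨m, hm⟩ := exists_nat_gt a
  refine ⟨N + m + 1, fun n hn => ?_⟩
  have h1 := hN n (by omega)
  have hn0 : (0 : ℝ) < n := by exact_mod_cast (show 0 < n by omega)
  have hmn : (m : ℝ) < n := by exact_mod_cast (show m < n by omega)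
  have h2 : a * (n : ℝ) ^ (((0 : ℕ) : ℤ) - 1) < 1 := by
    norm_num
    rw [← div_eq_mul_inv, div_lt_one hn0]
    linarith
  have h3 : (g n : ℝ) < 1 := lt_of_le_of_lt h1 h2
  have h4 : g n < 1 := by exact_mod_cast h3
  omega

theorem growth {f g : ℕ → ℕ} {p N s : ℕ} {a : ℝ} (hp : 1 ≤ p) (h : ∀ n ≥ N, g (n + 1) + f n = f (n + p))
    (hg : ∀ᶠ n : ℕ in atTop, (g n : ℝ) ≤ a * (n : ℝ) ^ ((s : ℤ) - 1)) :
    ∃ C : ℝ, ∀ᶠ n : ℕ in atTop, (f n : ℝ) ≤ C * (n : ℝ) ^ (((s + 1 : ℕ) : ℤ) - 1) := by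
  have hcast : (((s + 1 : ℕ) : ℤ) - 1) = (s : ℤ) := by push_cast; ring
  simp only [hcast, zpow_natCast]
  have h' : ∀ n ≥ N, (f (n + p) : ℝ) = f n + g (n + 1) := by
    intro n hn
    rw [← h n hn]; push_cast; ring
  cases s with
  | zero =>
    obtain ⟨N1, hN1⟩ := eventually_zero hg
    obtain ⟨C, hC, hC'⟩ := growth_aux (f := f) (p := p) (N := N + N1) (s := 0) (a := 0) le_rfl hp (by
      intro n hn
      rw [h' n (by omega), hN1 (n + 1) (by omega)]; simp)
    refine ⟨C, eventually_atTop.2 ⟨N + N1, fun n hn => ?_⟩⟩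
    simpa using hC' n hn
  | succ s =>
    obtain ⟨N1, hN1⟩ := eventually_atTop.1 hg
    have hcast2 : (((s + 1 : ℕ) : ℤ) - 1) = (s : ℤ) := by push_cast; ring
    simp only [hcast2, zpow_natCast] at hN1
    obtain ⟨C, hC, hC'⟩ := growth_aux (f := f) (p := p) (N := N + N1) (s := s) (a := |a|) (abs_nonneg a) hp (by
      intro n hn
      rw [h' n (by omega)]
      have h1 := hN1 (n + 1) (by omega)
      push_cast at h1
      have h2 : a * ((n : ℝ) + 1) ^ s ≤ |a| * ((n : ℝ) + 1) ^ s := by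
        gcongr
        exact le_abs_self a
      linarith)
    refine ⟨C + |a|, eventually_atTop.2 ⟨N + N1 + 1, fun n hn => ?_⟩⟩
    have h1 := hC' n (by omega)
    have h2 : (1 : ℝ) ≤ (n : ℝ) ^ (s + 1) := one_le_pow₀ (by exact_mod_cast (show 1 ≤ n by omega))
    nlinarith
end numerics

section cx
variable {A : Type u} [CommRing A] [IsLocalRing A] {X : Type u} [AddCommGroup X] [Module A X]

theorem cx_le {t : ℕ} (h : HasComplexityLE A X t) : complexity A X ≤ t := sInf_le ⟨t, rfl, h⟩

theorem cx_lt {s : ℕ} (h : complexity A X < s) : ∃ t, t < s ∧ HasComplexityLE A X t := by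
  obtain ⟨c, ⟨t, rfl, ht⟩, hc⟩ := sInf_lt_iff.1 h
  exact ⟨t, by exact_mod_cast hc, ht⟩

theorem cx_zero_of_b (F : MinFreeRes A X) {N : ℕ} (h : ∀ n ≥ N, F.b n = 0) : complexity A X ≤ (0 : ℕ) := by
  refine cx_le ⟨F, 0, eventually_atTop.2 ⟨N, fun n hn => ?_⟩⟩
  rw [h n hn]; simp

variable [IsNoetherianRing A]

theorem main_ind (qd : QuasiDeformation A) {s : ℕ} (hs : 1 ≤ s) : ∀ (r : ℕ) (X : Type u) [AddCommGroup X] [Module A X]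
    [Module.Finite A X] (_ : HasFiniteProjDim qd.Q (TQ qd X)) (F : MinFreeRes A X) (N : ℕ)
    (_ : ∀ n ≥ N, Delta^[r] (fun n => (F.b n : ℤ)) n = 0) (_ : (s : ℕ∞) ≤ complexity A X),
    ∃ (Y : Type u) (_ : AddCommGroup Y) (_ : Module A Y), Module.Finite A Y ∧ HasFiniteCIDim A Y ∧ complexity A Y = s ∧
      ¬ ∃ i0, ∀ i ≥ i0, EV (tdeg F) (td F) Y i := by
  intro r
  induction r with
  | zero =>
    intro X _ _ _ _ F N hN hcx
    exfalso
    have h1 := hcx.trans (cx_zero_of_b F (N := N) fun n hn => by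
      have h3 : (F.b n : ℤ) = 0 := hN n hn
      exact_mod_cast h3)
    have h2 : s ≤ 0 := by exact_mod_cast h1
    omega
  | succ r ih =>
    intro X _ _ _ hX F N hN hcx
    obtain ⟨-, q, η, N1, hq, hη, hc, hinj⟩ := main_reg F qd hX
    rcases hcx.eq_or_lt with heq | hlt
    · refine ⟨X, inferInstance, inferInstance, inferInstance, ⟨qd, hX⟩, heq.symm, ?_⟩
      rintro ⟨i0, hE⟩
      have h0 := null_lemma F (q := 2 * q) (by omega) hη hc hinj hE
      have h1 := hcx.trans (cx_zero_of_b F h0)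
      have h2 : s ≤ 0 := by exact_mod_cast h1
      omega
    · obtain ⟨p, hp⟩ : ∃ p, 2 * q = p + 2 := ⟨2 * q - 2, by omega⟩
      rw [hp] at hη
      have hR := t_isRes F
      have hR2 := t_isRes (shiftRes F p)
      have hη2 := eta2_isDeg F hη
      have hc2 := eta2_chain F hη hc
      obtain ⟨f, g, hf, he, hg⟩ := KK_ses hR hR2 hη2 hc2
      have hKpd : HasFiniteProjDim qd.Q (TQ qd (KK (tdeg (shiftRes F p)) (td (shiftRes F p)) (taug F) (η ∘ₗ sg F p))) :=
        TQ_ext F hX p hf he hg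
      haveI := KK_finite hR hR2 hη2 hc2
      have hcone := cone_isRes hR hR2 hη2 hc2
      have hbetti : ∀ (G : MinFreeRes A (KK (tdeg (shiftRes F p)) (td (shiftRes F p)) (taug F) (η ∘ₗ sg F p))),
          ∀ n ≥ N1, G.b (n + 1) + F.b n = F.b (n + 2 * q) := by
        intro G n hn
        have h1 := betti_cone (residue A) hη2 (bc_td F) (bc_td (shiftRes F p)) (bc_td G) hR.fin hR2.fin hcone (t_isRes G) n
          (eta2_inj F (residue A) hη (hinj n hn)) (eta2_inj F (residue A) hη (hinj (n + 1) (by omega)))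
        rw [t_card, t_card, t_card] at h1
        rw [h1]
        change F.b (p + 1 + (n + 1)) = _
        congr 1
        omega
      obtain ⟨G⟩ := exists_minres_noeth (B := A) (KK (tdeg (shiftRes F p)) (td (shiftRes F p)) (taug F) (η ∘ₗ sg F p))
      obtain ⟨N2, hN2⟩ := Delta_drop (h := fun n => (F.b n : ℤ)) (g := fun n => (G.b n : ℤ)) (q := q) (N := N1)
        (fun n hn => by
          have := hbetti G n hn
          rw [← this]; push_cast; ring) hN
      obtain ⟨Y, i1, i2, hYf, hYci, hYcx, hYE⟩ := ih (KK (tdeg (shiftRes F p)) (td (shiftRes F p)) (taug F) (η ∘ₗ sg F p))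
        hKpd G N2 hN2 (by
          by_contra hlt2
          obtain ⟨t, hts, R, a, hR'⟩ := cx_lt (not_le.1 hlt2)
          obtain ⟨C, hC⟩ := growth (f := F.b) (g := R.b) (p := 2 * q) (by omega) (hbetti R) hR'
          have h3 : complexity A X ≤ ((t + 1 : ℕ) : ℕ∞) := cx_le ⟨F, C, hC⟩
          have h4 : (s : ℕ∞) < ((t + 1 : ℕ) : ℕ∞) := lt_of_lt_of_le hlt h3
          have h5 : s < t + 1 := by exact_mod_cast h4
          omega)
      refine ⟨Y, i1, i2, hYf, hYci, hYcx, ?_⟩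
      rintro ⟨i0, hE⟩
      refine hYE ⟨i0, fun i hi => ?_⟩
      exact EV_transfer hcone (t_isRes G) (EV_cone hη2 hc2 (hE i hi) (EV_shift F (hE _ (by omega))))

theorem part_one [Module.Finite A X] (hM : HasFiniteCIDim A X) {t : ℕ} (ht : 0 < t)
    (h : ∀ (N : Type u) [AddCommGroup N] [Module A N] [Module.Finite A N],
        HasFiniteCIDim A N → complexity A N = t → ∀ᶠ i in Filter.atTop, extVanish A X i N) :
    complexity A X < (t : ℕ∞) := by
  by_contra hcx
  obtain ⟨qd, hqd⟩ := hM
  obtain ⟨F⟩ := exists_minres_noeth (B := A) X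
  obtain ⟨⟨r, N, hN⟩, -⟩ := main_reg F qd hqd
  obtain ⟨Y, i1, i2, hYf, hYci, hYcx, hYE⟩ := main_ind qd ht r X hqd F N hN (not_lt.1 hcx)
  obtain ⟨i0, hi0⟩ := eventually_atTop.1 (h Y hYci hYcx)
  exact hYE ⟨i0, fun i hi => EV_of_ext F (hi0 (i + 1) (by omega))⟩

theorem finPd_of_cx (h : complexity A X < ((1 : ℕ) : ℕ∞)) : HasFiniteProjDim A X := by
  obtain ⟨t, ht, R, a, hR⟩ := cx_lt h
  obtain rfl : t = 0 := by omega
  obtain ⟨N, hN⟩ := eventually_zero hR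
  exact ⟨N, R, fun i hi => hN i (by omega)⟩

theorem ext_of_finPd (h : HasFiniteProjDim A X) (N : Type u) [AddCommGroup N] [Module A N] :
    ∀ᶠ i in Filter.atTop, extVanish A X i N := by
  obtain ⟨t, F, hF⟩ := h
  refine eventually_atTop.2 ⟨t + 1, fun i hi => ?_⟩
  obtain ⟨j, rfl⟩ : ∃ j, i = j + 1 := ⟨i - 1, by omega⟩
  exact ext_of_b F N (hF _ (by omega))
end cx
end CX
end Part20

/-- **Theorem 3.2 / Corollary 3.3 for complete intersection dimension**: let `M` be a
module of finite complete intersection dimension over the local ring `A` and `t` a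
(positive) natural number. If `Ext^i_A(M,N) = 0` for `i ≫ 0` for every module `N` of
finite complete intersection dimension with `cx N = t`, then `cx M < t`. In particular,
`M` has finite projective dimension if and only if `Ext^i_A(M,N) = 0` for `i ≫ 0` for
every `N` of finite complete intersection dimension with `cx N = 1`. -/
theorem complexity_lt_of_extVanish_against_ciDim
    (A : Type u) [CommRing A] [IsLocalRing A] [IsNoetherianRing A]
    (M : Type u) [AddCommGroup M] [Module A M] [Module.Finite A M]
    (hM : HasFiniteCIDim A M) :
    (∀ t : ℕ, 0 < t →
      (∀ (N : Type u) [AddCommGroup N] [Module A N] [Module.Finite A N],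
        HasFiniteCIDim A N → complexity A N = t →
          ∀ᶠ i in Filter.atTop, extVanish A M i N) →
      complexity A M < (t : ℕ∞)) ∧
    (HasFiniteProjDim A M ↔
      ∀ (N : Type u) [AddCommGroup N] [Module A N] [Module.Finite A N],
        HasFiniteCIDim A N → complexity A N = 1 →
          ∀ᶠ i in Filter.atTop, extVanish A M i N) := by
  refine ⟨fun t ht h => CX.part_one hM ht h, fun h N _ _ _ _ _ => CX.ext_of_finPd h N, fun h => ?_⟩
  refine CX.finPd_of_cx (CX.part_one hM Nat.one_pos fun N _ _ _ h1 h2 => h N h1 ?_)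
  rw [h2, Nat.cast_one]
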